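/- Let A be a commutative Noetherian Cohen-Macaulay ring of Krull dimension one, let π ∈ A be a nonzerodivisor such that the Krull dimension of A/πA is zero, and let R = A[x_1,...,x_n] be a polynomial ring over A. Then for every ideal I of R, every integer i ≥ 0, every prime ideal P of R containing π, and every integer j ≥ 0, the Bass number μ_j(P, H^i_I(R)) is finite. -/

import Mathlib

/-!
STATEMENT 6: Let `A` be a commutative Noetherian Cohen-Macaulay ring of Krull dimension
one, let `π ∈ A` be a nonzerodivisor with `dim (A/πA) = 0`, and let `R` be a polynomial
ring in `n` variables over `A`.  Then for every ideal `I` of `R`, every `i ≥ 0`, every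
prime ideal `P` of `R` containing `π` and every `j ≥ 0`, the Bass number
`μ_j(P, H^i_I(R))` is finite.
-/

universe u

open CategoryTheory

/-- A Noetherian local ring is Cohen-Macaulay if its depth equals its Krull dimension,
equivalently (for a Noetherian local ring) if there is a regular sequence contained in the
maximal ideal whose length is the Krull dimension. -/
def IsCohenMacaulayLocalRing (R : Type u) [CommRing R] [IsLocalRing R] : Prop :=
  ∃ rs : List R, (∀ r ∈ rs, r ∈ IsLocalRing.maximalIdeal R) ∧
    RingTheory.Sequence.IsRegular R rs ∧ (rs.length : WithBot ℕ∞) = ringKrullDim R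

/-- A commutative Noetherian ring is Cohen-Macaulay if its localization at every prime
ideal is a Cohen-Macaulay local ring. -/
def IsCohenMacaulayRing (A : Type u) [CommRing A] : Prop :=
  ∀ (P : Ideal A) (hP : P.IsPrime),
    haveI := hP
    IsCohenMacaulayLocalRing (Localization.AtPrime P)

/-- The Ext module `Ext^j_{R_P}(κ(P), M_P)` whose `κ(P)`-dimension is the `j`-th Bass
number `μ_j(P, M)` of the `R`-module `M` with respect to the prime ideal `P`. -/
noncomputable def bassExtModule (R : Type u) [CommRing R] (P : Ideal R) [P.IsPrime] (j : ℕ)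
    (M : ModuleCat.{u} R) : ModuleCat.{u} (Localization.AtPrime P) :=
  ((Ext (Localization.AtPrime P) (ModuleCat.{u} (Localization.AtPrime P)) j).obj
    (Opposite.op (ModuleCat.of _ (IsLocalRing.ResidueField (Localization.AtPrime P))))).obj
    (ModuleCat.of _ (LocalizedModule P.primeCompl M))

noncomputable section
open CategoryTheory Opposite
namespace LCB

section ExtCompare
variable {R : Type u} [CommRing R] {X Y : ModuleCat.{u} R}

/-- The Hom complex of a projective resolution. -/
abbrev homCx (P : ProjectiveResolution X) (Y : ModuleCat.{u} R) : CochainComplex (ModuleCat R) ℕ :=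
  P.complex.linearYonedaObj R Y

lemma homCx_d (P : ProjectiveResolution X) (i j : ℕ) (f : P.complex.X i ⟶ Y) :
    ((homCx P Y).d i j).hom f = P.complex.d j i ≫ f := rfl

/-- the cocycle underlying an element of the cycles -/
def cyc (P : ProjectiveResolution X) (Y : ModuleCat.{u} R) (n : ℕ) :
    (homCx P Y).cycles n →ₗ[R] (P.complex.X n ⟶ Y) := ((homCx P Y).iCycles n).hom

lemma cyc_inj (P : ProjectiveResolution X) (Y : ModuleCat.{u} R) (n : ℕ) :
    Function.Injective (cyc P Y n) :=
  (ModuleCat.mono_iff_injective ((homCx P Y).iCycles n)).1 inferInstance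

lemma cyc_d (P : ProjectiveResolution X) (n : ℕ) (z : (homCx P Y).cycles n) :
    P.complex.d (n+1) n ≫ cyc P Y n z = 0 := by
  have := (homCx P Y).iCycles_d n (n+1)
  exact congrArg (fun f => f.hom z) this

lemma cyc_surj (P : ProjectiveResolution X) (n : ℕ) (f : P.complex.X n ⟶ Y)
    (hf : P.complex.d (n+1) n ≫ f = 0) : ∃ z, cyc P Y n z = f := by
  let k : ModuleCat.of R R ⟶ (homCx P Y).X n := ModuleCat.ofHom (LinearMap.toSpanSingleton R _ f)
  have hk : k ≫ (homCx P Y).d n (n+1) = 0 := by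
    ext
    change P.complex.d (n+1) n ≫ ((1:R) • f) = 0
    rw [one_smul]; exact hf
  refine ⟨((homCx P Y).liftCycles k (n+1) (by simp) hk).hom 1, ?_⟩
  have := (homCx P Y).liftCycles_i k (n+1) (by simp) hk
  have h2 := congrArg (fun f => f.hom (1:R)) this
  refine h2.trans ?_
  change (1:R) • f = f
  simp

/-- class in the old Ext -/
def aOld (P : ProjectiveResolution X) (Y : ModuleCat.{u} R) (n : ℕ) :
    (homCx P Y).cycles n →ₗ[R] ((Ext R (ModuleCat.{u} R) n).obj (op X)).obj Y :=
  ((homCx P Y).homologyπ n ≫ (P.isoExt n Y).inv).hom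

lemma smul_extMk (P : ProjectiveResolution X) {n : ℕ} (f : P.complex.X n ⟶ Y)
    (hf : P.complex.d (n+1) n ≫ f = 0) (r : R) :
    r • P.extMk f (n+1) rfl hf = P.extMk (r • f) (n+1) rfl (by simp [hf]) := by
  rw [Abelian.Ext.smul_eq_comp_mk₀, P.extMk_comp_mk₀]
  congr 1

/-- class in the new Ext -/
def aNew (P : ProjectiveResolution X) (Y : ModuleCat.{u} R) (n : ℕ) :
    (homCx P Y).cycles n →ₗ[R] Abelian.Ext.{u} X Y n where
  toFun z := P.extMk (cyc P Y n z) (n+1) rfl (cyc_d P n z)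
  map_add' a b := by
    rw [P.add_extMk]; congr 1; simp
  map_smul' r a := by
    rw [RingHom.id_apply, smul_extMk]; congr 1; simp

lemma aNew_surj (P : ProjectiveResolution X) (Y : ModuleCat.{u} R) (n : ℕ) :
    Function.Surjective (aNew P Y n) := by
  intro e
  obtain ⟨f, hf, rfl⟩ := P.extMk_surjective e (n+1) rfl
  obtain ⟨z, rfl⟩ := cyc_surj P n f hf
  exact ⟨z, rfl⟩

lemma aOld_surj (P : ProjectiveResolution X) (Y : ModuleCat.{u} R) (n : ℕ) :
    Function.Surjective (aOld P Y n) := by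
  exact (ModuleCat.epi_iff_surjective ((homCx P Y).homologyπ n ≫ (P.isoExt n Y).inv)).1
    inferInstance

lemma aOld_ker (P : ProjectiveResolution X) (Y : ModuleCat.{u} R) (n : ℕ) :
    LinearMap.ker (aOld P Y n) =
      LinearMap.range ((homCx P Y).toCycles ((ComplexShape.up ℕ).prev n) n).hom := by
  have h1 : LinearMap.ker (aOld P Y n) = LinearMap.ker ((homCx P Y).homologyπ n).hom := by
    ext z
    have hi : Function.Injective (P.isoExt (R := R) n Y).inv.hom :=
      (ModuleCat.mono_iff_injective _).1 inferInstance
    simp only [LinearMap.mem_ker]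
    change (P.isoExt (R := R) n Y).inv.hom (((homCx P Y).homologyπ n).hom z) = 0 ↔ _
    exact map_eq_zero_iff _ hi
  rw [h1]
  have hex : (ShortComplex.mk _ _ ((homCx P Y).toCycles_comp_homologyπ
      ((ComplexShape.up ℕ).prev n) n)).Exact :=
    ShortComplex.exact_of_g_is_cokernel _ ((homCx P Y).homologyIsCokernel _ n rfl)
  exact hex.moduleCat_range_eq_ker.symm

lemma aNew_ker (P : ProjectiveResolution X) (Y : ModuleCat.{u} R) (n : ℕ) :
    LinearMap.ker (aNew P Y n) =
      LinearMap.range ((homCx P Y).toCycles ((ComplexShape.up ℕ).prev n) n).hom := by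
  have key : ∀ (p : ℕ) (g : P.complex.X p ⟶ Y),
      cyc P Y n (((homCx P Y).toCycles p n).hom g) = P.complex.d n p ≫ g := by
    intro p g
    exact congrArg (fun f => f.hom g) ((homCx P Y).toCycles_i p n)
  ext z
  simp only [LinearMap.mem_ker, LinearMap.mem_range]
  change P.extMk (cyc P Y n z) (n+1) rfl (cyc_d P n z) = 0 ↔ _
  rcases n with _ | p
  · constructor
    · intro h
      refine ⟨0, ?_⟩
      rw [map_zero]
      symm
      apply cyc_inj
      rw [map_zero]
      rw [← P.extEquivCohomologyClass.apply_eq_iff_eq] at h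
      rw [P.extEquivCohomologyClass_extMk, P.extEquivCohomologyClass_zero,
        CochainComplex.HomComplex.CohomologyClass.mk_eq_zero_iff,
        CochainComplex.HomComplex.Cocycle.toSingleMk_mem_coboundaries_iff _ _ _ _ _ 1 (by simp)] at h
      obtain ⟨g, hg⟩ := h
      have hz : (P.cochainComplex.d (-(0:ℕ)) 1) = 0 := by
        apply (P.cochainComplex.isZero_of_isStrictlyLE 0 1 (by simp)).eq_of_tgt
      rw [hz, Limits.zero_comp] at hg
      rw [← cancel_epi (P.cochainComplexXIso (-(0:ℕ)) 0 rfl).hom]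
      exact hg.symm.trans (by simp)
    · rintro ⟨g, hg⟩
      have : (homCx P Y).toCycles ((ComplexShape.up ℕ).prev 0) 0 = 0 := by
        rw [← cancel_mono ((homCx P Y).iCycles 0), HomologicalComplex.toCycles_i]
        rw [(homCx P Y).shape, Limits.zero_comp]
        simp
      rw [this] at hg
      have hz : z = 0 := hg.symm
      subst hz
      simp
  · rw [P.extMk_eq_zero_iff _ _ _ _ p rfl]
    have hp : (ComplexShape.up ℕ).prev (p+1) = p := by simp
    rw [hp]
    constructor
    · rintro ⟨g, hg⟩
      exact ⟨g, cyc_inj P Y _ ((key p g).trans hg)⟩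
    · rintro ⟨g, rfl⟩
      exact ⟨g, (key p g).symm⟩

/-- comparison of the two Ext modules -/
def extEquiv (X Y : ModuleCat.{u} R) (n : ℕ) :
    ((Ext R (ModuleCat.{u} R) n).obj (op X)).obj Y ≃ₗ[R] Abelian.Ext.{u} X Y n :=
  ((aOld (projectiveResolution X) Y n).quotKerEquivOfSurjective (aOld_surj _ _ _)).symm ≪≫ₗ
    Submodule.quotEquivOfEq _ _ ((aOld_ker _ _ _).trans (aNew_ker _ _ _).symm) ≪≫ₗ
    (aNew (projectiveResolution X) Y n).quotKerEquivOfSurjective (aNew_surj _ _ _)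

lemma extEquiv_aOld (n : ℕ) (z) :
    extEquiv X Y n (aOld (projectiveResolution X) Y n z) = aNew (projectiveResolution X) Y n z := by
  have : ((aOld (projectiveResolution X) Y n).quotKerEquivOfSurjective (aOld_surj _ _ _)).symm
      (aOld (projectiveResolution X) Y n z) = Submodule.Quotient.mk z := by
    rw [LinearEquiv.symm_apply_eq]; rfl
  simp only [extEquiv, LinearEquiv.trans_apply, this]
  rfl

end ExtCompare
end LCB

end

noncomputable section
open CategoryTheory Opposite
namespace LCB
section ExtCompare2
variable {R : Type u} [CommRing R] {X X' Y : ModuleCat.{u} R}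

/-- the induced map of Hom complexes -/
def homCxMap {P : ProjectiveResolution X} {P' : ProjectiveResolution X'}
    (φ : P'.complex ⟶ P.complex) (Y : ModuleCat.{u} R) : homCx P Y ⟶ homCx P' Y :=
  (HomologicalComplex.unopFunctor (ModuleCat R) (ComplexShape.down ℕ)).map
    (((((linearYoneda R (ModuleCat.{u} R)).obj Y).rightOp).mapHomologicalComplex _).map φ).op

lemma abstract_nat {C : Type*} [Category C] {a1 a2 a3 a4 b1 b2 : C} (a : a1 ⟶ a2) (b : a2 ⟶ a3)
    (c : a3 ⟶ a4) (m : a1 ⟶ b1) (a' : b1 ⟶ b2) (b' : b2 ⟶ a4) (k : a2 ⟶ b2)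
    (h1 : b ≫ c = k ≫ b') (h2 : a ≫ k = m ≫ a') : (a ≫ b) ≫ c = m ≫ (a' ≫ b') := by
  rw [Category.assoc, h1, ← Category.assoc, h2, Category.assoc]

lemma homCxMap_nat {P : ProjectiveResolution X} {P' : ProjectiveResolution X'} (g : X' ⟶ X)
    (φ : P'.complex ⟶ P.complex) (hφ : φ.f 0 ≫ P.π.f 0 = P'.π.f 0 ≫ g) (n : ℕ) :
    (P.isoExt (R := R) n Y).inv ≫ ((Ext R (ModuleCat.{u} R) n).map g.op).app Y =
      HomologicalComplex.homologyMap (homCxMap φ Y) n ≫ (P'.isoExt (R := R) n Y).inv := by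
  have h1 := ProjectiveResolution.isoLeftDerivedObj_hom_naturality g P' P φ hφ
    ((linearYoneda R (ModuleCat.{u} R)).obj Y).rightOp n
  have h2 := HomologicalComplex.homologyOp_hom_naturality (homCxMap φ Y) n
  have h1' := congrArg Quiver.Hom.unop h1
  have h2' := congrArg Quiver.Hom.unop h2
  let F := ((linearYoneda R (ModuleCat.{u} R)).obj Y).rightOp
  exact abstract_nat ((homCx P Y).homologyOp n).hom.unop (P.isoLeftDerivedObj F n).hom.unop
    ((F.leftDerived n).map g).unop (HomologicalComplex.homologyMap (homCxMap φ Y) n)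
    ((homCx P' Y).homologyOp n).hom.unop (P'.isoLeftDerivedObj F n).hom.unop
    ((F.mapHomologicalComplex _ ⋙ HomologicalComplex.homologyFunctor _ _ n).map φ).unop h1' h2'

lemma aOld_nat {P : ProjectiveResolution X} {P' : ProjectiveResolution X'} (g : X' ⟶ X)
    (φ : P'.complex ⟶ P.complex) (hφ : φ.f 0 ≫ P.π.f 0 = P'.π.f 0 ≫ g) (n : ℕ) (z) :
    ((Ext R (ModuleCat.{u} R) n).map g.op).app Y (aOld P Y n z) =
      aOld P' Y n ((HomologicalComplex.cyclesMap (homCxMap φ Y) n).hom z) := by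
  have h := homCxMap_nat (Y := Y) g φ hφ n
  have h3 : ((homCx P Y).homologyπ n ≫ (P.isoExt n Y).inv) ≫ ((Ext R (ModuleCat.{u} R) n).map g.op).app Y
    = HomologicalComplex.cyclesMap (homCxMap φ Y) n ≫ (homCx P' Y).homologyπ n ≫ (P'.isoExt n Y).inv := by
    rw [Category.assoc, h, HomologicalComplex.homologyπ_naturality_assoc]
  exact congrArg (fun f => f.hom z) h3

lemma cyc_nat {P : ProjectiveResolution X} {P' : ProjectiveResolution X'} 
    (φ : P'.complex ⟶ P.complex) (n : ℕ) (z) :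
    cyc P' Y n ((HomologicalComplex.cyclesMap (homCxMap φ Y) n).hom z) = φ.f n ≫ cyc P Y n z := by
  have := HomologicalComplex.cyclesMap_i (homCxMap φ Y) n
  exact congrArg (fun f => f.hom z) this

lemma extEquiv_nat (g : X' ⟶ X) (n : ℕ) (z) :
    extEquiv X' Y n (((Ext R (ModuleCat.{u} R) n).map g.op).app Y z) =
      (Abelian.Ext.mk₀ g).comp (extEquiv X Y n z) (zero_add _) := by
  obtain ⟨z, rfl⟩ := aOld_surj (projectiveResolution X) Y n z
  let φ := ProjectiveResolution.lift g (projectiveResolution X') (projectiveResolution X)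
  have hφ : φ.f 0 ≫ (projectiveResolution X).π.f 0 = (projectiveResolution X').π.f 0 ≫ g := by
    have := ProjectiveResolution.lift_commutes_zero g (projectiveResolution X') (projectiveResolution X)
    exact this
  rw [aOld_nat g φ hφ, extEquiv_aOld, extEquiv_aOld]
  refine Eq.trans ?_ (ProjectiveResolution.mk₀_comp_extMk (cyc (projectiveResolution X) Y n z)
    (n+1) rfl (cyc_d _ n z)
    (R' := projectiveResolution X') (⟨φ, hφ⟩ : ProjectiveResolution.Hom _ _ g)).symm
  have key := cyc_nat (Y := Y) φ n z
  have gen : ∀ (f f' : (projectiveResolution X').complex.X n ⟶ Y) (h h'), f = f' →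
    (projectiveResolution X').extMk f (n+1) rfl h = (projectiveResolution X').extMk f' (n+1) rfl h' := by
    rintro f _ _ _ rfl; rfl
  exact gen _ _ (cyc_d _ n _) (by rw [← key]; exact cyc_d _ n _) key

end ExtCompare2
end LCB

end

noncomputable section
open CategoryTheory Opposite
namespace LCB
section ExtMod
variable (R : Type u) [CommRing R]
variable (X X' X'' Y Y' Y'' : Type u) [AddCommGroup X] [AddCommGroup X'] [AddCommGroup X'']
  [AddCommGroup Y] [AddCommGroup Y'] [AddCommGroup Y'']
  [Module R X] [Module R X'] [Module R X''] [Module R Y] [Module R Y'] [Module R Y'']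

/-- Ext of plain modules -/
abbrev E (n : ℕ) : Type u := Abelian.Ext.{u} (ModuleCat.of R X) (ModuleCat.of R Y) n

variable {R X X' X'' Y Y' Y''}

/-- precomposition -/
def pre (f : X' →ₗ[R] X) (Y : Type u) [AddCommGroup Y] [Module R Y] (n : ℕ) :
    E R X Y n →ₗ[R] E R X' Y n where
  toFun x := (Abelian.Ext.mk₀ (ModuleCat.ofHom f)).comp x (zero_add n)
  map_add' x y := Abelian.Ext.comp_add _ _ _ _
  map_smul' r x := Abelian.Ext.comp_smul _ _ _ _

/-- postcomposition -/
def post (g : Y →ₗ[R] Y') (X : Type u) [AddCommGroup X] [Module R X] (n : ℕ) :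
    E R X Y n →ₗ[R] E R X Y' n where
  toFun x := x.comp (Abelian.Ext.mk₀ (ModuleCat.ofHom g)) (add_zero n)
  map_add' x y := Abelian.Ext.add_comp _ _ _ _
  map_smul' r x := Abelian.Ext.smul_comp _ _ _ _

lemma pre_id (n : ℕ) (x : E R X Y n) : pre LinearMap.id Y n x = x :=
  Abelian.Ext.mk₀_id_comp x

lemma post_id (n : ℕ) (x : E R X Y n) : post LinearMap.id X n x = x :=
  Abelian.Ext.comp_mk₀_id x

lemma pre_pre (f : X' →ₗ[R] X) (f' : X'' →ₗ[R] X') (n : ℕ) (x : E R X Y n) :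
    pre f' Y n (pre f Y n x) = pre (f ∘ₗ f') Y n x := by
  simp only [pre, LinearMap.coe_mk, AddHom.coe_mk]
  rw [← Abelian.Ext.comp_assoc_of_second_deg_zero, Abelian.Ext.mk₀_comp_mk₀]
  rfl

lemma post_post (f : Y →ₗ[R] Y') (f' : Y' →ₗ[R] Y'') (n : ℕ) (x : E R X Y n) :
    post f' X n (post f X n x) = post (f' ∘ₗ f) X n x := by
  simp only [post, LinearMap.coe_mk, AddHom.coe_mk]
  rw [Abelian.Ext.comp_assoc_of_second_deg_zero, Abelian.Ext.mk₀_comp_mk₀]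
  rfl

lemma pre_post (f : X' →ₗ[R] X) (g : Y →ₗ[R] Y') (n : ℕ) (x : E R X Y n) :
    pre f Y' n (post g X n x) = post g X' n (pre f Y n x) := by
  simp only [pre, post, LinearMap.coe_mk, AddHom.coe_mk]
  rw [Abelian.Ext.comp_assoc_of_third_deg_zero]

lemma pre_smul (f : X' →ₗ[R] X) (r : R) (n : ℕ) (x : E R X Y n) :
    pre (r • f) Y n x = r • pre f Y n x := by
  simp only [pre, LinearMap.coe_mk, AddHom.coe_mk]
  rw [← Abelian.Ext.smul_comp, ← Abelian.Ext.mk₀_smul]; rfl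

lemma pre_zero (n : ℕ) (x : E R X Y n) : pre (0 : X' →ₗ[R] X) Y n x = 0 := by
  have := pre_smul (0 : X' →ₗ[R] X) 0 n x
  simpa using this

lemma post_smul (g : Y →ₗ[R] Y') (r : R) (n : ℕ) (x : E R X Y n) :
    post (r • g) X n x = r • post g X n x := by
  simp only [post, LinearMap.coe_mk, AddHom.coe_mk]
  rw [← Abelian.Ext.comp_smul, ← Abelian.Ext.mk₀_smul]; rfl

lemma post_zero (n : ℕ) (x : E R X Y n) : post (0 : Y →ₗ[R] Y') X n x = 0 := by
  have := post_smul (0 : Y →ₗ[R] Y') 0 n x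
  simpa using this

lemma post_add (g g' : Y →ₗ[R] Y') (n : ℕ) (x : E R X Y n) :
    post (g + g') X n x = post g X n x + post g' X n x := by
  simp only [post, LinearMap.coe_mk, AddHom.coe_mk]
  rw [← Abelian.Ext.comp_add, ← Abelian.Ext.mk₀_add]; rfl

lemma post_sum {ι : Type*} (s : Finset ι) (g : ι → Y →ₗ[R] Y') (n : ℕ) (x : E R X Y n) :
    post (∑ i ∈ s, g i) X n x = ∑ i ∈ s, post (g i) X n x := by
  classical
  induction s using Finset.induction_on with
  | empty => simp [post_zero]
  | insert a s ha ih => rw [Finset.sum_insert ha, Finset.sum_insert ha, post_add, ih]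

lemma ext_smul_eq_zero (r : R) (h : ∀ v : X, r • v = 0) (n : ℕ) (x : E R X Y n) : r • x = 0 := by
  have h1 : (r • LinearMap.id : X →ₗ[R] X) = 0 := by ext v; simpa using h v
  have := pre_smul (LinearMap.id : X →ₗ[R] X) r n x
  rw [h1, pre_zero, pre_id] at this
  exact this.symm

/-- short exact sequence data -/
structure SES (f : X →ₗ[R] X') (g : X' →ₗ[R] X'') : Prop where
  inj : Function.Injective f
  surj : Function.Surjective g
  ex : Function.Exact f g

lemma SES.se {f : X →ₗ[R] X'} {g : X' →ₗ[R] X''} (h : SES f g) :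
    (ShortComplex.mk (ModuleCat.ofHom f) (ModuleCat.ofHom g) (by
      ext v; exact h.ex.apply_apply_eq_zero v)).ShortExact :=
  ModuleCat.shortComplex_shortExact _ h.ex h.inj h.surj

/-- contravariant connecting map -/
def dC {f : X →ₗ[R] X'} {g : X' →ₗ[R] X''} (h : SES f g) (Y : Type u) [AddCommGroup Y]
    [Module R Y] (n : ℕ) : E R X Y n →ₗ[R] E R X'' Y (n+1) where
  toFun x := h.se.extClass.comp x (add_comm 1 n)
  map_add' x y := Abelian.Ext.comp_add _ _ _ _
  map_smul' r x := Abelian.Ext.comp_smul _ _ _ _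

/-- covariant connecting map -/
def dV {f : X →ₗ[R] X'} {g : X' →ₗ[R] X''} (h : SES f g) (Y : Type u) [AddCommGroup Y]
    [Module R Y] (n : ℕ) : E R Y X'' n →ₗ[R] E R Y X (n+1) where
  toFun x := x.comp h.se.extClass rfl
  map_add' x y := Abelian.Ext.add_comp _ _ _ _
  map_smul' r x := Abelian.Ext.smul_comp _ _ _ _

section
variable {f : X →ₗ[R] X'} {g : X' →ₗ[R] X''}

lemma exV1 (h : SES f g) (n : ℕ) : Function.Exact (dV h Y n) (post f Y (n+1)) := by
  intro x
  constructor
  · intro hx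
    exact Abelian.Ext.covariant_sequence_exact₁ _ h.se x hx rfl
  · rintro ⟨y, rfl⟩
    change (y.comp h.se.extClass rfl).comp _ (add_zero _) = 0
    rw [Abelian.Ext.comp_assoc_of_third_deg_zero]
    erw [h.se.extClass_comp]
    simp

lemma exV2 (h : SES f g) (n : ℕ) : Function.Exact (post f Y n) (post g Y n) := by
  intro x
  constructor
  · intro hx
    exact Abelian.Ext.covariant_sequence_exact₂ _ h.se x hx
  · rintro ⟨y, rfl⟩
    rw [post_post, h.ex.linearMap_comp_eq_zero, post_zero]

lemma exV3 (h : SES f g) (n : ℕ) : Function.Exact (post g Y n) (dV h Y n) := by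
  intro x
  constructor
  · intro hx
    exact Abelian.Ext.covariant_sequence_exact₃ _ h.se x rfl hx
  · rintro ⟨y, rfl⟩
    change (y.comp _ (add_zero _)).comp h.se.extClass rfl = 0
    rw [Abelian.Ext.comp_assoc_of_second_deg_zero]
    erw [h.se.comp_extClass]
    simp

lemma post_inj0 (h : SES f g) : Function.Injective (post f Y 0) := by
  have := h.se.mono_f
  rw [injective_iff_map_eq_zero]
  intro x hx
  obtain ⟨a, rfl⟩ := (Abelian.Ext.linearEquiv₀ (R := R)).symm.surjective x
  change (Abelian.Ext.mk₀ a).comp (Abelian.Ext.mk₀ (ModuleCat.ofHom f)) (add_zero 0) = 0 at hx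
  rw [Abelian.Ext.mk₀_comp_mk₀, Abelian.Ext.mk₀_eq_zero_iff] at hx
  have h0 : a = 0 := by
    rw [← cancel_mono (ModuleCat.ofHom f)]
    rw [hx]; simp
  rw [h0, map_zero]

lemma dC_surj (h : SES f g) [Module.Projective R X'] (n : ℕ) : Function.Surjective (dC h Y n) := by
  intro x
  haveI : Projective (ModuleCat.of R X') := (IsProjective.iff_projective X').1 inferInstance
  exact precomp_extClass_surjective_of_projective_X₂ (ModuleCat.of R Y) h.se n x

lemma pre_dV (h : SES f g) (a : Y' →ₗ[R] Y) (n : ℕ) (x : E R Y X'' n) :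
    pre a X (n+1) (dV h Y n x) = dV h Y' n (pre a X'' n x) := by
  change Abelian.Ext.comp _ (x.comp h.se.extClass rfl) (zero_add _) = (Abelian.Ext.comp _ x (zero_add _)).comp h.se.extClass rfl
  rw [Abelian.Ext.comp_assoc]
  simp

end

lemma pre_dC {Z Z' Z'' : Type u} [AddCommGroup Z] [AddCommGroup Z'] [AddCommGroup Z'']
    [Module R Z] [Module R Z'] [Module R Z'']
    {f : X →ₗ[R] X'} {g : X' →ₗ[R] X''} (h : SES f g)
    {f₁ : Z →ₗ[R] Z'} {g₁ : Z' →ₗ[R] Z''} (h₁ : SES f₁ g₁)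
    (a : Z →ₗ[R] X) (b : Z' →ₗ[R] X') (c : Z'' →ₗ[R] X'')
    (hab : f ∘ₗ a = b ∘ₗ f₁) (hbc : g ∘ₗ b = c ∘ₗ g₁) (n : ℕ) (x : E R X Y n) :
    pre c Y (n+1) (dC h Y n x) = dC h₁ Y n (pre a Y n x) := by
  have := ShortComplex.ShortExact.extClass_naturality h₁.se h.se
    { τ₁ := ModuleCat.ofHom a, τ₂ := ModuleCat.ofHom b, τ₃ := ModuleCat.ofHom c
      comm₁₂ := by ext v; exact congrArg (fun f => f v) hab
      comm₂₃ := by ext v; exact congrArg (fun f => f v) hbc }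
  change Abelian.Ext.comp _ (h.se.extClass.comp x (add_comm 1 n)) (zero_add _) = h₁.se.extClass.comp (Abelian.Ext.comp _ x (zero_add _)) (add_comm 1 n)
  rw [← Abelian.Ext.comp_assoc _ _ _ (zero_add 1) (add_comm 1 n) (by omega)]
  rw [← Abelian.Ext.comp_assoc _ _ _ (add_zero 1) (zero_add n) (by omega)]
  erw [this]

lemma ext_zero_of_sum {ι : Type*} [Fintype ι] (r : ι → R) (g : ι → Y →ₗ[R] Y)
    (hg : ∑ i, r i • g i = LinearMap.id) (hr : ∀ i (v : X), r i • v = 0) (n : ℕ) (x : E R X Y n) :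
    x = 0 := by
  have h := post_id n x
  rw [← hg, post_sum] at h
  rw [← h]
  apply Finset.sum_eq_zero
  intro i _
  rw [post_smul]
  exact ext_smul_eq_zero _ (hr i) _ _

end ExtMod
end LCB

end

noncomputable section
open CategoryTheory Opposite
namespace LCB
section Dies
variable {R : Type u} [CommRing R]

lemma mk0_surj {X Y : Type u} [AddCommGroup X] [AddCommGroup Y] [Module R X] [Module R Y]
    (x : E R X Y 0) : ∃ a : X →ₗ[R] Y, x = Abelian.Ext.mk₀ (ModuleCat.ofHom a) := by
  obtain ⟨a, rfl⟩ := (Abelian.Ext.linearEquiv₀ (R := R)).symm.surjective x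
  exact ⟨a.hom, rfl⟩

lemma pre_mk0 {X X' Y : Type u} [AddCommGroup X] [AddCommGroup Y] [Module R X] [Module R Y]
    [AddCommGroup X'] [Module R X'] (f : X' →ₗ[R] X) (a : X →ₗ[R] Y) :
    pre f Y 0 (Abelian.Ext.mk₀ (ModuleCat.ofHom a)) = Abelian.Ext.mk₀ (ModuleCat.ofHom (a ∘ₗ f)) := by
  change Abelian.Ext.comp _ _ (zero_add 0) = _
  rw [Abelian.Ext.mk₀_comp_mk₀]; rfl

/-- `I`-power torsion modules -/
def IsTors (I : Ideal R) (T : Type u) [AddCommGroup T] [Module R T] : Prop :=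
  ∀ t : T, ∃ m : ℕ, ∀ a ∈ I ^ m, a • t = 0

lemma kill_mono {I : Ideal R} {T : Type u} [AddCommGroup T] [Module R T] {t : T} {m m' : ℕ}
    (h : m ≤ m') (hm : ∀ a ∈ I ^ m, a • t = 0) : ∀ a ∈ I ^ m', a • t = 0 :=
  fun a ha => hm a (Ideal.pow_le_pow_right h ha)

lemma pre_factor {X X' T : Type u} [AddCommGroup X] [AddCommGroup X'] [AddCommGroup T] [Module R X]
    [Module R X'] [Module R T] (f : X' →ₗ[R] X) (S : Submodule R X) (hS : ∀ v, f v ∈ S) (i : ℕ)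
    (y : E R X T i) (h : pre S.subtype T i y = 0) : pre f T i y = 0 := by
  have e : pre f T i y = pre (LinearMap.codRestrict S f hS) T i (pre S.subtype T i y) :=
    (pre_pre S.subtype (LinearMap.codRestrict S f hS) i y).symm
  rw [e, h, map_zero]

lemma dies_aux [IsNoetherianRing R] (I : Ideal R) (T : Type u) [AddCommGroup T] [Module R T]
    (hT : IsTors I T) (i : ℕ) : ∀ (N : Type u) [AddCommGroup N] [Module R N] [Module.Finite R N]
      (x : E R N T i), ∃ m : ℕ, pre (I ^ m • ⊤ : Submodule R N).subtype T i x = 0 := by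
  induction i with
  | zero =>
    intro N _ _ _ x
    obtain ⟨a, rfl⟩ := mk0_surj x
    obtain ⟨S, hS⟩ := (Module.Finite.fg_top : (⊤ : Submodule R N).FG)
    choose m hm using fun v : N => hT (a v)
    refine ⟨S.sup m, ?_⟩
    rw [pre_mk0]
    have : a ∘ₗ (I ^ (S.sup m) • ⊤ : Submodule R N).subtype = 0 := by
      ext ⟨v, hv⟩
      simp only [LinearMap.comp_apply, Submodule.subtype_apply, LinearMap.zero_apply]
      have key : ∀ b ∈ I ^ (S.sup m), ∀ w : N, b • a w = 0 := by
        intro b hb w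
        have hw : w ∈ Submodule.span R (S : Set N) := hS ▸ trivial
        induction hw using Submodule.span_induction with
        | mem w hw => exact kill_mono (Finset.le_sup hw) (hm w) b hb
        | zero => simp
        | add p q _ _ hp hq => rw [map_add, smul_add, hp, hq, add_zero]
        | smul r p _ hp => rw [map_smul, smul_comm, hp, smul_zero]
      induction hv using Submodule.smul_induction_on' with
      | smul b hb w _ => rw [map_smul]; exact key b hb w
      | add p _ q _ hp hq => rw [map_add, hp, hq, add_zero]
    rw [this]
    exact Abelian.Ext.mk₀_zero _ _
  | succ i ih =>
    intro N _ _ _ x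
    obtain ⟨n, f, hf⟩ := Module.Finite.exists_fin' R N
    let K := LinearMap.ker f
    have h : SES K.subtype f := ⟨K.injective_subtype, hf, fun v => by
      simp [K]⟩
    obtain ⟨y, rfl⟩ := dC_surj h (Y := T) i x
    obtain ⟨c, hc⟩ := ih K y
    obtain ⟨k, hk⟩ := I.exists_pow_inf_eq_pow_smul K
    refine ⟨k + c, ?_⟩
    have hAR := hk (k + c) (by omega)
    have hle : (I ^ (k + c) • ⊤ : Submodule R (Fin n → R)) ⊓ K ≤ I ^ c • K := by
      rw [hAR, Nat.add_sub_cancel_left]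
      exact Submodule.smul_mono le_rfl inf_le_right
    have hmap : Submodule.map f (I ^ (k+c) • ⊤ : Submodule R (Fin n → R)) =
        (I ^ (k+c) • ⊤ : Submodule R N) := by
      rw [Submodule.map_smul'', Submodule.map_top, LinearMap.range_eq_top.2 hf]
    let g₁ : (I ^ (k+c) • ⊤ : Submodule R (Fin n → R)) →ₗ[R] (I ^ (k+c) • ⊤ : Submodule R N) :=
      f.restrict (fun v hv => hmap ▸ Submodule.mem_map_of_mem hv)
    have hg₁ : Function.Surjective g₁ := by
      rintro ⟨v, hv⟩
      rw [← hmap] at hv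
      obtain ⟨w, hw, rfl⟩ := hv
      exact ⟨⟨w, hw⟩, rfl⟩
    have h₁ : SES (X := LinearMap.ker g₁) (LinearMap.ker g₁).subtype g₁ :=
      ⟨Submodule.injective_subtype _, hg₁, LinearMap.exact_subtype_ker_map g₁⟩
    let a : LinearMap.ker g₁ →ₗ[R] K := LinearMap.codRestrict K
      ((Submodule.subtype _) ∘ₗ (LinearMap.ker g₁).subtype) (fun v => by
        have := v.2
        rw [LinearMap.mem_ker] at this
        have h2 := congrArg Subtype.val this
        exact h2)
    rw [pre_dC h h₁ a (Submodule.subtype _) _ rfl rfl]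
    have ha : ∀ v, a v ∈ (I ^ c • ⊤ : Submodule R K) := by
      intro v
      have h1 : ((a v : K) : Fin n → R) ∈ I ^ c • K := hle ⟨v.1.2, (a v).2⟩
      have h2 : I ^ c • K = Submodule.map K.subtype (I ^ c • ⊤ : Submodule R K) := by
        rw [Submodule.map_smul'', Submodule.map_top, Submodule.range_subtype]
      rw [h2] at h1
      obtain ⟨w, hw, hw2⟩ := h1
      have : w = a v := Subtype.ext hw2
      exact this ▸ hw
    have e := pre_factor (X := ↥K) (X' := ↥(LinearMap.ker g₁)) (T := T) a (I ^ c • ⊤) ha i y hc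
    exact (congrArg (dC h₁ T i) e).trans (map_zero _)

/-- transition maps -/
abbrev tq (I : Ideal R) {k l : ℕ} (h : k ≤ l) : (R ⧸ I ^ l) →ₗ[R] (R ⧸ I ^ k) :=
  Submodule.mapQ (I ^ l) (I ^ k) LinearMap.id (Ideal.pow_le_pow_right h)

lemma dies [IsNoetherianRing R] (I : Ideal R) (T : Type u) [AddCommGroup T] [Module R T]
    (hT : IsTors I T) (i k : ℕ) (x : E R (R ⧸ I ^ k) T (i+1)) :
    ∃ (l : ℕ) (h : k ≤ l), pre (tq I h) T (i+1) x = 0 := by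
  have hs : ∀ k, SES (X := ↥(I^k)) (X' := R) (X'' := R ⧸ I ^ k)
      (Submodule.subtype (I ^ k)) (Submodule.mkQ (I ^ k)) := fun k =>
    ⟨Submodule.injective_subtype _, Submodule.mkQ_surjective _, LinearMap.exact_subtype_mkQ _⟩
  obtain ⟨y, rfl⟩ := dC_surj (hs k) (Y := T) i x
  obtain ⟨m, hm⟩ := dies_aux I T hT i _ y
  refine ⟨m + k, by omega, ?_⟩
  let a : ↥(I ^ (m+k)) →ₗ[R] ↥(I ^ k) := Submodule.inclusion (Ideal.pow_le_pow_right (by omega))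
  rw [pre_dC (hs k) (hs (m+k)) a LinearMap.id _ rfl rfl]
  have ha : ∀ v, a v ∈ (I ^ m • ⊤ : Submodule R ↥(I ^ k)) := by
    intro v
    have h1 : ((a v : ↥(I ^ k)) : R) ∈ I ^ m • (I ^ k : Submodule R R) := by
      have h0 : ∀ r : R, r ∈ I ^ (m + k) → r ∈ I ^ m * I ^ k := fun r hr => by
        rwa [pow_add] at hr
      exact h0 _ v.2
    have h2 : I ^ m • (I ^ k : Submodule R R) =
        Submodule.map (Submodule.subtype (I ^ k)) (I ^ m • ⊤ : Submodule R ↥(I ^ k)) := by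
      rw [Submodule.map_smul'', Submodule.map_top, Submodule.range_subtype]
    rw [h2] at h1
    obtain ⟨w, hw, hw2⟩ := h1
    have : w = a v := Subtype.ext hw2
    exact this ▸ hw
  have e := pre_factor a _ ha i y hm
  exact (congrArg (dC (hs (m+k)) T i) e).trans (map_zero _)

end Dies

section Colim
variable {R : Type u} [CommRing R] {Ek : ℕ → Type u} [∀ k, AddCommGroup (Ek k)]
  [∀ k, Module R (Ek k)] (tr : ∀ k l, k ≤ l → Ek k →ₗ[R] Ek l)

/-- elementwise description of a sequential colimit -/
structure IsColim (L : Type u) [AddCommGroup L] [Module R L] (ι : ∀ k, Ek k →ₗ[R] L) : Prop where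
  compat : ∀ k l h x, ι l (tr k l h x) = ι k x
  surj : ∀ y, ∃ k x, ι k x = y
  inj : ∀ k x, ι k x = 0 → ∃ l h, tr k l h x = 0

variable {tr}
lemma IsColim.wd {L L' : Type u} [AddCommGroup L] [Module R L] [AddCommGroup L'] [Module R L']
    {ι : ∀ k, Ek k →ₗ[R] L} {ι' : ∀ k, Ek k →ₗ[R] L'} (h : IsColim tr L ι)
    (h' : ∀ k l h x, ι' l (tr k l h x) = ι' k x)
    {k k' : ℕ} {x : Ek k} {x' : Ek k'} (e : ι k x = ι k' x') : ι' k x = ι' k' x' := by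
  have h1 : ι (max k k') (tr k _ (le_max_left _ _) x - tr k' _ (le_max_right _ _) x') = 0 := by
    rw [map_sub, h.compat, h.compat, e, sub_self]
  obtain ⟨l, hl, h2⟩ := h.inj _ _ h1
  have h3 := congrArg (ι' l) h2
  rw [map_zero, h', map_sub, h', h', sub_eq_zero] at h3
  exact h3

lemma IsColim.equiv {L L' : Type u} [AddCommGroup L] [Module R L] [AddCommGroup L'] [Module R L']
    {ι : ∀ k, Ek k →ₗ[R] L} {ι' : ∀ k, Ek k →ₗ[R] L'} (h : IsColim tr L ι)
    (h' : IsColim tr L' ι') : Nonempty (L ≃ₗ[R] L') := by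
  choose kk xx hx using h.surj
  have hf : ∀ k (x : Ek k), ι' (kk (ι k x)) (xx (ι k x)) = ι' k x := fun k x =>
    h.wd h'.compat (hx _)
  let β : L →ₗ[R] L' :=
    { toFun := fun y => ι' (kk y) (xx y)
      map_add' := by
        intro y y'
        have h1 : y + y' = ι (max (kk y) (kk y')) (tr _ _ (le_max_left _ _) (xx y) +
          tr _ _ (le_max_right _ _) (xx y')) := by
          rw [map_add, h.compat, h.compat, hx, hx]
        rw [h1, hf, map_add, h'.compat, h'.compat]
      map_smul' := by
        intro r y
        have h1 : r • y = ι (kk y) (r • xx y) := by rw [map_smul, hx]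
        rw [h1, hf, map_smul]; rfl }
  refine ⟨LinearEquiv.ofBijective β ⟨?_, ?_⟩⟩
  · intro y y' e
    rw [← hx y, ← hx y']
    exact h'.wd h.compat e
  · intro z
    obtain ⟨k, x, rfl⟩ := h'.surj z
    exact ⟨ι k x, hf k x⟩

variable {Ek' : ℕ → Type u} [∀ k, AddCommGroup (Ek' k)]
  [∀ k, Module R (Ek' k)] {tr' : ∀ k l, k ≤ l → Ek' k →ₗ[R] Ek' l}

lemma IsColim.of_ind {L : Type u} [AddCommGroup L] [Module R L] {ι : ∀ k, Ek k →ₗ[R] L}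
    (h : IsColim tr L ι) (α : ∀ k, Ek' k →ₗ[R] Ek k)
    (hα : ∀ k l h x, α l (tr' k l h x) = tr k l h (α k x))
    (hsurj : ∀ k x, ∃ l h y, α l y = tr k l h x)
    (htr : ∀ k l m h h' x, tr' l m h' (tr' k l h x) = tr' k m (h.trans h') x)
    (hinj : ∀ k x, α k x = 0 → ∃ l h, tr' k l h x = 0) :
    IsColim tr' L (fun k => ι k ∘ₗ α k) where
  compat k l hkl x := by simp [hα, h.compat]
  surj y := by
    obtain ⟨k, x, rfl⟩ := h.surj y
    obtain ⟨l, hl, y, hy⟩ := hsurj k x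
    exact ⟨l, y, by simp [hy, h.compat]⟩
  inj k x hx := by
    obtain ⟨l, hl, h1⟩ := h.inj _ _ hx
    rw [← hα] at h1
    obtain ⟨m, hm, h2⟩ := hinj _ _ h1
    exact ⟨m, hl.trans hm, by rw [← htr k l m hl hm, h2]⟩
end Colim
end LCB

end

noncomputable section
open CategoryTheory Opposite
namespace LCB

section LC
variable {R : Type u} [CommRing R] (I : Ideal R) (i : ℕ) (M : Type u) [AddCommGroup M] [Module R M]

/-- the local cohomology module -/
abbrev LCm : ModuleCat.{u} R := (localCohomology I i).obj (ModuleCat.of R M)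

/-- the diagram evaluated at `M` -/
abbrev dgm : ℕᵒᵖᵒᵖ ⥤ ModuleCat.{u} R :=
  localCohomology.diagram (localCohomology.idealPowersDiagram I) i ⋙
    (evaluation _ _).obj (ModuleCat.of R M)

lemma hasCol : Limits.HasColimit
    (localCohomology.diagram (localCohomology.idealPowersDiagram I) i) :=
  localCohomology.hasColimitDiagram.{u, 0} _ i

/-- the cocone -/
def coc : Limits.Cocone (dgm I i M) :=
  haveI := hasCol I i
  ((evaluation _ _).obj (ModuleCat.of R M)).mapCocone
    (Limits.colimit.cocone (localCohomology.diagram (localCohomology.idealPowersDiagram I) i))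

/-- it is a colimit -/
def cocIs : Limits.IsColimit (coc I i M) :=
  haveI := hasCol I i
  Limits.isColimitOfPreserves _ (Limits.colimit.isColimit _)

lemma coc_pt : (coc I i M).pt = LCm I i M := rfl

instance filt : IsFiltered ℕᵒᵖᵒᵖ := inferInstance

instance pres : Limits.PreservesColimitsOfShape ℕᵒᵖᵒᵖ (forget (ModuleCat.{u} R)) :=
  haveI : Limits.PreservesFilteredColimitsOfSize.{0,0} (forget (ModuleCat.{u} R)) :=
    Limits.preservesFilteredColimitsOfSize_shrink _
  inferInstance

/-- structure map -/
def lcι (k : ℕ) : E R (R ⧸ I ^ k) M i →ₗ[R] LCm I i M :=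
  ((coc I i M).ι.app (op (op k))).hom ∘ₗ
    (extEquiv (ModuleCat.of R (R ⧸ I ^ k)) (ModuleCat.of R M) i).symm.toLinearMap

/-- the arrow -/
def arr {k l : ℕ} (h : k ≤ l) : (op (op k) : ℕᵒᵖᵒᵖ) ⟶ op (op l) := (homOfLE h).op.op

lemma dgm_map {k l : ℕ} (h : k ≤ l) (z) :
    extEquiv (ModuleCat.of R (R ⧸ I ^ l)) (ModuleCat.of R M) i ((dgm I i M).map (arr h) z) =
    pre (tq I h) M i (extEquiv (ModuleCat.of R (R ⧸ I ^ k)) (ModuleCat.of R M) i z) :=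
  extEquiv_nat (ModuleCat.ofHom (tq I h)) i z

theorem lc_isColim : IsColim (Ek := fun k => E R (R ⧸ I ^ k) M i)
    (fun k l h => pre (tq I h) M i) (LCm I i M) (lcι I i M) where
  compat k l h x := by
    have h1 := dgm_map I i M h ((extEquiv (ModuleCat.of R (R ⧸ I ^ k)) (ModuleCat.of R M) i).symm x)
    rw [LinearEquiv.apply_symm_apply] at h1
    have h2 := ConcreteCategory.congr_hom ((coc I i M).w (arr h))
      ((extEquiv (ModuleCat.of R (R ⧸ I ^ k)) (ModuleCat.of R M) i).symm x)
    have e := (LinearEquiv.eq_symm_apply _).2 h1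
    exact (congrArg ((coc I i M).ι.app (op (op l))).hom e.symm).trans h2
  surj y := by
    obtain ⟨⟨⟨k⟩⟩, z, hz⟩ := Limits.Concrete.isColimit_exists_rep (dgm I i M) (cocIs I i M) y
    refine ⟨k, extEquiv _ _ i z, ?_⟩
    exact (congrArg ((coc I i M).ι.app (op (op k))).hom
      (LinearEquiv.symm_apply_apply _ z)).trans hz
  inj k x hx := by
    have h1 : (coc I i M).ι.app (op (op k))
      ((extEquiv (ModuleCat.of R (R ⧸ I ^ k)) (ModuleCat.of R M) i).symm x) =
      (coc I i M).ι.app (op (op k)) 0 := by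
      refine Eq.trans hx (map_zero ((coc I i M).ι.app (op (op k))).hom).symm
    obtain ⟨⟨⟨l⟩⟩, f, g, hfg⟩ := Limits.Concrete.isColimit_exists_of_rep_eq (dgm I i M)
      (cocIs I i M) _ _ h1
    have hl : k ≤ l := leOfHom f.unop.unop
    refine ⟨l, hl, ?_⟩
    have h3 := dgm_map I i M hl ((extEquiv (ModuleCat.of R (R ⧸ I ^ k)) (ModuleCat.of R M) i).symm x)
    rw [LinearEquiv.apply_symm_apply] at h3
    rw [← h3]
    have e : arr hl = f := Subsingleton.elim _ _
    rw [e]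
    refine (congrArg _ (hfg.trans (map_zero ((dgm I i M).map g).hom))).trans (map_zero _)
end LC
end LCB

end

noncomputable section
open CategoryTheory Opposite
namespace LCB

section Cech
variable {R : Type u} [CommRing R] (s : Finset R) (M : Type u) [AddCommGroup M] [Module R M]

/-- product of localizations -/
abbrev Lm : Type u := ∀ t : s, LocalizedModule (Submonoid.powers (t : R)) M

/-- the localization map -/
def locMap : M →ₗ[R] Lm s M :=
  LinearMap.pi fun t => LocalizedModule.mkLinearMap (Submonoid.powers (t : R)) M

/-- torsion -/
abbrev Gm : Submodule R M := LinearMap.ker (locMap s M)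

/-- cokernel -/
abbrev Qm : Type u := Lm s M ⧸ LinearMap.range (locMap s M)

lemma mem_Gm (v : M) : v ∈ Gm s M ↔ ∃ m : ℕ, ∀ a ∈ (Ideal.span (s : Set R)) ^ m, a • v = 0 := by
  rw [LinearMap.mem_ker]
  constructor
  · intro h
    have hrad : Ideal.span (s : Set R) ≤ (Ideal.radical (LinearMap.ker (LinearMap.toSpanSingleton R M v))) := by
      rw [Ideal.span_le]
      intro t ht
      have h1 := congrFun h ⟨t, ht⟩
      change LocalizedModule.mkLinearMap (Submonoid.powers t) M v = 0 at h1
      rw [IsLocalizedModule.eq_zero_iff (Submonoid.powers t)] at h1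
      obtain ⟨⟨_, k, rfl⟩, hk⟩ := h1
      exact ⟨k, hk⟩
    obtain ⟨m, hm⟩ := Ideal.exists_pow_le_of_le_radical_of_fg hrad ⟨s, rfl⟩
    exact ⟨m, fun a ha => hm ha⟩
  · rintro ⟨m, hm⟩
    funext t
    change LocalizedModule.mkLinearMap (Submonoid.powers (t : R)) M v = 0
    rw [IsLocalizedModule.eq_zero_iff (Submonoid.powers (t : R))]
    exact ⟨⟨_, m, rfl⟩, hm _ (Ideal.pow_mem_pow (Ideal.subset_span t.2) m)⟩

lemma Gm_tors : IsTors (Ideal.span (s : Set R)) (Gm s M) := by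
  intro t
  obtain ⟨m, hm⟩ := (mem_Gm s M t).1 t.2
  exact ⟨m, fun a ha => Subtype.ext (hm a ha)⟩

lemma lm_zero (k n : ℕ) (x : E R (R ⧸ (Ideal.span (s : Set R)) ^ k) (Lm s M) n) : x = 0 := by
  classical
  have hu : ∀ t : s, ∃ g : Module.End R (LocalizedModule (Submonoid.powers (t : R)) M),
      ((t : R) ^ k) • g = LinearMap.id := by
    intro t
    have h1 := IsLocalizedModule.map_units (S := Submonoid.powers (t : R))
      (LocalizedModule.mkLinearMap (Submonoid.powers (t : R)) M) ⟨_, k, rfl⟩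
    obtain ⟨u, hu⟩ := h1
    refine ⟨u.inv, ?_⟩
    have h2 := u.val_inv
    rw [hu] at h2
    exact h2
  choose g hg using hu
  refine ext_zero_of_sum (fun t : s => (t : R) ^ k)
    (fun t => LinearMap.single R (fun t : s => LocalizedModule (Submonoid.powers (t : R)) M) t ∘ₗ g t ∘ₗ LinearMap.proj t) ?_ ?_ n x
  · apply LinearMap.ext
    intro v
    funext t
    simp only [LinearMap.sum_apply, Finset.sum_apply, LinearMap.smul_apply, Pi.smul_apply,
      LinearMap.comp_apply, LinearMap.proj_apply, LinearMap.id_apply]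
    rw [Finset.sum_eq_single t]
    · have := congrArg (fun f => f (v t)) (hg t)
      simpa using this
    · intro b _ hb
      simp [LinearMap.single_apply, Pi.single_eq_of_ne hb.symm]
    · simp
  · intro t v
    obtain ⟨r, rfl⟩ := Ideal.Quotient.mk_surjective v
    have : (t : R) ^ k • (Ideal.Quotient.mk (Ideal.span (s : Set R) ^ k) r) =
      Ideal.Quotient.mk (Ideal.span (s : Set R) ^ k) ((t : R) ^ k * r) := rfl
    rw [this, Ideal.Quotient.eq_zero_iff_mem]
    exact Ideal.mul_mem_right _ _ (Ideal.pow_mem_pow (Ideal.subset_span t.2) k)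

/-- the colimit system -/
abbrev syst (I : Ideal R) (i : ℕ) : ∀ k l, k ≤ l → E R (R ⧸ I ^ k) M i →ₗ[R] E R (R ⧸ I ^ l) M i :=
  fun _ _ h => pre (tq I h) M i

lemma syst_comp (I : Ideal R) (i : ℕ) (k l m h h' x) :
    syst M I i l m h' (syst M I i k l h x) = syst M I i k m (h.trans h') x := by
  simp only [syst]
  rw [pre_pre]
  congr 2
  ext; rfl

lemma colim0 : ∃ ι, IsColim (Ek := fun k => E R (R ⧸ (Ideal.span (s : Set R)) ^ k) M 0)
    (syst M _ 0) (Gm s M) ι := by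
  set I := Ideal.span (s : Set R) with hI
  let ev : ∀ k, E R (R ⧸ I ^ k) M 0 →ₗ[R] M := fun k =>
    { toFun := fun x => ((Abelian.Ext.linearEquiv₀ (R := R)) x).hom (Ideal.Quotient.mk _ 1)
      map_add' := fun x y => by rw [map_add]; rfl
      map_smul' := fun r x => by rw [map_smul]; rfl }
  have evmk : ∀ k (a : (R ⧸ I ^ k) →ₗ[R] M), ev k (Abelian.Ext.mk₀ (ModuleCat.ofHom a)) =
      a (Ideal.Quotient.mk _ 1) := by
    intro k a
    have : (Abelian.Ext.linearEquiv₀ (R := R)) (Abelian.Ext.mk₀ (ModuleCat.ofHom a)) =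
      ModuleCat.ofHom a := (Abelian.Ext.linearEquiv₀ (R := R)).apply_symm_apply (ModuleCat.ofHom a)
    change ((Abelian.Ext.linearEquiv₀ (R := R)) (Abelian.Ext.mk₀ (ModuleCat.ofHom a))).hom _ = _
    rw [this]
    rfl
  have hev : ∀ k x, ev k x ∈ Gm s M := by
    intro k x
    obtain ⟨a, rfl⟩ := mk0_surj x
    rw [evmk, mem_Gm]
    refine ⟨k, fun r hr => ?_⟩
    rw [← map_smul]
    have : r • (Ideal.Quotient.mk (I ^ k) 1) = Ideal.Quotient.mk (I ^ k) (r * 1) := rfl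
    rw [this, mul_one, Ideal.Quotient.eq_zero_iff_mem.2 hr, map_zero]
  refine ⟨fun k => (ev k).codRestrict _ (hev k), ?_, ?_, ?_⟩
  · intro k l h x
    apply Subtype.ext
    obtain ⟨a, rfl⟩ := mk0_surj x
    change ev l _ = ev k _
    simp only [syst]
    rw [pre_mk0, evmk, evmk]; rfl
  · rintro ⟨v, hv⟩
    obtain ⟨m, hm⟩ := (mem_Gm s M v).1 hv
    refine ⟨m, Abelian.Ext.mk₀ (ModuleCat.ofHom
      (Submodule.liftQ (I ^ m) (LinearMap.toSpanSingleton R M v) (fun r hr => hm r hr))), ?_⟩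
    apply Subtype.ext
    change ev m _ = v
    rw [evmk]
    exact (Submodule.liftQ_apply (I ^ m) (LinearMap.toSpanSingleton R M v) (1 : R)).trans (one_smul R v)
  · intro k x hx
    refine ⟨k, le_rfl, ?_⟩
    obtain ⟨a, rfl⟩ := mk0_surj x
    have h1 : ev k _ = 0 := congrArg Subtype.val hx
    rw [evmk] at h1
    have : a = 0 := by
      ext
      exact h1
    subst this
    have e : Abelian.Ext.mk₀ (ModuleCat.ofHom (0 : (R ⧸ I ^ k) →ₗ[R] M)) = 0 := 
      Abelian.Ext.mk₀_zero _ _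
    rw [e, map_zero]

lemma colim_step [IsNoetherianRing R] (i : ℕ) {L : Type u} [AddCommGroup L] [Module R L] {ι}
    (h : IsColim (Ek := fun k => E R (R ⧸ (Ideal.span (s : Set R)) ^ k) (Qm s M) i)
      (syst (Qm s M) _ i) L ι) :
    ∃ ι', IsColim (Ek := fun k => E R (R ⧸ (Ideal.span (s : Set R)) ^ k) M (i+1))
      (syst M _ (i+1)) L ι' := by
  set I := Ideal.span (s : Set R) with hI
  have h1 : SES (LinearMap.range (locMap s M)).subtype (LinearMap.range (locMap s M)).mkQ :=
    ⟨Submodule.injective_subtype _, Submodule.mkQ_surjective _, LinearMap.exact_subtype_mkQ _⟩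
  have h2 : SES (Gm s M).subtype (locMap s M).rangeRestrict :=
    ⟨Submodule.injective_subtype _, LinearMap.surjective_rangeRestrict _, fun v => by
      simp only [Submodule.coe_subtype, Subtype.range_coe_subtype, Set.mem_setOf_eq,
        LinearMap.mem_ker]
      exact Subtype.ext_iff⟩
  let e : ∀ k, E R (R ⧸ I ^ k) (Qm s M) i ≃ₗ[R] E R (R ⧸ I ^ k) (LinearMap.range (locMap s M)) (i+1) :=
    fun k => LinearEquiv.ofBijective (dV h1 (R ⧸ I ^ k) i) (by
      constructor
      · rw [injective_iff_map_eq_zero]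
        intro x hx
        obtain ⟨y, rfl⟩ := (exV3 h1 (Y := R ⧸ I ^ k) i x).1 hx
        rw [lm_zero s M k i y, map_zero]
      · intro x
        exact (exV1 h1 (Y := R ⧸ I ^ k) i x).1 (lm_zero s M k (i+1) _))
  have c1 := h.of_ind (tr' := syst (LinearMap.range (locMap s M)) I (i+1))
    (fun k => (e k).symm.toLinearMap) (by
      intro k l hkl x
      obtain ⟨y, rfl⟩ := (e k).surjective x
      have : syst (LinearMap.range (locMap s M)) I (i+1) k l hkl (e k y) =
        e l (syst (Qm s M) I i k l hkl y) := pre_dV h1 (tq I hkl) i y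
      rw [this]
      simp only [LinearEquiv.coe_coe, LinearEquiv.symm_apply_apply]
      rfl) (fun k x => ⟨k, le_rfl, e k (syst _ I i k k le_rfl x), by
        simp only [LinearEquiv.coe_coe, LinearEquiv.symm_apply_apply]; rfl⟩)
      (syst_comp _ I _) (fun k x hx => ⟨k, le_rfl, by
        have : x = 0 := by simpa using hx
        rw [this, map_zero]⟩)
  have c2 := c1.of_ind (tr' := syst M I (i+1))
    (fun k => post (locMap s M).rangeRestrict (R ⧸ I ^ k) (i+1))
    (fun k l hkl x => (pre_post (tq I hkl) (locMap s M).rangeRestrict (i+1) x).symm)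
    (by
      intro k x
      obtain ⟨l, hl, hx⟩ := dies I (Gm s M) (Gm_tors s M) (i+1) k (dV h2 _ (i+1) x)
      rw [pre_dV] at hx
      obtain ⟨y, hy⟩ := (exV3 h2 (Y := R ⧸ I ^ l) (i+1) _).1 hx
      exact ⟨l, hl, y, hy⟩)
    (syst_comp _ I _)
    (by
      intro k x hx
      obtain ⟨y, rfl⟩ := (exV2 h2 (Y := R ⧸ I ^ k) (i+1) _).1 hx
      obtain ⟨l, hl, hy⟩ := dies I (Gm s M) (Gm_tors s M) i k y
      refine ⟨l, hl, ?_⟩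
      rw [syst, pre_post, hy, map_zero])
  exact ⟨_, c2⟩

theorem lc_induct [IsNoetherianRing R]
    (C : (M : Type u) → [AddCommGroup M] → [Module R M] → Prop)
    (hQ : ∀ (M : Type u) [AddCommGroup M] [Module R M], C M → C (Qm s M)) (hM : C M) (i : ℕ) :
    ∃ (Y : Type u) (_ : AddCommGroup Y) (_ : Module R Y), C Y ∧
      Nonempty (LCm (Ideal.span (s : Set R)) i M ≃ₗ[R] Gm s Y) := by
  have key : ∀ (i : ℕ) (M : Type u) [AddCommGroup M] [Module R M], C M →
    ∃ (Y : Type u) (_ : AddCommGroup Y) (_ : Module R Y), C Y ∧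
      ∃ ι, IsColim (Ek := fun k => E R (R ⧸ (Ideal.span (s : Set R)) ^ k) M i)
        (syst M _ i) (Gm s Y) ι := by
    intro i
    induction i with
    | zero => exact fun M _ _ hM => ⟨M, _, _, hM, colim0 s M⟩
    | succ i ih =>
      intro M _ _ hM
      obtain ⟨Y, iY, iY', hY, ι, hι⟩ := ih (Qm s M) (hQ M hM)
      exact ⟨Y, iY, iY', hY, colim_step s M i hι⟩
  obtain ⟨Y, iY, iY', hY, ι, hι⟩ := key i M hM
  exact ⟨Y, iY, iY', hY, IsColim.equiv (lc_isColim _ i M) hι⟩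

end Cech
end LCB

end

noncomputable section
open CategoryTheory Opposite
namespace LCB

section Tay
variable {σ : Type} [DecidableEq σ] (S : Type u) [CommRing S] (Y : Type u) [AddCommGroup Y] [Module S Y]

/-- formal power series with coefficients in a module -/
def Tay (σ : Type) (Y : Type u) : Type u := (σ →₀ ℕ) → Y

instance : AddCommGroup (Tay σ Y) := inferInstanceAs (AddCommGroup ((σ →₀ ℕ) → Y))

variable {S Y}
/-- power series action -/
def Tay.act (p : MvPowerSeries σ S) (y : Tay σ Y) : Tay σ Y :=
  fun b => ∑ c ∈ Finset.HasAntidiagonal.antidiagonal b, MvPowerSeries.coeff c.1 p • y c.2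

lemma Tay.ext {y z : Tay σ Y} (h : ∀ b, y b = z b) : y = z := funext h
lemma Tay.add_app (y z : Tay σ Y) (b) : (y + z) b = y b + z b := rfl

lemma Tay.one_act (y : Tay σ Y) : Tay.act (1 : MvPowerSeries σ S) y = y := by
  apply Tay.ext
  intro b
  rw [Tay.act, Finset.sum_eq_single (0, b)]
  · simp
  · rintro ⟨c, c'⟩ h hne
    rw [MvPowerSeries.coeff_one, if_neg, zero_smul]
    rintro rfl
    simp at h
    subst h
    exact hne rfl
  · intro h; simp at h

lemma Tay.mul_act (p q : MvPowerSeries σ S) (y : Tay σ Y) :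
    Tay.act (p * q) y = Tay.act p (Tay.act q y) := by
  apply Tay.ext
  intro b
  simp only [Tay.act, MvPowerSeries.coeff_mul, Finset.sum_smul, Finset.smul_sum, Finset.sum_sigma']
  apply Finset.sum_nbij' (fun x => ⟨(x.2.1, x.2.2 + x.1.2), (x.2.2, x.1.2)⟩)
    (fun x => ⟨(x.1.1 + x.2.1, x.2.2), (x.1.1, x.2.1)⟩)
  · rintro ⟨⟨i, j⟩, ⟨k, l⟩⟩ h
    simp only [Finset.mem_sigma, Finset.HasAntidiagonal.mem_antidiagonal] at h ⊢
    rw [← h.1, ← h.2]; simp [add_assoc]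
  · rintro ⟨⟨i, j⟩, ⟨k, l⟩⟩ h
    simp only [Finset.mem_sigma, Finset.HasAntidiagonal.mem_antidiagonal] at h ⊢
    rw [← h.1, ← h.2]; simp [add_assoc]
  · rintro ⟨⟨i, j⟩, ⟨k, l⟩⟩ h
    simp only [Finset.mem_sigma, Finset.HasAntidiagonal.mem_antidiagonal] at h ⊢
    obtain ⟨rfl, rfl⟩ := h
    rfl
  · rintro ⟨⟨i, j⟩, ⟨k, l⟩⟩ h
    simp only [Finset.mem_sigma, Finset.HasAntidiagonal.mem_antidiagonal] at h ⊢
    obtain ⟨rfl, rfl⟩ := h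
    rfl
  · rintro ⟨⟨i, j⟩, ⟨k, l⟩⟩ h
    simp [mul_smul]

/-- the module structure -/
instance Tay.mod : Module (MvPowerSeries σ S) (Tay σ Y) where
  smul := Tay.act
  one_smul := Tay.one_act
  mul_smul := Tay.mul_act
  smul_zero p := Tay.ext fun b => Finset.sum_eq_zero fun c _ => smul_zero _
  zero_smul y := Tay.ext fun b => Finset.sum_eq_zero fun c _ => by
    rw [map_zero, zero_smul]
  smul_add p y z := Tay.ext fun b => by
    change Tay.act p (y + z) b = Tay.act p y b + Tay.act p z b
    simp only [Tay.act, Tay.add_app, smul_add, Finset.sum_add_distrib]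
  add_smul p q y := Tay.ext fun b => by
    change Tay.act (p + q) y b = Tay.act p y b + Tay.act q y b
    simp only [Tay.act, map_add, add_smul, Finset.sum_add_distrib]

lemma Tay.smul_app (p : MvPowerSeries σ S) (y : Tay σ Y) (b) :
    (p • y) b = ∑ c ∈ Finset.HasAntidiagonal.antidiagonal b, MvPowerSeries.coeff c.1 p • y c.2 := rfl
end Tay

section TD
variable {A : Type u} [CommRing A] {n : ℕ}

/-- Taylor expansion -/
def tau : MvPolynomial (Fin n) A →+* MvPowerSeries (Fin n) (MvPolynomial (Fin n) A) :=
  MvPolynomial.eval₂Hom (MvPowerSeries.C.comp MvPolynomial.C)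
    (fun i => MvPowerSeries.C (MvPolynomial.X i) + MvPowerSeries.X i)

lemma tau_C (a : A) : tau (n := n) (MvPolynomial.C a) = MvPowerSeries.C (MvPolynomial.C a) := by
  simp [tau]

lemma tau_X (i : Fin n) : tau (A := A) (MvPolynomial.X i) =
    MvPowerSeries.C (MvPolynomial.X i) + MvPowerSeries.X i := by
  simp [tau]

lemma coeff_tau_mul_X (p : MvPolynomial (Fin n) A) (i : Fin n) (c : Fin n →₀ ℕ) :
    MvPowerSeries.coeff c (tau (p * MvPolynomial.X i)) =
      MvPowerSeries.coeff c (tau p) * MvPolynomial.X i +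
      if c i = 0 then 0 else MvPowerSeries.coeff (c - Finsupp.single i 1) (tau p) := by
  rw [map_mul, tau_X, mul_add, map_add, mul_comm (tau p), MvPowerSeries.coeff_C_mul,
    mul_comm (tau p), MvPowerSeries.X_def, MvPowerSeries.coeff_monomial_mul, mul_comm]
  congr 1
  have : (Finsupp.single i 1 ≤ c) ↔ c i ≠ 0 := by
    rw [Finsupp.single_le_iff]; omega
  by_cases h : c i = 0
  · rw [if_neg (by simpa [this] using h), if_pos h]
  · rw [if_pos (this.2 h), if_neg h, one_mul]

lemma tau_const (f : MvPolynomial (Fin n) A) : MvPowerSeries.coeff 0 (tau f) = f := by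
  induction f using MvPolynomial.induction_on with
  | C a => rw [tau_C, MvPowerSeries.coeff_zero_C]
  | add p q hp hq => rw [map_add, map_add, hp, hq]
  | mul_X p i hp => rw [coeff_tau_mul_X, hp]; simp

/-- A Taylor (divided power differential operator) structure. -/
structure TD (A : Type u) [CommRing A] (n : ℕ) (X : Type u) [AddCommGroup X]
    [Module (MvPolynomial (Fin n) A) X] where
  D : (Fin n →₀ ℕ) → X →+ X
  D_zero : ∀ v, D 0 v = v
  D_smul : ∀ b (f : MvPolynomial (Fin n) A) v, D b (f • v) =
    ∑ c ∈ Finset.HasAntidiagonal.antidiagonal b, MvPowerSeries.coeff c.1 (tau f) • D c.2 v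

variable {X : Type u} [AddCommGroup X] [Module (MvPolynomial (Fin n) A) X]
  {Y : Type u} [AddCommGroup Y] [Module (MvPolynomial (Fin n) A) Y]
  {Z : Type u} [AddCommGroup Z] [Module (MvPolynomial (Fin n) A) Z]

lemma TD.D_C (d : TD A n X) (b) (a : A) (v : X) :
    d.D b ((MvPolynomial.C a : MvPolynomial (Fin n) A) • v) = (MvPolynomial.C a : MvPolynomial (Fin n) A) • d.D b v := by
  rw [d.D_smul, tau_C, Finset.sum_eq_single (0, b)]
  · simp
  · rintro ⟨c, c'⟩ h hne
    rw [MvPowerSeries.coeff_C, if_neg, zero_smul]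
    rintro rfl
    simp at h
    subst h
    exact hne rfl
  · intro h; simp at h

lemma TD.D_X (d : TD A n X) (b) (i : Fin n) (v : X) :
    d.D b ((MvPolynomial.X i : MvPolynomial (Fin n) A) • v) =
     (MvPolynomial.X i : MvPolynomial (Fin n) A) • d.D b v +
      if b i = 0 then 0 else d.D (b - Finsupp.single i 1) v := by
  rw [d.D_smul, tau_X]
  simp only [map_add, add_smul, Finset.sum_add_distrib]
  congr 1
  · rw [Finset.sum_eq_single (0, b)]
    · simp
    · rintro ⟨c, c'⟩ h hne
      rw [MvPowerSeries.coeff_C, if_neg, zero_smul]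
      rintro rfl
      simp at h
      subst h
      exact hne rfl
    · intro h; simp at h
  · by_cases h : b i = 0
    · rw [if_pos h]
      apply Finset.sum_eq_zero
      rintro ⟨c, c'⟩ hc
      rw [MvPowerSeries.coeff_X, if_neg, zero_smul]
      rintro rfl
      rw [Finset.HasAntidiagonal.mem_antidiagonal] at hc
      have := congrArg (fun f => f i) hc
      simp [h] at this
    · rw [if_neg h]
      have hle : Finsupp.single i 1 ≤ b := by rw [Finsupp.single_le_iff]; omega
      rw [Finset.sum_eq_single (Finsupp.single i 1, b - Finsupp.single i 1)]
      · simp [MvPowerSeries.coeff_X]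
      · rintro ⟨c, c'⟩ hc hne
        rw [MvPowerSeries.coeff_X, if_neg, zero_smul]
        rintro rfl
        rw [Finset.HasAntidiagonal.mem_antidiagonal] at hc
        apply hne
        simp only at hc
        rw [← hc]; simp
      · intro h'; exact absurd (by rw [Finset.HasAntidiagonal.mem_antidiagonal]; exact add_tsub_cancel_of_le hle) h'

/-- equivariance -/
def Eqv (d : TD A n X) (d' : TD A n Y) (f : X →ₗ[MvPolynomial (Fin n) A] Y) : Prop :=
  ∀ b v, f (d.D b v) = d'.D b (f v)

/-- stable submodules -/
def TD.St (d : TD A n X) (U : Submodule (MvPolynomial (Fin n) A) X) : Prop :=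
  ∀ b v, v ∈ U → d.D b v ∈ U

/-- restriction -/
def TD.sub (d : TD A n X) (U : Submodule (MvPolynomial (Fin n) A) X) (h : d.St U) : TD A n U where
  D b := ((d.D b).comp U.subtype.toAddMonoidHom).codRestrict U.toAddSubgroup (fun v => h b v v.2)
  D_zero v := Subtype.ext (d.D_zero v)
  D_smul b f v := Subtype.ext (by
    rw [AddSubmonoidClass.coe_finset_sum]
    exact d.D_smul b f v)

lemma TD.sub_eqv (d : TD A n X) (U) (h : d.St U) : Eqv (d.sub U h) d U.subtype := fun _ _ => rfl

/-- quotient -/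
def TD.quot (d : TD A n X) (U : Submodule (MvPolynomial (Fin n) A) X) (h : d.St U) :
    TD A n (X ⧸ U) where
  D b := QuotientAddGroup.map U.toAddSubgroup U.toAddSubgroup (d.D b) (fun v hv => h b v hv)
  D_zero v := by
    obtain ⟨v, rfl⟩ := U.mkQ_surjective v
    exact congrArg U.mkQ (d.D_zero v)
  D_smul b f v := by
    obtain ⟨v, rfl⟩ := U.mkQ_surjective v
    refine (congrArg U.mkQ (d.D_smul b f v)).trans ?_
    rw [map_sum]
    rfl

lemma TD.quot_eqv (d : TD A n X) (U) (h : d.St U) : Eqv d (d.quot U h) U.mkQ := fun _ _ => rfl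

/-- product -/
def TD.pi {ι : Type u} {Xs : ι → Type u} [∀ i, AddCommGroup (Xs i)]
    [∀ i, Module (MvPolynomial (Fin n) A) (Xs i)] (d : ∀ i, TD A n (Xs i)) : TD A n (∀ i, Xs i) where
  D b := 
    { toFun := fun v i => (d i).D b (v i)
      map_zero' := by funext i; simp
      map_add' := fun v w => by funext i; simp }
  D_zero v := by funext i; exact (d i).D_zero _
  D_smul b f v := by
    funext i
    rw [Finset.sum_apply]
    exact (d i).D_smul b f (v i)

/-- the polynomial ring -/
def TD.self : TD A n (MvPolynomial (Fin n) A) where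
  D b := (MvPowerSeries.coeff b).toAddMonoidHom.comp (tau (A := A) (n := n)).toAddMonoidHom
  D_zero v := tau_const v
  D_smul b f v := by
    change MvPowerSeries.coeff b (tau (f * v)) = _
    rw [map_mul, MvPowerSeries.coeff_mul]
    rfl

lemma ker_st {d : TD A n X} {d' : TD A n Y} {f : X →ₗ[MvPolynomial (Fin n) A] Y} (h : Eqv d d' f) :
    d.St (LinearMap.ker f) := fun b v hv => by
  rw [LinearMap.mem_ker] at *
  rw [h, hv, map_zero]

lemma range_st {d : TD A n X} {d' : TD A n Y} {f : X →ₗ[MvPolynomial (Fin n) A] Y} (h : Eqv d d' f) :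
    d'.St (LinearMap.range f) := by
  rintro b _ ⟨v, rfl⟩
  exact ⟨d.D b v, h b v⟩
end TD

section Loc
variable {A : Type u} [CommRing A] {n : ℕ}
variable {X : Type u} [AddCommGroup X] [Module (MvPolynomial (Fin n) A) X]
  {Y : Type u} [AddCommGroup Y] [Module (MvPolynomial (Fin n) A) Y]
variable (f : Submonoid (MvPolynomial (Fin n) A))

/-- `R` acts on Taylor series through `tau` -/
def tMod (Y : Type u) [AddCommGroup Y] [Module (MvPolynomial (Fin n) A) Y] :
  Module (MvPolynomial (Fin n) A) (Tay (Fin n) Y) := Module.compHom _ tau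

lemma tMod_smul (Y : Type u) [AddCommGroup Y] [Module (MvPolynomial (Fin n) A) Y]
    (r : MvPolynomial (Fin n) A) (y : Tay (Fin n) Y) (b) :
    letI := tMod (A := A) (n := n) Y
    (r • y) b = ∑ c ∈ Finset.HasAntidiagonal.antidiagonal b, MvPowerSeries.coeff c.1 (tau r) • y c.2 := rfl

lemma tMod_unit (g : f) :
    letI := tMod (A := A) (n := n) (LocalizedModule f X)
    IsUnit (algebraMap (MvPolynomial (Fin n) A) (Module.End (MvPolynomial (Fin n) A)
      (Tay (Fin n) (LocalizedModule f X))) g) := by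
  letI := tMod (A := A) (n := n) (LocalizedModule f X)
  rw [Module.End.isUnit_iff]
  let p : MvPowerSeries (Fin n) (Localization f) := MvPowerSeries.map (algebraMap _ _) (tau g.1)
  have hp : IsUnit p := by
    rw [MvPowerSeries.isUnit_iff_constantCoeff]
    have : MvPowerSeries.constantCoeff p = algebraMap _ (Localization f) g.1 := by
      rw [← MvPowerSeries.coeff_zero_eq_constantCoeff_apply]
      simp only [p]
      rw [MvPowerSeries.coeff_map, tau_const]
    rw [this]
    exact IsLocalization.map_units _ g
  have hb : Function.Bijective (fun y : Tay (Fin n) (LocalizedModule f X) => p • y) := by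
    obtain ⟨u, hu⟩ := hp
    rw [← hu]
    refine ⟨fun y z h => ?_, fun y => ⟨(↑u⁻¹ : MvPowerSeries (Fin n) (Localization f)) • y, ?_⟩⟩
    · have := congrArg (fun w => (↑u⁻¹ : MvPowerSeries (Fin n) (Localization f)) • w) h
      simp only at this
      rw [← mul_smul, ← mul_smul, Units.inv_mul, one_smul, one_smul] at this
      exact this
    · change (u : MvPowerSeries (Fin n) (Localization f)) •
        ((↑u⁻¹ : MvPowerSeries (Fin n) (Localization f)) • y) = y
      rw [← mul_smul, Units.mul_inv, one_smul]
  convert hb using 1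
  funext y
  apply Tay.ext
  intro b
  change (g.1 • y) b = (p • y) b
  rw [tMod_smul, Tay.smul_app]
  refine Finset.sum_congr rfl fun c _ => ?_
  simp only [p]
  rw [MvPowerSeries.coeff_map]
  rw [algebraMap_smul]

/-- taylor map -/
def TD.theta (d : TD A n X) (g : X →ₗ[MvPolynomial (Fin n) A] Y) : 
    letI := tMod (A := A) (n := n) Y
    X →ₗ[MvPolynomial (Fin n) A] Tay (Fin n) Y :=
  letI := tMod (A := A) (n := n) Y
  { toFun := fun v b => g (d.D b v)
    map_add' := fun v w => Tay.ext fun b => by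
      rw [map_add, map_add]; rfl
    map_smul' := fun r v => Tay.ext fun b => by
      change g (d.D b (r • v)) = ∑ c ∈ Finset.HasAntidiagonal.antidiagonal b,
        MvPowerSeries.coeff c.1 (tau r) • g (d.D c.2 v)
      rw [d.D_smul, map_sum]
      simp }

/-- extended taylor map -/
def TD.thetaL (d : TD A n X) :
    letI := tMod (A := A) (n := n) (LocalizedModule f X)
    LocalizedModule f X →ₗ[MvPolynomial (Fin n) A] Tay (Fin n) (LocalizedModule f X) :=
  letI := tMod (A := A) (n := n) (LocalizedModule f X)
  IsLocalizedModule.lift f (LocalizedModule.mkLinearMap f X)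
    (d.theta (LocalizedModule.mkLinearMap f X)) (tMod_unit f)

lemma TD.thetaL_mk (d : TD A n X) (v : X) (b) :
    d.thetaL f (LocalizedModule.mkLinearMap f X v) b = LocalizedModule.mkLinearMap f X (d.D b v) := by
  letI := tMod (A := A) (n := n) (LocalizedModule f X)
  have := IsLocalizedModule.lift_apply f (LocalizedModule.mkLinearMap f X)
    (d.theta (LocalizedModule.mkLinearMap f X)) (tMod_unit f) v
  exact congrFun this b

lemma loc_units (g : f) : IsUnit (algebraMap (MvPolynomial (Fin n) A)
    (Module.End (MvPolynomial (Fin n) A) (LocalizedModule f X)) g) :=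
  IsLocalizedModule.map_units (LocalizedModule.mkLinearMap f X) g

/-- localization -/
def TD.loc (d : TD A n X) : TD A n (LocalizedModule f X) where
  D b := 
    { toFun := fun v => d.thetaL f v b
      map_zero' := by rw [map_zero]; rfl
      map_add' := fun v w => by rw [map_add]; rfl }
  D_zero v := by
    letI := tMod (A := A) (n := n) (LocalizedModule f X)
    let e0 : LocalizedModule f X →ₗ[MvPolynomial (Fin n) A] LocalizedModule f X :=
      { toFun := fun v => d.thetaL f v 0
        map_add' := fun v w => by rw [map_add]; rfl
        map_smul' := fun r v => by
          rw [map_smul, tMod_smul]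
          simp [tau_const] }
    have : e0 = LinearMap.id := by
      apply IsLocalizedModule.ext f (LocalizedModule.mkLinearMap f X) (loc_units f)
      ext v
      change d.thetaL f (LocalizedModule.mkLinearMap f X v) 0 = _
      rw [d.thetaL_mk, d.D_zero]; rfl
    exact congrArg (fun g => g v) this
  D_smul b r v := by
    letI := tMod (A := A) (n := n) (LocalizedModule f X)
    change d.thetaL f (r • v) b = _
    rw [map_smul, tMod_smul]
    rfl

lemma TD.loc_eqv (d : TD A n X) : Eqv d (d.loc f) (LocalizedModule.mkLinearMap f X) :=
  fun b v => (d.thetaL_mk f v b).symm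

lemma loc_unique {d : TD A n X} (d' : TD A n Y) (g : LocalizedModule f X →ₗ[MvPolynomial (Fin n) A] Y)
    (hY : ∀ s : f, Function.Injective (fun y : Y => s.1 • y))
    (hg : ∀ b v, g ((d.loc f).D b (LocalizedModule.mkLinearMap f X v)) =
      d'.D b (g (LocalizedModule.mkLinearMap f X v))) : Eqv (d.loc f) d' g := by
  intro b
  induction b using WellFoundedLT.induction with
  | _ b ih =>
  intro w
  obtain ⟨⟨v, s⟩, hw⟩ := IsLocalizedModule.surj f (LocalizedModule.mkLinearMap f X) w
  simp only at hw
  have h1 := (d.loc f).D_smul b s.1 w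
  have h2 := d'.D_smul b s.1 (g w)
  have h3 := hg b v
  rw [← hw] at h3
  change g ((d.loc f).D b (s.1 • w)) = d'.D b (g (s.1 • w)) at h3
  rw [map_smul g, h1, h2, map_sum] at h3
  have hmem : ((0 : Fin n →₀ ℕ), b) ∈ Finset.HasAntidiagonal.antidiagonal b := by simp
  rw [← Finset.add_sum_erase _ _ hmem, ← Finset.add_sum_erase _ _ hmem] at h3
  have h4 : ∑ c ∈ (Finset.HasAntidiagonal.antidiagonal b).erase (0, b),
      g (MvPowerSeries.coeff c.1 (tau s.1) • (d.loc f).D c.2 w) =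
      ∑ c ∈ (Finset.HasAntidiagonal.antidiagonal b).erase (0, b),
        MvPowerSeries.coeff c.1 (tau s.1) • d'.D c.2 (g w) := by
    refine Finset.sum_congr rfl ?_
    rintro ⟨c, c'⟩ hc
    rw [Finset.mem_erase, Finset.HasAntidiagonal.mem_antidiagonal] at hc
    rw [map_smul, ih c']
    obtain ⟨hc1, rfl⟩ := hc
    refine lt_of_le_of_ne (by simp) ?_
    intro h
    apply hc1
    simp only at h ⊢
    have : c = 0 := by simpa using h.symm
    rw [this, zero_add]
  rw [h4] at h3
  have h5 := add_right_cancel h3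
  simp only [tau_const, map_smul g] at h5
  exact hY s h5
end Loc
end LCB

end

noncomputable section
open CategoryTheory Opposite
namespace LCB

section Hol
variable {A : Type u} [CommRing A] {n : ℕ}
variable {X : Type u} [AddCommGroup X] [Module (MvPolynomial (Fin n) A) X]
  {Y : Type u} [AddCommGroup Y] [Module (MvPolynomial (Fin n) A) Y]

/-- `S` is contained in the image of an `A`-module of length at most `N`. -/
def Small (A : Type u) [CommRing A] (n : ℕ) {X : Type u} [AddCommGroup X]
    [Module (MvPolynomial (Fin n) A) X] (S : AddSubgroup X) (N : ℕ) : Prop :=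
  ∃ (V : Type u) (_ : AddCommGroup V) (_ : Module A V)
    (φ : V →ₛₗ[(MvPolynomial.C : A →+* MvPolynomial (Fin n) A)] X),
    (∀ v ∈ S, ∃ x, φ x = v) ∧ Module.length A V ≤ N

/-- filtrations with polynomial growth -/
structure HolF (d : TD A n X) (C : ℕ) (F : ℕ → AddSubgroup X) : Prop where
  mono : Monotone F
  exh : ∀ v, ∃ j, v ∈ F j
  smulC : ∀ (a : A) j v, v ∈ F j → (MvPolynomial.C a : MvPolynomial (Fin n) A) • v ∈ F j
  smulX : ∀ i j v, v ∈ F j → (MvPolynomial.X i : MvPolynomial (Fin n) A) • v ∈ F (j + 1)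
  D_mem : ∀ b j v, v ∈ F j → d.D b v ∈ F (j + b.degree)
  small : ∀ j, Small A n (F j) (C * (j + 1) ^ n)

lemma HolF.quot {d : TD A n X} {C F} (h : HolF d C F) {d' : TD A n Y}
    {g : X →ₗ[MvPolynomial (Fin n) A] Y} (hg : Eqv d d' g) (hs : Function.Surjective g) :
    HolF d' C (fun j => (F j).map g.toAddMonoidHom) where
  mono _ _ hij := AddSubgroup.map_mono (h.mono hij)
  exh v := by
    obtain ⟨v, rfl⟩ := hs v
    obtain ⟨j, hj⟩ := h.exh v
    exact ⟨j, v, hj, rfl⟩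
  smulC := by
    rintro a j _ ⟨v, hv, rfl⟩
    exact ⟨_, h.smulC a j v hv, map_smul g _ _⟩
  smulX := by
    rintro a j _ ⟨v, hv, rfl⟩
    exact ⟨_, h.smulX a j v hv, map_smul g _ _⟩
  D_mem := by
    rintro a j _ ⟨v, hv, rfl⟩
    exact ⟨_, h.D_mem a j v hv, hg _ _⟩
  small j := by
    obtain ⟨V, _, _, φ, h1, h2⟩ := h.small j
    refine ⟨V, _, _, g.comp φ, ?_, h2⟩
    rintro _ ⟨v, hv, rfl⟩
    obtain ⟨x, rfl⟩ := h1 v hv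
    exact ⟨x, rfl⟩

lemma HolF.bound {d : TD A n X} {C F} (h : HolF d C F) (f : MvPolynomial (Fin n) A) :
    ∃ e, ∀ c q v, v ∈ F q → MvPowerSeries.coeff c (tau f) • v ∈ F (q + e) := by
  induction f using MvPolynomial.induction_on with
  | C a =>
    refine ⟨0, fun c q v hv => ?_⟩
    rw [tau_C, MvPowerSeries.coeff_C]
    split_ifs
    · exact h.smulC a q v hv
    · rw [zero_smul]; exact zero_mem _
  | add p q hp hq =>
    obtain ⟨e, he⟩ := hp
    obtain ⟨e', he'⟩ := hq
    refine ⟨e + e', fun c q v hv => ?_⟩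
    rw [map_add, map_add, add_smul]
    exact add_mem (h.mono (by omega) (he c q v hv)) (h.mono (by omega) (he' c q v hv))
  | mul_X p i hp =>
    obtain ⟨e, he⟩ := hp
    refine ⟨e + 1, fun c q v hv => ?_⟩
    rw [coeff_tau_mul_X, add_smul, mul_comm, mul_smul]
    refine add_mem (h.smulX _ _ _ (he c q v hv)) ?_
    split_ifs
    · rw [zero_smul]; exact zero_mem _
    · exact h.mono (by omega) (he _ q v hv)

/-- pieces of the localized filtration -/
def GG (f : MvPolynomial (Fin n) A) (F : ℕ → AddSubgroup X) (p q : ℕ) :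
    AddSubgroup (LocalizedModule (Submonoid.powers f) X) :=
  ((F q).map (LocalizedModule.mkLinearMap (Submonoid.powers f) X).toAddMonoidHom).comap
    (DistribSMul.toAddMonoidHom _ (f ^ p))

lemma mem_GG (f : MvPolynomial (Fin n) A) (F : ℕ → AddSubgroup X) (p q : ℕ) (w) :
    w ∈ GG f F p q ↔ ∃ x ∈ F q, LocalizedModule.mkLinearMap (Submonoid.powers f) X x = f ^ p • w :=
  Iff.rfl

section
variable {d : TD A n X} {C : ℕ} {F : ℕ → AddSubgroup X}
  {f : MvPolynomial (Fin n) A} {e : ℕ}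

lemma GG_mono (h : HolF d C F) {p q q' : ℕ} (hq : q ≤ q') : GG f F p q ≤ GG f F p q' := by
  rintro w ⟨x, hx, hw⟩
  exact ⟨x, h.mono hq hx, hw⟩

lemma GG_coeff (h : HolF d C F) 
    (he : ∀ c q v, v ∈ F q → MvPowerSeries.coeff c (tau f) • v ∈ F (q + e)) {p q : ℕ} (c) {w} (hw : w ∈ GG f F p q) :
    MvPowerSeries.coeff c (tau f) • w ∈ GG f F p (q + e) := by
  rw [mem_GG] at *
  obtain ⟨x, hx, hw⟩ := hw
  refine ⟨_, he c q x hx, ?_⟩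
  rw [map_smul, hw, smul_comm]

lemma GG_succ (h : HolF d C F) 
    (he : ∀ c q v, v ∈ F q → MvPowerSeries.coeff c (tau f) • v ∈ F (q + e)) {p q : ℕ} : GG f F p q ≤ GG f F (p + 1) (q + e) := by
  intro w hw
  obtain ⟨x, hx, hw⟩ := (mem_GG _ _ _ _ _).1 (GG_coeff h he 0 hw)
  rw [tau_const] at hw
  exact (mem_GG _ _ _ _ _).2 ⟨x, hx, by rw [hw, ← mul_smul, pow_succ]⟩

lemma GG_add (h : HolF d C F) 
    (he : ∀ c q v, v ∈ F q → MvPowerSeries.coeff c (tau f) • v ∈ F (q + e)) {p q : ℕ} (t : ℕ) : GG f F p q ≤ GG f F (p + t) (q + t * e) := by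
  induction t with
  | zero => simp
  | succ t ih =>
    refine ih.trans ((GG_succ h he).trans ?_)
    rw [add_assoc, add_assoc, Nat.succ_mul]

lemma GG_le (h : HolF d C F) 
    (he : ∀ c q v, v ∈ F q → MvPowerSeries.coeff c (tau f) • v ∈ F (q + e)) {p q p' q' : ℕ} (hp : p ≤ p') (hq : q + (p' - p) * e ≤ q') :
    GG f F p q ≤ GG f F p' q' := by
  have := GG_add h he (p := p) (q := q) (p' - p)
  rw [Nat.add_sub_cancel' hp] at this
  exact this.trans (GG_mono h hq)

lemma GG_D (h : HolF d C F) 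
    (he : ∀ c q v, v ∈ F q → MvPowerSeries.coeff c (tau f) • v ∈ F (q + e)) (p : ℕ) : ∀ (b : Fin n →₀ ℕ) (q : ℕ) (w), w ∈ GG f F p q →
    (d.loc (Submonoid.powers f)).D b w ∈ GG f F (p + b.degree) (q + b.degree * (e + 1)) := by
  induction p with
  | zero =>
    intro b q w hw
    obtain ⟨x, hx, hw⟩ := hw
    have : w = LocalizedModule.mkLinearMap (Submonoid.powers f) X x := by
      refine Eq.trans ?_ hw.symm
      change w = f ^ 0 • w
      rw [pow_zero, one_smul]
    rw [this, ← TD.loc_eqv]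
    refine GG_le h he (p := 0) (q := q + b.degree) (by omega) ?_ ?_
    · rw [Nat.mul_add]; simp; omega
    · exact (mem_GG _ _ _ _ _).2 ⟨_, h.D_mem b q x hx, by simp⟩
  | succ p ihp =>
    intro b
    induction b using WellFoundedLT.induction with
    | _ b ih =>
    intro q w hw
    have hfw : f • w ∈ GG f F p q := by
      obtain ⟨x, hx, hw⟩ := (mem_GG _ _ _ _ _).1 hw
      exact ⟨x, hx, by rw [pow_succ, mul_smul] at hw; exact hw⟩
    have h1 := ihp b q _ hfw
    have key : f • (d.loc (Submonoid.powers f)).D b w ∈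
        GG f F (p + b.degree) (q + b.degree * (e + 1)) := by
      rw [TD.D_smul] at h1
      have hmem : ((0 : Fin n →₀ ℕ), b) ∈ Finset.HasAntidiagonal.antidiagonal b := by simp
      rw [← Finset.add_sum_erase _ _ hmem] at h1
      simp only [tau_const] at h1
      refine (AddSubgroup.add_mem_cancel_right _ ?_).1 h1
      refine sum_mem ?_
      rintro ⟨c, c'⟩ hc
      rw [Finset.mem_erase, Finset.HasAntidiagonal.mem_antidiagonal] at hc
      obtain ⟨hc1, rfl⟩ := hc
      simp only at hc1 ⊢
      have hc0 : c ≠ 0 := by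
        rintro rfl; simp at hc1
      have hdeg : 1 ≤ c.degree := by
        rw [Nat.one_le_iff_ne_zero]
        intro h0
        exact hc0 ((Finsupp.degree_eq_zero_iff c).1 h0)
      have h2 := ih c' (lt_of_le_of_ne (by simp) (by simpa using hc0)) q w hw
      refine GG_le h he ?_ ?_ (GG_coeff h he c h2)
      · rw [map_add]; omega
      · rw [map_add]
        obtain ⟨t, ht⟩ := Nat.exists_eq_add_of_le hdeg
        rw [ht]
        have : p + (1 + t + c'.degree) - (p + 1 + c'.degree) = t := by omega
        rw [this]
        ring_nf
        omega
    obtain ⟨x, hx, hw⟩ := (mem_GG _ _ _ _ _).1 key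
    refine (mem_GG _ _ _ _ _).2 ⟨x, hx, hw.trans ?_⟩
    rw [← mul_smul, ← pow_succ]
    congr 2
    omega
end

lemma HolF.loc {d : TD A n X} {C F} (h : HolF d C F) (f : MvPolynomial (Fin n) A) :
    ∃ C' F', HolF (d.loc (Submonoid.powers f)) C' F' := by
  obtain ⟨e, he⟩ := h.bound f
  refine ⟨C * (e + 1) ^ n, fun j => GG f F j (j * (e + 1)), ?_, ?_, ?_, ?_, ?_, ?_⟩
  · refine monotone_nat_of_le_succ fun j => GG_le h he (by omega) ?_
    simp only [Nat.add_sub_cancel_left]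
    ring_nf; omega
  · intro w
    obtain ⟨⟨v, s⟩, hw⟩ := IsLocalizedModule.surj (Submonoid.powers f)
      (LocalizedModule.mkLinearMap (Submonoid.powers f) X) w
    obtain ⟨p, hp⟩ := s.2
    obtain ⟨q, hq⟩ := h.exh v
    refine ⟨p + q, GG_le h he (p := p) (q := q) (by omega) ?_
      ((mem_GG _ _ _ _ _).2 ⟨v, hq, ?_⟩)⟩
    · rw [Nat.add_sub_cancel_left]; nlinarith [Nat.zero_le (p * (e + 1))]
    · rw [← hw]
      exact congrArg (· • w) hp.symm
  · intro a j v hv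
    obtain ⟨x, hx, hw⟩ := (mem_GG _ _ _ _ _).1 hv
    exact (mem_GG _ _ _ _ _).2 ⟨_, h.smulC a _ x hx, by rw [map_smul, hw, smul_comm]⟩
  · intro a j v hv
    obtain ⟨x, hx, hw⟩ := (mem_GG _ _ _ _ _).1 hv
    refine GG_le h he (p := j) (q := j * (e + 1) + 1) (by omega) ?_
      ((mem_GG _ _ _ _ _).2 ⟨_, h.smulX a _ x hx, by rw [map_smul, hw, smul_comm]⟩)
    simp only [Nat.add_sub_cancel_left]
    ring_nf; omega
  · intro b j v hv
    refine GG_mono h ?_ (GG_D h he j b _ v hv)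
    ring_nf; omega
  · intro j
    obtain ⟨V, _, _, φ, h1, h2⟩ := h.small (j * (e + 1))
    have hu := loc_units (X := X) (Submonoid.powers f) ⟨f ^ j, j, rfl⟩
    rw [Module.End.isUnit_iff] at hu
    let ψ := LinearEquiv.ofBijective _ hu
    refine ⟨V, _, _, ψ.symm.toLinearMap.comp
      ((LocalizedModule.mkLinearMap (Submonoid.powers f) X).comp φ), ?_, ?_⟩
    · intro w hw
      obtain ⟨x, hx, hw⟩ := (mem_GG _ _ _ _ _).1 hw
      obtain ⟨y, rfl⟩ := h1 x hx
      refine ⟨y, ?_⟩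
      change ψ.symm (LocalizedModule.mkLinearMap (Submonoid.powers f) X (φ y)) = w
      rw [LinearEquiv.symm_apply_eq, hw]
      rfl
    · refine h2.trans ?_
      have : C * (j * (e + 1) + 1) ^ n ≤ C * (e + 1) ^ n * (j + 1) ^ n := by
        rw [mul_assoc, ← mul_pow]
        gcongr
        nlinarith
      exact_mod_cast this

/-- the extension closure of the holonomic modules -/
inductive ExtHol {A : Type u} [CommRing A] {n : ℕ} : ∀ {X : Type u} [AddCommGroup X]
    [Module (MvPolynomial (Fin n) A) X], TD A n X → Prop
  | hol {X : Type u} [AddCommGroup X] [Module (MvPolynomial (Fin n) A) X] (d : TD A n X)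
      (C : ℕ) (F : ℕ → AddSubgroup X) (h : HolF d C F) : ExtHol d
  | mid {N X Z : Type u} [AddCommGroup N] [Module (MvPolynomial (Fin n) A) N]
      [AddCommGroup X] [Module (MvPolynomial (Fin n) A) X]
      [AddCommGroup Z] [Module (MvPolynomial (Fin n) A) Z]
      (dN : TD A n N) (d : TD A n X) (dZ : TD A n Z)
      (f : N →ₗ[MvPolynomial (Fin n) A] X) (g : X →ₗ[MvPolynomial (Fin n) A] Z)
      (hf : Eqv dN d f) (hg : Eqv d dZ g) (hex : Function.Exact f g)
      (hN : ExtHol dN) (hZ : ExtHol dZ) : ExtHol d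

lemma eqv_zero (d : TD A n X) (d' : TD A n Y) : Eqv d d' 0 := fun b v => by simp

lemma ExtHol.of_inj {d : TD A n X} {d' : TD A n Y} (hd : ExtHol d')
    {g : X →ₗ[MvPolynomial (Fin n) A] Y} (hg : Eqv d d' g) (hi : Function.Injective g) :
    ExtHol d := by
  refine .mid d' d d' 0 g (eqv_zero _ _) hg ?_ hd hd
  intro v
  rw [map_eq_zero_iff g hi]
  constructor
  · rintro rfl; exact ⟨0, rfl⟩
  · rintro ⟨w, rfl⟩; rfl

lemma ExtHol.of_surj {d : TD A n X} {d' : TD A n Y} (hd : ExtHol d)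
    {g : X →ₗ[MvPolynomial (Fin n) A] Y} (hg : Eqv d d' g) (hi : Function.Surjective g) :
    ExtHol d' := by
  refine .mid d d' d g 0 hg (eqv_zero _ _) ?_ hd hd
  intro v
  simpa using hi v

lemma eqv_locMap {d : TD A n X} {d' : TD A n Y} {g : X →ₗ[MvPolynomial (Fin n) A] Y}
    (hg : Eqv d d' g) (f : Submonoid (MvPolynomial (Fin n) A)) :
    Eqv (d.loc f) (d'.loc f) (IsLocalizedModule.map f (LocalizedModule.mkLinearMap f X)
      (LocalizedModule.mkLinearMap f Y) g) := by
  apply loc_unique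
  · intro s
    have := (Module.End.isUnit_iff _).1 (loc_units (X := Y) f s)
    exact this.1
  · intro b v
    rw [← TD.loc_eqv, IsLocalizedModule.map_apply, IsLocalizedModule.map_apply, hg, TD.loc_eqv]

lemma ExtHol.loc {d : TD A n X} (hd : ExtHol d) (f : MvPolynomial (Fin n) A) :
    ExtHol (d.loc (Submonoid.powers f)) := by
  induction hd with
  | hol d C F h =>
    obtain ⟨C', F', h'⟩ := h.loc f
    exact .hol _ _ _ h'
  | mid dN d dZ i g hf hg hex hN hZ ihN ihZ =>
    exact .mid _ _ _ _ _ (eqv_locMap hf _) (eqv_locMap hg _)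
      (IsLocalizedModule.map_exact _ _ _ _ _ _ hex) ihN ihZ
end Hol
end LCB

end

noncomputable section
open CategoryTheory Opposite
namespace LCB

section Good
variable {A : Type u} [CommRing A] {n : ℕ}
variable {N : Type u} [AddCommGroup N] [Module (MvPolynomial (Fin n) A) N]
  {X : Type u} [AddCommGroup X] [Module (MvPolynomial (Fin n) A) X]
  {Y : Type u} [AddCommGroup Y] [Module (MvPolynomial (Fin n) A) Y]
  {Z : Type u} [AddCommGroup Z] [Module (MvPolynomial (Fin n) A) Z]

lemma ExtHol.of_subsingleton (d : TD A n X) [Subsingleton X] : ExtHol d := by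
  refine .hol d 0 (fun _ => ⊤) ⟨fun _ _ _ => le_rfl, fun _ => ⟨0, trivial⟩, fun _ _ _ _ => trivial,
    fun _ _ _ _ => trivial, fun _ _ _ _ => trivial, fun j => ⟨PUnit, _, _, 0, ?_, ?_⟩⟩
  · intro v _
    exact ⟨0, Subsingleton.elim _ _⟩
  · simp [Module.length_eq_zero]

lemma ExtHol.of_finset {ι : Type u} {Xs : ι → Type u} [∀ i, AddCommGroup (Xs i)]
    [∀ i, Module (MvPolynomial (Fin n) A) (Xs i)] (d : ∀ i, TD A n (Xs i)) (hd : ∀ i, ExtHol (d i))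
    (T : Finset ι) : ∀ (Y : Type u) [AddCommGroup Y] [Module (MvPolynomial (Fin n) A) Y]
    (dY : TD A n Y) (g : ∀ i, Y →ₗ[MvPolynomial (Fin n) A] Xs i) (_ : ∀ i, Eqv dY (d i) (g i))
    (_ : ∀ y, (∀ i ∈ T, g i y = 0) → y = 0), ExtHol dY := by
  classical
  induction T using Finset.induction_on with
  | empty =>
    intro Y _ _ dY g hg hy
    haveI : Subsingleton Y := ⟨fun a b => by rw [hy a (by simp), hy b (by simp)]⟩
    exact .of_subsingleton dY
  | insert a T ha ih =>
    intro Y _ _ dY g hg hy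
    refine .mid (dY.sub (LinearMap.ker (g a)) (ker_st (hg a))) dY (d a)
      (LinearMap.ker (g a)).subtype (g a) (TD.sub_eqv _ _ _) (hg a)
      (LinearMap.exact_subtype_ker_map _) ?_ (hd a)
    refine ih _ _ (fun i => (g i).comp (LinearMap.ker (g a)).subtype) (fun i b v => hg i b v) ?_
    intro y h
    apply Subtype.ext
    apply hy
    intro i hi
    rcases Finset.mem_insert.1 hi with rfl | hi
    · exact y.2
    · exact h i hi

lemma ExtHol.ker_of_exact {dN : TD A n N} {d : TD A n X} {dZ : TD A n Z}
    {f : N →ₗ[MvPolynomial (Fin n) A] X} {g : X →ₗ[MvPolynomial (Fin n) A] Z}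
    (hf : Eqv dN d f) (hg : Eqv d dZ g) (hex : Function.Exact f g) (hN : ExtHol dN) :
    ExtHol (d.sub (LinearMap.ker g) (ker_st hg)) := by
  refine hN.of_surj (g := f.codRestrict _ (fun v => hex.apply_apply_eq_zero v))
    (fun b v => Subtype.ext (hf b v)) ?_
  rintro ⟨x, hx⟩
  obtain ⟨y, rfl⟩ := (hex x).1 hx
  exact ⟨y, rfl⟩

lemma ExtHol.coker_of_exact {dN : TD A n N} {d : TD A n X} {dZ : TD A n Z}
    {f : N →ₗ[MvPolynomial (Fin n) A] X} {g : X →ₗ[MvPolynomial (Fin n) A] Z}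
    (hf : Eqv dN d f) (hg : Eqv d dZ g) (hex : Function.Exact f g) (hZ : ExtHol dZ) :
    ExtHol (d.quot (LinearMap.range f) (range_st hf)) := by
  have hle : LinearMap.range f ≤ LinearMap.ker g := by
    rintro _ ⟨v, rfl⟩
    exact hex.apply_apply_eq_zero v
  refine hZ.of_inj (g := (LinearMap.range f).liftQ g hle) ?_ ?_
  · intro b v
    obtain ⟨v, rfl⟩ := Submodule.mkQ_surjective _ v
    exact hg b v
  · rw [← LinearMap.ker_eq_bot, Submodule.ker_liftQ_eq_bot]
    rw [← LinearMap.exact_iff.1 hex]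

/-- multiplication by `π` -/
def mu (π : A) (X : Type u) [AddCommGroup X] [Module (MvPolynomial (Fin n) A) X] :
    X →ₗ[MvPolynomial (Fin n) A] X := LinearMap.lsmul _ X (MvPolynomial.C π)

lemma mu_apply (π : A) (x : X) :
  mu (n := n) π X x = (MvPolynomial.C π : MvPolynomial (Fin n) A) • x := rfl

variable (π : A)

lemma mu_eqv (d : TD A n X) : Eqv d d (mu (n := n) π X) := fun b v => (d.D_C b π v).symm

/-- kernel -/
def TD.kp (d : TD A n X) : TD A n (LinearMap.ker (mu (n := n) π X)) :=
  d.sub _ (ker_st (mu_eqv π d))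
/-- cokernel -/
def TD.cp (d : TD A n X) : TD A n (X ⧸ LinearMap.range (mu (n := n) π X)) :=
  d.quot _ (range_st (mu_eqv π d))

/-- goodness -/
def Good (d : TD A n X) : Prop := ExtHol (d.kp π) ∧ ExtHol (d.cp π)

lemma mu_comm (g : X →ₗ[MvPolynomial (Fin n) A] Y) : g.comp (mu (n := n) π X) = (mu (n := n) π Y).comp g := by
  ext v; simp [mu_apply]

/-- map on kernels -/
def kmap (g : X →ₗ[MvPolynomial (Fin n) A] Y) :
    LinearMap.ker (mu (n := n) π X) →ₗ[MvPolynomial (Fin n) A] LinearMap.ker (mu (n := n) π Y) :=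
  g.restrict (fun x hx => by
    rw [LinearMap.mem_ker, mu_apply] at *
    rw [← map_smul, hx, map_zero])

/-- map on cokernels -/
def cmap (g : X →ₗ[MvPolynomial (Fin n) A] Y) :
    (X ⧸ LinearMap.range (mu (n := n) π X)) →ₗ[MvPolynomial (Fin n) A]
      (Y ⧸ LinearMap.range (mu (n := n) π Y)) :=
  Submodule.mapQ _ _ g (by
    rintro _ ⟨x, rfl⟩
    exact ⟨g x, by simp [mu_apply]⟩)

variable {π}
lemma kmap_eqv {d : TD A n X} {d' : TD A n Y} {g : X →ₗ[MvPolynomial (Fin n) A] Y}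
    (hg : Eqv d d' g) : Eqv (d.kp π) (d'.kp π) (kmap π g) :=
  fun b v => Subtype.ext (hg b v)

lemma cmap_eqv {d : TD A n X} {d' : TD A n Y} {g : X →ₗ[MvPolynomial (Fin n) A] Y}
    (hg : Eqv d d' g) : Eqv (d.cp π) (d'.cp π) (cmap π g) := by
  intro b v
  obtain ⟨v, rfl⟩ := Submodule.mkQ_surjective _ v
  exact congrArg (Submodule.mkQ _) (hg b v)

lemma kmap_inj {g : X →ₗ[MvPolynomial (Fin n) A] Y} (h : Function.Injective g) :
    Function.Injective (kmap π g) := fun v w hvw => Subtype.ext (h (congrArg Subtype.val hvw))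

lemma cmap_surj {g : X →ₗ[MvPolynomial (Fin n) A] Y} (h : Function.Surjective g) :
    Function.Surjective (cmap π g) := by
  intro v
  obtain ⟨v, rfl⟩ := Submodule.mkQ_surjective _ v
  obtain ⟨v, rfl⟩ := h v
  exact ⟨Submodule.mkQ _ v, rfl⟩

lemma mu_loc (f : Submonoid (MvPolynomial (Fin n) A)) :
   IsLocalizedModule.map f (LocalizedModule.mkLinearMap f X)
      (LocalizedModule.mkLinearMap f X) (mu (n := n) π X) = mu (n := n) π (LocalizedModule f X) := by
  apply IsLocalizedModule.ext f (LocalizedModule.mkLinearMap f X) (loc_units f)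
  ext v
  simp only [LinearMap.comp_apply]
  rw [IsLocalizedModule.map_apply, mu_apply, mu_apply, map_smul]

lemma Good.loc {d : TD A n X} (h : Good π d) (f : MvPolynomial (Fin n) A) :
    Good π (d.loc (Submonoid.powers f)) := by
  constructor
  · have e1 : Function.Exact (LinearMap.ker (mu (n := n) π X)).subtype (mu (n := n) π X) :=
      LinearMap.exact_subtype_ker_map _
    have e2 := IsLocalizedModule.map_exact (Submonoid.powers f)
      (LocalizedModule.mkLinearMap (Submonoid.powers f) (LinearMap.ker (mu (n := n) π X)))
      (LocalizedModule.mkLinearMap (Submonoid.powers f) X)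
      (LocalizedModule.mkLinearMap (Submonoid.powers f) X) _ _ e1
    rw [mu_loc] at e2
    exact ExtHol.ker_of_exact (eqv_locMap (TD.sub_eqv d _ (ker_st (mu_eqv π d))) _)
      (mu_eqv π _) e2 (h.1.loc f)
  · have e1 : Function.Exact (mu (n := n) π X) (LinearMap.range (mu (n := n) π X)).mkQ :=
      LinearMap.exact_map_mkQ_range _
    have e2 := IsLocalizedModule.map_exact (Submonoid.powers f)
      (LocalizedModule.mkLinearMap (Submonoid.powers f) X)
      (LocalizedModule.mkLinearMap (Submonoid.powers f) X)
      (LocalizedModule.mkLinearMap (Submonoid.powers f) (X ⧸ LinearMap.range (mu (n := n) π X))) _ _ e1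
    rw [mu_loc] at e2
    exact ExtHol.coker_of_exact (mu_eqv π _)
      (eqv_locMap (TD.quot_eqv d _ (range_st (mu_eqv π d))) _) e2 (h.2.loc f)

lemma Good.pi {ι : Type u} [Fintype ι] {Xs : ι → Type u} [∀ i, AddCommGroup (Xs i)]
    [∀ i, Module (MvPolynomial (Fin n) A) (Xs i)] (d : ∀ i, TD A n (Xs i)) (hd : ∀ i, Good π (d i)) :
    Good π (TD.pi d) := by
  have hp : ∀ i, Eqv (TD.pi d) (d i) (LinearMap.proj i) := fun i b v => rfl
  constructor
  · refine ExtHol.of_finset (fun i => (d i).kp π) (fun i => (hd i).1) Finset.univ _ _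
      (fun i => kmap π (LinearMap.proj i)) (fun i => kmap_eqv (hp i)) ?_
    intro y hy
    apply Subtype.ext
    funext i
    exact congrArg Subtype.val (hy i (Finset.mem_univ _))
  · refine ExtHol.of_finset (fun i => (d i).cp π) (fun i => (hd i).2) Finset.univ _ _
      (fun i => cmap π (LinearMap.proj i)) (fun i => cmap_eqv (hp i)) ?_
    intro y hy
    obtain ⟨y, rfl⟩ := Submodule.mkQ_surjective _ y
    have h1 : ∀ i, ∃ x : Xs i, mu (n := n) π (Xs i) x = y i := by
      intro i
      have := hy i (Finset.mem_univ _)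
      change Submodule.mkQ _ (y i) = 0 at this
      rw [← LinearMap.mem_ker, Submodule.ker_mkQ] at this
      exact this
    choose x hx using h1
    rw [← LinearMap.mem_ker, Submodule.ker_mkQ]
    exact ⟨x, funext hx⟩

section Six
variable {dN : TD A n N} {d : TD A n X} {dZ : TD A n Z}
    {f : N →ₗ[MvPolynomial (Fin n) A] X} {g : X →ₗ[MvPolynomial (Fin n) A] Z}
    (hf : Eqv dN d f) (hg : Eqv d dZ g) (h : SES f g)

lemma six (hf : Eqv dN d f) (hg : Eqv d dZ g) (h : SES f g) : 
    ∃ δ : LinearMap.ker (mu (n := n) π Z) →ₗ[MvPolynomial (Fin n) A]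
      N ⧸ LinearMap.range (mu (n := n) π N), Eqv (dZ.kp π) (dN.cp π) δ ∧
      Function.Exact (kmap π g) δ ∧ Function.Exact δ (cmap π f) := by
  have hσ : g ∘ (Function.surjInv h.surj) = id := funext (Function.surjInv_eq h.surj)
  have hρ : (Function.invFun f) ∘ f = id := Function.invFun_comp h.inj
  have e3 : Function.Exact (LinearMap.ker (mu (n := n) π Z)).subtype (mu (n := n) π Z) :=
      LinearMap.exact_subtype_ker_map _
  have e2 : Function.Exact (LinearMap.ker (mu (n := n) π X)).subtype (mu (n := n) π X) :=
      LinearMap.exact_subtype_ker_map _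
  have c1 : Function.Exact (mu (n := n) π N) (LinearMap.range (mu (n := n) π N)).mkQ :=
      LinearMap.exact_map_mkQ_range _
  have c2 : Function.Exact (mu (n := n) π X) (LinearMap.range (mu (n := n) π X)).mkQ :=
      LinearMap.exact_map_mkQ_range _
  refine ⟨SnakeLemma.δ (mu (n := n) π N) (mu (n := n) π X) (mu (n := n) π Z) f g h.ex f g h.ex (mu_comm π f) (mu_comm π g) _ hσ
    _ hρ (LinearMap.ker (mu (n := n) π Z)).subtype e3 (LinearMap.range (mu (n := n) π N)).mkQ c1, ?_, ?_, ?_⟩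
  · intro b v
    obtain ⟨y, hy⟩ := h.surj v.1
    obtain ⟨z, hz⟩ := (h.ex (mu (n := n) π X y)).1 (by
      rw [mu_apply, map_smul, hy]; exact v.2)
    rw [SnakeLemma.δ_eq _ _ _ _ _ _ _ _ _ _ _ _ _ _ _ _ _ _ _ v y hy z hz,
      SnakeLemma.δ_eq _ _ _ _ _ _ _ _ _ _ _ _ _ _ _ _ _ _ _ ((dZ.kp π).D b v) (d.D b y)
        (by rw [hg, hy]; rfl) (dN.D b z) (by rw [hf, hz, mu_apply, mu_apply, TD.D_C])]
    rfl
  · exact SnakeLemma.exact_δ_right _ _ _ _ _ _ _ _ _ _ _ _ _ _ _ _ e2 _ _ _ _ _ rfl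
      Subtype.val_injective
  · exact SnakeLemma.exact_δ_left _ _ _ _ _ _ _ _ _ _ _ _ _ _ _ _ _ _ _ _ c2 _ rfl
      (Submodule.mkQ_surjective _)

lemma Good.right (hf : Eqv dN d f) (hg : Eqv d dZ g) (h : SES f g) (hX : Good π d)
    (hN : ExtHol (dN.cp π)) : Good π dZ := by
  obtain ⟨δ, h1, h2, h3⟩ := six (π := π) hf hg h
  exact ⟨.mid _ _ _ _ _ (kmap_eqv hg) h1 h2 hX.1 hN, hX.2.of_surj (cmap_eqv hg) (cmap_surj h.surj)⟩

lemma Good.left (hf : Eqv dN d f) (hg : Eqv d dZ g) (h : SES f g) (hX : Good π d)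
    (hZ : ExtHol (dZ.kp π)) : Good π dN := by
  obtain ⟨δ, h1, h2, h3⟩ := six (π := π) hf hg h
  exact ⟨hX.1.of_inj (kmap_eqv hf) (kmap_inj h.inj),
    .mid _ _ _ _ _ h1 (cmap_eqv hf) h3 hZ hX.2⟩
end Six

section Cech
variable (s : Finset (MvPolynomial (Fin n) A)) (d : TD A n X)

/-- on the first Cech term -/
def TD.lm : TD A n (Lm s X) := TD.pi (fun t : s => d.loc (Submonoid.powers (t : MvPolynomial (Fin n) A)))

lemma locMap_eqv : Eqv d (d.lm s) (locMap s X) := fun b v => by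
  funext t
  exact TD.loc_eqv _ d b v

variable {d} 
lemma Good.lm (h : Good π d) : Good π (d.lm s) := Good.pi _ fun t => h.loc _

lemma Good.qm (h : Good π d) : ∃ d' : TD A n (Qm s X), Good π d' := by
  refine ⟨(d.lm s).quot _ (range_st (locMap_eqv s d)), ?_⟩
  refine Good.right (dN := (d.lm s).sub _ (range_st (locMap_eqv s d))) (TD.sub_eqv _ _ _)
    (TD.quot_eqv _ _ _) (?_ : SES (LinearMap.range (locMap s X)).subtype
      (LinearMap.range (locMap s X)).mkQ) (h.lm s) ?_
  · exact ⟨Subtype.val_injective, Submodule.mkQ_surjective _, LinearMap.exact_subtype_mkQ _⟩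
  · refine h.2.of_surj (g := cmap π (locMap s X).rangeRestrict) (cmap_eqv ?_)
      (cmap_surj (LinearMap.surjective_rangeRestrict _))
    exact fun b v => Subtype.ext (locMap_eqv s d b v)

lemma Good.gm (h : Good π d) : Good π (d.sub (Gm s X) (ker_st (locMap_eqv s d))) := by
  refine Good.left (dZ := (d.lm s).sub _ (range_st (locMap_eqv s d))) (TD.sub_eqv _ _ _)
    (g := (locMap s X).rangeRestrict) (fun b v => Subtype.ext (locMap_eqv s d b v)) ?_ h ?_
  · refine ⟨Subtype.val_injective, LinearMap.surjective_rangeRestrict _, ?_⟩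
    intro v
    constructor
    · intro hv
      exact ⟨⟨v, congrArg Subtype.val hv⟩, rfl⟩
    · rintro ⟨v, rfl⟩
      exact Subtype.ext v.2
  · exact (h.lm s).1.of_inj (kmap_eqv (TD.sub_eqv _ _ _)) (kmap_inj Subtype.val_injective)
end Cech
end Good
end LCB

end

noncomputable section
open CategoryTheory Opposite
namespace LCB

section Base
variable {A : Type u} [CommRing A] {n : ℕ}

lemma totalDegree_coeff_monomial (a : A) (k : ℕ) : ∀ (b : Fin n →₀ ℕ), b.degree = k → ∀ c : Fin n →₀ ℕ,
    (MvPowerSeries.coeff c (tau (MvPolynomial.monomial b a))).totalDegree ≤ k := by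
  induction k with
  | zero =>
    intro b hb c
    have : b = 0 := (Finsupp.degree_eq_zero_iff b).1 hb
    rw [this]
    change (MvPowerSeries.coeff c (tau (MvPolynomial.C a))).totalDegree ≤ 0
    rw [tau_C, MvPowerSeries.coeff_C]
    split_ifs <;> simp
  | succ k ih =>
    intro b hb c
    have hb0 : b ≠ 0 := by
      rintro rfl; simp at hb
    obtain ⟨i, hi⟩ := Finsupp.ne_iff.1 hb0
    have hle : Finsupp.single i 1 ≤ b := by
      rw [Finsupp.single_le_iff]; simp at hi; omega
    obtain ⟨b', rfl⟩ := exists_add_of_le hle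
    rw [map_add, Finsupp.degree_single] at hb
    have h1 := ih b' (by omega)
    have : MvPolynomial.monomial (Finsupp.single i 1 + b') a =
        MvPolynomial.monomial b' a * MvPolynomial.X i := by
      rw [add_comm, MvPolynomial.X, MvPolynomial.monomial_mul, mul_one]
    rw [this, coeff_tau_mul_X]
    refine (MvPolynomial.totalDegree_add _ _).trans (max_le ?_ ?_)
    · refine (MvPolynomial.totalDegree_mul _ _).trans (Nat.add_le_add (h1 c) ?_)
      exact (MvPolynomial.totalDegree_monomial_le _ _).trans (by simp)
    · split_ifs
      · simp
      · exact (h1 _).trans (by omega)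

lemma totalDegree_coeff (p : MvPolynomial (Fin n) A) (c : Fin n →₀ ℕ) :
    (MvPowerSeries.coeff c (tau p)).totalDegree ≤ p.totalDegree := by
  conv_lhs => rw [p.as_sum, map_sum, map_sum]
  refine MvPolynomial.totalDegree_finsetSum_le fun b hb => ?_
  exact (totalDegree_coeff_monomial _ _ b rfl c).trans (MvPolynomial.le_totalDegree hb)

variable (π : A)

/-- one monomial -/
def psi (b : Fin n →₀ ℕ) : (A ⧸ Ideal.span {π}) →ₛₗ[(MvPolynomial.C : A →+* MvPolynomial (Fin n) A)]
    (MvPolynomial (Fin n) A ⧸ LinearMap.range (mu (n := n) π (MvPolynomial (Fin n) A))) :=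
  Submodule.liftQ (Ideal.span {π})
    { toFun := fun a => Submodule.mkQ _ (MvPolynomial.monomial b a)
      map_add' := fun x y => by rw [map_add, map_add]
      map_smul' := fun x y => by
        rw [← map_smul, smul_eq_mul, smul_eq_mul, MvPolynomial.C_mul_monomial] }
    (by
      rw [Ideal.span, Submodule.span_le, Set.singleton_subset_iff]
      change Submodule.mkQ _ (MvPolynomial.monomial b π) = 0
      rw [← LinearMap.mem_ker, Submodule.ker_mkQ]
      refine ⟨MvPolynomial.monomial b 1, ?_⟩
      rw [mu_apply, smul_eq_mul, MvPolynomial.C_mul_monomial, mul_one])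

lemma psi_mk (b : Fin n →₀ ℕ) (a : A) : psi π b (Submodule.mkQ (Ideal.span {π}) a) =
  Submodule.mkQ _ (MvPolynomial.monomial b a) := rfl

/-- box exponents -/
def boxE (n j : ℕ) (β : Fin n → Fin (j + 1)) : Fin n →₀ ℕ := Finsupp.equivFunOnFinite.symm (fun i => (β i : ℕ))

lemma boxE_inj (n j : ℕ) : Function.Injective (boxE n j) := by
  intro β γ h
  funext i
  exact Fin.ext (congrArg (fun f => f i) h)

lemma mem_boxE {n j : ℕ} {b : Fin n →₀ ℕ} (h : ∀ i, b i ≤ j) : ∃ β, boxE n j β = b :=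
  ⟨fun i => ⟨b i, by have := h i; omega⟩, by ext i; rfl⟩

lemma good_self [IsNoetherianRing A] (hreg : π ∈ nonZeroDivisors A)
    (hπ : ringKrullDim (A ⧸ Ideal.span {π}) = 0) :
    Good π (TD.self : TD A n (MvPolynomial (Fin n) A)) := by
  constructor
  · have : Subsingleton (LinearMap.ker (mu (n := n) π (MvPolynomial (Fin n) A))) := by
      rw [Submodule.subsingleton_iff_eq_bot, LinearMap.ker_eq_bot']
      intro p hp
      rw [mu_apply, smul_eq_mul] at hp
      ext b
      have := congrArg (MvPolynomial.coeff b) hp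
      rw [MvPolynomial.coeff_C_mul] at this
      simpa using (mul_left_mem_nonZeroDivisors_eq_zero_iff hreg).1 this
    exact .of_subsingleton _
  · have hart : IsArtinianRing (A ⧸ Ideal.span {π}) := by
      rw [isArtinianRing_iff_isNoetherianRing_krullDimLE_zero]
      refine ⟨inferInstance, ?_⟩
      rw [Ring.krullDimLE_iff, hπ]; rfl
    have hfl : Module.length A (A ⧸ Ideal.span {π}) ≠ ⊤ := by
      haveI : IsArtinian A (A ⧸ Ideal.span {π}) :=
        isArtinian_of_surjective_algebraMap (S := A)
          (R := A ⧸ Ideal.span {π}) (M := A ⧸ Ideal.span {π}) Ideal.Quotient.mk_surjective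
      exact Module.length_ne_top
    obtain ⟨ℓ, hℓ⟩ := ENat.ne_top_iff_exists.1 hfl
    refine .hol _ ℓ (fun j => ((MvPolynomial.restrictTotalDegree (Fin n) A j).toAddSubgroup).map
      (Submodule.mkQ _).toAddMonoidHom) ⟨?_, ?_, ?_, ?_, ?_, ?_⟩
    · rintro i j hij _ ⟨p, hp, rfl⟩
      refine ⟨p, ?_, rfl⟩
      have hp : p ∈ MvPolynomial.restrictTotalDegree (Fin n) A i := hp
      change p ∈ MvPolynomial.restrictTotalDegree (Fin n) A j
      rw [MvPolynomial.mem_restrictTotalDegree] at *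
      exact hp.trans hij
    · intro v
      obtain ⟨p, rfl⟩ := Submodule.mkQ_surjective _ v
      exact ⟨p.totalDegree, p, (MvPolynomial.mem_restrictTotalDegree _ _ _).2 le_rfl, rfl⟩
    · rintro a j _ ⟨p, hp, rfl⟩
      refine ⟨a • p, (MvPolynomial.restrictTotalDegree (Fin n) A j).smul_mem a hp, ?_⟩
      rw [MvPolynomial.smul_eq_C_mul]
      rfl
    · rintro i j _ ⟨p, hp, rfl⟩
      refine ⟨MvPolynomial.X i * p, ?_, rfl⟩
      have hp : p ∈ MvPolynomial.restrictTotalDegree (Fin n) A j := hp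
      change _ ∈ MvPolynomial.restrictTotalDegree (Fin n) A (j + 1)
      rw [MvPolynomial.mem_restrictTotalDegree] at *
      refine (MvPolynomial.totalDegree_mul _ _).trans ?_
      have : (MvPolynomial.X i : MvPolynomial (Fin n) A).totalDegree ≤ 1 :=
        (MvPolynomial.totalDegree_monomial_le _ _).trans (by simp)
      omega
    · rintro b j _ ⟨p, hp, rfl⟩
      refine ⟨MvPowerSeries.coeff b (tau p), ?_, rfl⟩
      have hp : p ∈ MvPolynomial.restrictTotalDegree (Fin n) A j := hp
      change _ ∈ MvPolynomial.restrictTotalDegree (Fin n) A (j + _)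
      rw [MvPolynomial.mem_restrictTotalDegree] at *
      have := totalDegree_coeff p b
      omega
    · intro j
      let φ : ((Fin n → Fin (j + 1)) → A ⧸ Ideal.span {π})
          →ₛₗ[(MvPolynomial.C : A →+* MvPolynomial (Fin n) A)]
          (MvPolynomial (Fin n) A ⧸ LinearMap.range (mu (n := n) π (MvPolynomial (Fin n) A))) :=
        ∑ β, (psi π (boxE n j β)).comp (LinearMap.proj (R := A) β)
      refine ⟨_, _, _, φ, ?_, ?_⟩
      · rintro _ ⟨p, hp, rfl⟩
        have hp : p ∈ MvPolynomial.restrictTotalDegree (Fin n) A j := hp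
        rw [MvPolynomial.mem_restrictTotalDegree] at hp
        refine ⟨fun β => Submodule.mkQ (Ideal.span {π}) (p.coeff (boxE n j β)), ?_⟩
        classical
        have h1 : p = ∑ β, MvPolynomial.monomial (boxE n j β) (p.coeff (boxE n j β)) := by
          rw [← Finset.sum_image (s := Finset.univ) (g := boxE n j)
            (f := fun b => MvPolynomial.monomial b (p.coeff b)) (fun _ _ _ _ h => boxE_inj n j h)]
          conv_lhs => rw [p.as_sum]
          refine Finset.sum_subset ?_ ?_
          · intro b hb
            obtain ⟨β, rfl⟩ := mem_boxE (b := b) (j := j) (fun i =>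
              (Finsupp.le_degree i b).trans ((MvPolynomial.le_totalDegree hb).trans hp))
            exact Finset.mem_image_of_mem _ (Finset.mem_univ _)
          · intro b _ hb
            rw [MvPolynomial.notMem_support_iff.1 hb, map_zero]
        simp only [φ, LinearMap.sum_apply, LinearMap.comp_apply, LinearMap.proj_apply, psi_mk]
        rw [← map_sum, ← h1]
        rfl
      · rw [Module.length_pi_of_fintype]
        simp only [← hℓ]
        simp
        rw [mul_comm]
end Base
end LCB

end

noncomputable section
open CategoryTheory Opposite
namespace LCB

section FieldA
open TensorProduct

lemma exists_socle (Z S Ω : Type u) [CommRing Z] [CommRing S] [Algebra Z S]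
    [Algebra.FiniteType Z S] [Algebra.IsAlgebraic Z S] [Field Ω] [Algebra Z Ω] [FaithfulSMul Z Ω]
    [Algebra S Ω] [IsScalarTower Z S Ω] :
    ∃ e : Ω ⊗[Z] S, e ≠ 0 ∧
      ∀ s : S, (LinearMap.mulLeft Z s).baseChange Ω e = algebraMap S Ω s • e := by
  haveI : Algebra.IsIntegral Ω (Ω ⊗[Z] S) := Algebra.IsAlgebraic.isIntegral
  haveI : Module.Finite Ω (Ω ⊗[Z] S) := Algebra.IsIntegral.finite
  haveI : IsArtinianRing (Ω ⊗[Z] S) := IsArtinianRing.of_finite Ω _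
  let μ : Ω ⊗[Z] S →ₐ[Ω] Ω := Algebra.TensorProduct.lift (AlgHom.id Ω Ω)
    (IsScalarTower.toAlgHom Z S Ω) (fun _ _ => mul_comm _ _)
  have hμ : ∀ s : S, μ (1 ⊗ₜ s) = algebraMap S Ω s := fun s =>
    (Algebra.TensorProduct.lift_tmul _ _ _ _ _).trans (by rw [map_one, one_mul]; rfl)
  have hprime : (RingHom.ker μ).IsPrime := RingHom.ker_isPrime μ
  have hmin : RingHom.ker μ ∈ (Module.annihilator (Ω ⊗[Z] S) (Ω ⊗[Z] S)).minimalPrimes := by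
    refine ⟨⟨hprime, ?_⟩, ?_⟩
    · intro a ha
      rw [Module.mem_annihilator] at ha
      have : a = 0 := by simpa using ha 1
      rw [this]; exact zero_mem _
    · rintro q ⟨hq, -⟩ hle
      haveI := hq
      haveI : q.IsMaximal := IsArtinianRing.isMaximal_of_isPrime q
      exact (this.eq_of_le hprime.ne_top hle).ge
  have hass := Module.associatedPrimes.minimalPrimes_annihilator_subset_associatedPrimes _ _ hmin
  obtain ⟨-, e, he⟩ := isAssociatedPrime_iff.1 hass
  refine ⟨e, ?_, ?_⟩
  · rintro rfl
    apply hprime.ne_top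
    rw [he, eq_top_iff]
    intro x _
    simp [Submodule.mem_colon_singleton]
  · intro s
    have hs : (1 ⊗ₜ s - algebraMap Ω (Ω ⊗[Z] S) (algebraMap S Ω s) : Ω ⊗[Z] S) ∈ RingHom.ker μ := by
      rw [RingHom.mem_ker, map_sub, hμ, AlgHom.commutes]
      simp
    rw [he, Submodule.mem_colon_singleton, Submodule.mem_bot, smul_eq_mul, sub_mul, sub_eq_zero,
      ← Algebra.smul_def] at hs
    rw [← hs]
    have : ∀ x : Ω ⊗[Z] S, (LinearMap.mulLeft Z s).baseChange Ω x = (1 ⊗ₜ s) * x := by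
      intro x
      induction x using TensorProduct.induction_on with
      | zero => simp
      | tmul a b => simp
      | add x y hx hy => rw [map_add, hx, hy, mul_add]
    exact this e

lemma flat_of_faithful (Z Ω : Type u) [CommRing Z] [IsDomain Z] [Field Ω] [Algebra Z Ω]
    [FaithfulSMul Z Ω] : Module.Flat Z Ω := by
  letI := FractionRing.liftAlgebra Z Ω
  haveI := FractionRing.isScalarTower_liftAlgebra Z Ω
  haveI : Module.Flat Z (FractionRing Z) := IsLocalization.flat _ (nonZeroDivisors Z)
  exact Module.Flat.trans Z (FractionRing Z) Ω

lemma indep_aux {Ω W τ ι : Type*} [Field Ω] [AddCommGroup W] [Module Ω W] [DecidableEq τ]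
    (Yo : τ → W →ₗ[Ω] W) (DD : (τ →₀ ℕ) → W →ₗ[Ω] W) (w : ι → W) [Fintype ι]
    (h0 : ∀ v, DD 0 v = v)
    (hY : ∀ j b i, Yo j (DD b (w i)) = if b j = 0 then 0 else DD (b - Finsupp.single j 1) (w i))
    (hw : LinearIndependent Ω w) (m : ℕ) : ∀ (T : Finset (τ →₀ ℕ)) (_ : ∀ b ∈ T, b.degree ≤ m)
    (c : (τ →₀ ℕ) → ι → Ω) (_ : ∑ b ∈ T, ∑ i, c b i • DD b (w i) = 0), ∀ b ∈ T, ∀ i, c b i = 0 := by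
  classical
  induction m with
  | zero =>
    intro T hT c hc b hb i
    have hb0 : ∀ b ∈ T, b = 0 := fun b hb => by
      have := hT b hb
      exact (Finsupp.degree_eq_zero_iff b).1 (by omega)
    rw [Finset.sum_eq_single b] at hc
    · have := hb0 b hb
      subst this
      simp only [h0] at hc
      exact Fintype.linearIndependent_iff.1 hw _ hc i
    · intro b' hb' hne
      exact absurd ((hb0 b' hb').trans (hb0 b hb).symm) hne
    · exact fun h => absurd hb h
  | succ m ih =>
    intro T hT c hc
    have key : ∀ b ∈ T, b ≠ 0 → ∀ i, c b i = 0 := by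
      intro b hb hb0
      obtain ⟨j, hj⟩ := Finsupp.ne_iff.1 hb0
      rw [Finsupp.zero_apply] at hj
      have h1 := congrArg (Yo j) hc
      simp only [map_sum, map_smul, map_zero, hY] at h1
      have h2 : ∑ b ∈ (T.filter (fun b => b j ≠ 0)).image (fun b => b - Finsupp.single j 1),
          ∑ i, c (b + Finsupp.single j 1) i • DD b (w i) = 0 := by
        rw [Finset.sum_image]
        · rw [Finset.sum_filter]
          refine Eq.trans ?_ h1
          refine Finset.sum_congr rfl fun b _ => ?_
          by_cases hbj : b j = 0
          · simp [hbj]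
          · simp only [hbj, ne_eq, not_false_eq_true, if_true, if_false]
            rw [tsub_add_cancel_of_le]
            rw [Finsupp.single_le_iff]; omega
        · intro b hb b' hb' h
          simp only [Finset.coe_filter, Set.mem_setOf_eq] at hb hb'
          have e1 : Finsupp.single j 1 ≤ b := by rw [Finsupp.single_le_iff]; omega
          have e2 : Finsupp.single j 1 ≤ b' := by rw [Finsupp.single_le_iff]; omega
          rw [← tsub_add_cancel_of_le e1, ← tsub_add_cancel_of_le e2]
          simp only at h
          rw [h]
      have e1 : Finsupp.single j 1 ≤ b := by rw [Finsupp.single_le_iff]; omega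
      intro i
      have := ih _ (by
        intro b' hb'
        rw [Finset.mem_image] at hb'
        obtain ⟨b, hb, rfl⟩ := hb'
        rw [Finset.mem_filter] at hb
        have e1 : Finsupp.single j 1 ≤ b := by rw [Finsupp.single_le_iff]; omega
        have e2 := congrArg Finsupp.degree (tsub_add_cancel_of_le e1)
        rw [map_add, Finsupp.degree_single] at e2
        have := hT b hb.1
        omega) (fun b => c (b + Finsupp.single j 1)) h2 (b - Finsupp.single j 1)
        (Finset.mem_image_of_mem _ (Finset.mem_filter.2 ⟨hb, hj⟩)) i
      simpa [tsub_add_cancel_of_le e1] using this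
    intro b hb i
    by_cases hb0 : b = 0
    · rw [Finset.sum_eq_single b] at hc
      · subst hb0
        simp only [h0] at hc
        exact Fintype.linearIndependent_iff.1 hw _ hc i
      · intro b' hb' hne
        exact Finset.sum_eq_zero fun i _ => by
          rw [key b' hb' (by rw [hb0] at hne; exact hne), zero_smul]
      · exact fun h => absurd hb h
    · exact key b hb hb0 i

lemma indep_D {Ω W τ ι : Type*} [Field Ω] [AddCommGroup W] [Module Ω W] [DecidableEq τ]
    (Yo : τ → W →ₗ[Ω] W) (DD : (τ →₀ ℕ) → W →ₗ[Ω] W) (w : ι → W) [Fintype ι]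
    (h0 : ∀ v, DD 0 v = v)
    (hY : ∀ j b i, Yo j (DD b (w i)) = if b j = 0 then 0 else DD (b - Finsupp.single j 1) (w i))
    (hw : LinearIndependent Ω w) {κ : Type*} [Fintype κ] (bx : κ → (τ →₀ ℕ))
    (hbx : Function.Injective bx) :
    LinearIndependent Ω (fun p : κ × ι => DD (bx p.1) (w p.2)) := by
  classical
  rw [Fintype.linearIndependent_iff]
  intro g hg
  rw [Fintype.sum_prod_type] at hg
  have := indep_aux Yo DD w h0 hY hw ((Finset.univ.image bx).sup Finsupp.degree)
    (Finset.univ.image bx) (fun b hb => Finset.le_sup (f := Finsupp.degree) hb)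
    (fun b i => if h : ∃ a, bx a = b then g (h.choose, i) else 0) (by
      rw [Finset.sum_image (fun _ _ _ _ h => hbx h), ← hg]
      refine Finset.sum_congr rfl fun a _ => Finset.sum_congr rfl fun i _ => ?_
      have h : ∃ a', bx a' = bx a := ⟨a, rfl⟩
      rw [dif_pos h]
      rw [hbx h.choose_spec])
  rintro ⟨a, i⟩
  have h := this (bx a) (Finset.mem_image_of_mem _ (Finset.mem_univ _)) i
  have h' : ∃ a', bx a' = bx a := ⟨a, rfl⟩
  rw [dif_pos h', hbx h'.choose_spec] at h
  exact h

lemma extract {Ω W ι : Type*} [Field Ω] [AddCommGroup W] [Module Ω W] [Fintype ι]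
    (w : ι → W) (hw : LinearIndependent Ω w) (T : Set W) (hT : ∀ i, w i ∈ Submodule.span Ω T) :
    ∃ v : ι → W, (∀ i, v i ∈ T) ∧ LinearIndependent Ω v := by
  obtain ⟨b, hb, hs, hi⟩ := exists_linearIndependent Ω T
  have h1 : Module.rank Ω (Submodule.span Ω b) = Cardinal.mk b := rank_span_set hi
  have hT' : ∀ i, w i ∈ Submodule.span Ω b := fun i => hs ▸ hT i
  have h2 : LinearIndependent Ω (fun i => (⟨w i, hT' i⟩ : Submodule.span Ω b)) :=
    LinearIndependent.of_comp (Submodule.span Ω b).subtype hw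
  have h3 := h2.cardinal_lift_le_rank
  rw [h1, Cardinal.lift_mk_le'] at h3
  obtain ⟨f⟩ := h3
  exact ⟨fun i => f i, fun i => hb (f i).2, hi.comp f f.injective⟩
end FieldA
end LCB

end

noncomputable section
open CategoryTheory Opposite
namespace LCB

section Core
open TensorProduct

def bxF (σ : Type) [Fintype σ] (m : ℕ) (f : σ → Fin (m + 1)) : σ →₀ ℕ :=
  Finsupp.equivFunOnFinite.symm (fun i => (f i : ℕ))

lemma bxF_inj (σ : Type) [Fintype σ] (m : ℕ) : Function.Injective (bxF σ m) := by
  intro f g h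
  funext i
  have := DFunLike.congr_fun h i
  exact Fin.ext this

lemma bxF_deg (σ : Type) [Fintype σ] (m : ℕ) (f : σ → Fin (m + 1)) :
    (bxF σ m f).degree ≤ Fintype.card σ * m := by
  rw [Finsupp.degree_eq_sum]
  refine (Finset.sum_le_card_nsmul _ _ m fun i _ => ?_).trans (by simp [Finset.card_univ])
  have : (bxF σ m f) i = (f i : ℕ) := rfl
  rw [this]
  have := (f i).2
  omega

lemma core_arith {C n s J : ℕ} (h : (J + 1) ^ n * s ≤ C * (J + n * J + 1) ^ n) :
    s ≤ C * (n + 1) ^ n := by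
  have h1 : (J + n * J + 1) ^ n ≤ ((n + 1) * (J + 1)) ^ n := by
    apply Nat.pow_le_pow_left
    nlinarith
  have h2 : (J + 1) ^ n * s ≤ (J + 1) ^ n * (C * (n + 1) ^ n) := by
    refine h.trans ((Nat.mul_le_mul_left C h1).trans (le_of_eq ?_))
    rw [mul_pow]; ring
  exact Nat.le_of_mul_le_mul_left h2 (by positivity)

lemma mono_mem {k : Type u} [Field k] {σ : Type} {X : Type u} [AddCommGroup X]
    [Module (MvPolynomial σ k) X] (F : ℕ → Set X)
    (FX : ∀ i j v, v ∈ F j → (MvPolynomial.X i : MvPolynomial σ k) • v ∈ F (j + 1))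
    (q : σ →₀ ℕ) : ∀ (j : ℕ) (v : X), v ∈ F j →
      (MvPolynomial.monomial q (1 : k) : MvPolynomial σ k) • v ∈ F (j + q.degree) := by
  induction q using Finsupp.induction_linear with
  | zero => intro j v hv; simpa using hv
  | add p q hp hq =>
    intro j v hv
    have := hq _ _ (hp _ _ hv)
    rw [← mul_smul, MvPolynomial.monomial_mul, mul_one] at this
    rwa [map_add, ← add_assoc, add_comm p q]
  | single i m =>
    induction m with
    | zero => intro j v hv; simpa using hv
    | succ m ih =>
      intro j v hv
      have := FX i _ _ (ih _ _ hv)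
      rw [← mul_smul, MvPolynomial.X, MvPolynomial.monomial_mul, mul_one, ← Finsupp.single_add,
        Finsupp.degree_single] at this
      rw [Finsupp.degree_single, add_comm m 1, add_left_comm, add_comm 1]
      exact this

lemma core {k : Type u} [Field k] {σ τ : Type} [Fintype σ] [Fintype τ] [DecidableEq τ]
    (S Ω X : Type u) [CommRing S] [Algebra (MvPolynomial σ k) S]
    [Algebra.FiniteType (MvPolynomial σ k) S] [Algebra.IsAlgebraic (MvPolynomial σ k) S]
    [Field Ω] [Algebra (MvPolynomial σ k) Ω] [FaithfulSMul (MvPolynomial σ k) Ω]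
    [Algebra S Ω] [IsScalarTower (MvPolynomial σ k) S Ω] [AddCommGroup X] [Module k X]
    [Module (MvPolynomial σ k) X] [IsScalarTower k (MvPolynomial σ k) X]
    (Y : τ → X →ₗ[MvPolynomial σ k] X) (yS : τ → S) (s : ℕ)
    (g : Fin s → S →ₗ[MvPolynomial σ k] X)
    (hg : ∀ i j c, g i (yS j * c) = Y j (g i c))
    (hinj : ∀ c : Fin s → S, ∑ i, g i (c i) = 0 → c = 0)
    (Dz : (τ →₀ ℕ) → X →ₗ[MvPolynomial σ k] X) (hD0 : ∀ v, Dz 0 v = v)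
    (hDY : ∀ b j v, Dz b (Y j v) = Y j (Dz b v) +
      if b j = 0 then 0 else Dz (b - Finsupp.single j 1) v)
    (F : ℕ → Set X) (Fmono : Monotone F) (Fexh : ∀ v, ∃ j, v ∈ F j)
    (FX : ∀ i j v, v ∈ F j → (MvPolynomial.X i : MvPolynomial σ k) • v ∈ F (j + 1))
    (FD : ∀ b j v, v ∈ F j → Dz b v ∈ F (j + b.degree)) (C : ℕ)
    (hF : ∀ (N j : ℕ) (v : Fin N → X), (∀ i, v i ∈ F j) → LinearIndependent k v →
      N ≤ C * (j + 1) ^ (Fintype.card σ + Fintype.card τ)) :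
    s ≤ C * (Fintype.card σ + Fintype.card τ + 1) ^ (Fintype.card σ + Fintype.card τ) := by
  classical
  set n := Fintype.card σ + Fintype.card τ with hn
  obtain ⟨e, he0, he⟩ := exists_socle (MvPolynomial σ k) S Ω
  haveI : Module.Flat (MvPolynomial σ k) Ω := flat_of_faithful _ _
  let w : Fin s → Ω ⊗[MvPolynomial σ k] X := fun i => (g i).baseChange Ω e
  have hwi : LinearIndependent Ω w := by
    let G : (Fin s → S) →ₗ[MvPolynomial σ k] X := ∑ i, (g i) ∘ₗ LinearMap.proj i
    have hG : Function.Injective G := by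
      rw [← LinearMap.ker_eq_bot, LinearMap.ker_eq_bot']
      intro c hc
      apply hinj
      simpa [G] using hc
    have hGb : Function.Injective (G.baseChange Ω) :=
      Module.Flat.lTensor_preserves_injective_linearMap (M := Ω) G hG
    rw [Fintype.linearIndependent_iff]
    intro ω hω i
    have h1 : ∀ i, w i = G.baseChange Ω ((LinearMap.single _ (fun _ => S) i).baseChange Ω e) := by
      intro i
      have : g i = G ∘ₗ LinearMap.single _ (fun _ => S) i := by
        ext c
        simp only [G, LinearMap.comp_apply, LinearMap.sum_apply, LinearMap.proj_apply,
          LinearMap.single_apply]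
        rw [Finset.sum_eq_single i]
        · simp
        · intro j _ hj; simp [hj]
        · simp
      show (g i).baseChange Ω e = _
      conv_lhs => rw [this, LinearMap.baseChange_comp]
      rfl
    simp only [h1, ← map_smul] at hω
    rw [← map_sum, ← map_zero (G.baseChange Ω)] at hω
    have h2 := congrArg ((LinearMap.proj i : (Fin s → S) →ₗ[MvPolynomial σ k] S).baseChange Ω)
      (hGb hω)
    have h3 : ∀ j, (LinearMap.proj i : (Fin s → S) →ₗ[MvPolynomial σ k] S).baseChange Ω
        ((LinearMap.single (MvPolynomial σ k) (fun _ => S) j).baseChange Ω e) =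
        if j = i then e else 0 := by
      intro j
      rw [← LinearMap.comp_apply, ← LinearMap.baseChange_comp]
      split_ifs with h
      · subst h
        rw [LinearMap.proj_comp_single_same, LinearMap.baseChange_id]; rfl
      · rw [LinearMap.proj_comp_single_ne _ _ _ _ (Ne.symm h), LinearMap.baseChange_zero]; rfl
    simp only [map_sum, map_smul, map_zero, h3] at h2
    simp only [smul_ite, smul_zero, Finset.sum_ite_eq', Finset.mem_univ, if_true] at h2
    exact (smul_eq_zero.1 h2).resolve_right he0
  -- spans
  let sp : ℕ → Submodule Ω (Ω ⊗[MvPolynomial σ k] X) := fun j =>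
    Submodule.span Ω ((fun v : X => (1 : Ω) ⊗ₜ[MvPolynomial σ k] v) '' F j)
  have spmono : Monotone sp := fun a b h => Submodule.span_mono (Set.image_mono (Fmono h))
  have hx : ∀ x : Ω ⊗[MvPolynomial σ k] X, ∃ j, x ∈ sp j := by
    intro x
    induction x using TensorProduct.induction_on with
    | zero => exact ⟨0, zero_mem _⟩
    | tmul a v =>
      obtain ⟨j, hj⟩ := Fexh v
      refine ⟨j, ?_⟩
      have : a ⊗ₜ[MvPolynomial σ k] v = a • ((1 : Ω) ⊗ₜ[MvPolynomial σ k] v) := by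
        rw [TensorProduct.smul_tmul', smul_eq_mul, mul_one]
      rw [this]
      exact Submodule.smul_mem _ _ (Submodule.subset_span ⟨v, hj, rfl⟩)
    | add x y hx hy =>
      obtain ⟨a, ha⟩ := hx
      obtain ⟨b, hb⟩ := hy
      exact ⟨max a b, add_mem (spmono (le_max_left _ _) ha) (spmono (le_max_right _ _) hb)⟩
  obtain ⟨J, hJ⟩ : ∃ J, ∀ i, w i ∈ sp J := by
    choose j hj using fun i => hx (w i)
    exact ⟨Finset.univ.sup j, fun i => spmono (Finset.le_sup (Finset.mem_univ i)) (hj i)⟩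
  have spD : ∀ b j x, x ∈ sp j → (Dz b).baseChange Ω x ∈ sp (j + b.degree) := by
    intro b j x hx
    have : sp j ≤ (sp (j + b.degree)).comap ((Dz b).baseChange Ω) := by
      refine Submodule.span_le.2 ?_
      rintro _ ⟨v, hv, rfl⟩
      exact Submodule.subset_span ⟨Dz b v, FD b j v hv, by simp⟩
    exact this hx
  let Yo : τ → (Ω ⊗[MvPolynomial σ k] X) →ₗ[Ω] (Ω ⊗[MvPolynomial σ k] X) := fun j =>
    algebraMap S Ω (yS j) • LinearMap.id - (Y j).baseChange Ω
  have hYw : ∀ j i, (Y j).baseChange Ω (w i) = algebraMap S Ω (yS j) • w i := by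
    intro j i
    have h1 : Y j ∘ₗ g i = g i ∘ₗ LinearMap.mulLeft _ (yS j) := by
      ext c; exact (hg i j c).symm
    have h2 := congrArg (fun f => f.baseChange Ω e) h1
    simp only [LinearMap.baseChange_comp, LinearMap.comp_apply, he, map_smul] at h2
    exact h2
  have hDYb : ∀ b j x, (Dz b).baseChange Ω ((Y j).baseChange Ω x) =
      (Y j).baseChange Ω ((Dz b).baseChange Ω x) +
      if b j = 0 then 0 else (Dz (b - Finsupp.single j 1)).baseChange Ω x := by
    intro b j x
    have h1 : Dz b ∘ₗ Y j = Y j ∘ₗ Dz b + if b j = 0 then 0 else Dz (b - Finsupp.single j 1) := by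
      ext v
      rw [LinearMap.comp_apply, hDY, LinearMap.add_apply]
      split_ifs <;> rfl
    have h2 := congrArg (fun f => f.baseChange Ω x) h1
    simp only [LinearMap.baseChange_comp, LinearMap.baseChange_add, LinearMap.add_apply,
      LinearMap.comp_apply] at h2
    rw [h2]
    split_ifs <;> simp
  have hind := indep_D Yo (fun b => (Dz b).baseChange Ω) w (by
      intro v
      have : Dz 0 = LinearMap.id := LinearMap.ext hD0
      simp only [this, LinearMap.baseChange_id]; rfl) (by
      intro j b i
      have h := hDYb b j (w i)
      rw [hYw, map_smul] at h
      simp only [Yo, LinearMap.sub_apply, LinearMap.smul_apply, LinearMap.id_apply, h]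
      abel) hwi (bxF τ J) (bxF_inj τ J)
  obtain ⟨v, hv, hvi⟩ := extract _ hind
    ((fun v : X => (1 : Ω) ⊗ₜ[MvPolynomial σ k] v) '' F (J + Fintype.card τ * J)) (by
      intro p
      exact spmono (Nat.add_le_add_left (bxF_deg τ J p.1) J) (spD _ _ _ (hJ p.2)))
  choose x hxF hxv using hv
  have hxi : LinearIndependent (MvPolynomial σ k) x := by
    rw [Fintype.linearIndependent_iff]
    intro z hz p
    have := Fintype.linearIndependent_iff.1 hvi (fun p => algebraMap _ Ω (z p)) (by
      simp only [← hxv, algebraMap_smul, ← TensorProduct.tmul_smul]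
      rw [← TensorProduct.tmul_sum, hz, TensorProduct.tmul_zero]) p
    exact (FaithfulSMul.algebraMap_injective _ Ω) (by rw [this, map_zero])
  have hki := linearIndependent_smul (MvPolynomial.basisMonomials σ k).linearIndependent hxi
  have hki2 := hki.comp (fun p : (σ → Fin (J + 1)) × ((τ → Fin (J + 1)) × Fin s) =>
    (bxF σ J p.1, p.2)) (by
      intro p q h
      simp only [Prod.mk.injEq] at h
      exact Prod.ext (bxF_inj _ _ h.1) h.2)
  let eq := Fintype.equivFin ((σ → Fin (J + 1)) × ((τ → Fin (J + 1)) × Fin s))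
  have hfin := hF _ (J + n * J) _ (by
    intro i
    have := mono_mem F FX (bxF σ J (eq.symm i).1) _ _ (hxF (eq.symm i).2)
    refine Fmono ?_ (by simpa [MvPolynomial.coe_basisMonomials] using this)
    have := bxF_deg σ J (eq.symm i).1
    rw [hn, add_mul]; omega) (hki2.comp eq.symm eq.symm.injective)
  apply core_arith (J := J)
  refine le_trans (le_of_eq ?_) hfin
  simp only [Fintype.card_prod, Fintype.card_fun, Fintype.card_fin, hn]
  ring

end Core
end LCB

end

noncomputable section
open CategoryTheory Opposite
namespace LCB

section FieldB

lemma field_trans {k S : Type u} [Field k] [CommRing S] [IsDomain S] [Algebra k S] {n : ℕ}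
    (x : Fin n → S) (hx : Algebra.adjoin k (Set.range x) = ⊤) :
    ∃ p : Fin n → Prop, AlgebraicIndependent k (fun i : {i // p i} => x i) ∧
      ∀ s : S, ∃ q : Polynomial (MvPolynomial {i // p i} k), q ≠ 0 ∧
        q.eval₂ (MvPolynomial.aeval (fun i : {i // p i} => x i) : _ →ₐ[k] S).toRingHom s = 0 := by
  haveI : Algebra.IsAlgebraic (Algebra.adjoin k (Set.range x)) S := by
    rw [hx]
    refine ⟨fun a => ?_⟩
    exact isAlgebraic_algebraMap (⟨a, trivial⟩ : (⊤ : Subalgebra k S))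
  obtain ⟨t, ht, hb⟩ := exists_isTranscendenceBasis_subset (R := k) (Set.range x)
  have hsurj : Set.SurjOn x Set.univ t := by
    intro a ha; obtain ⟨i, rfl⟩ := ht ha; exact ⟨i, trivial, rfl⟩
  obtain ⟨B, -, hB⟩ := hsurj.exists_bijOn_subset
  have hb' : IsTranscendenceBasis k (fun i : B => x i) := by
    rw [isTranscendenceBasis_image hB.injOn, hB.image_eq]
    exact hb
  refine ⟨(· ∈ B), hb'.1, fun s => ?_⟩
  obtain ⟨q, hq0, hq⟩ := hb'.isAlgebraic.isAlgebraic s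
  refine ⟨q.map hb'.1.aevalEquiv.symm.toAlgHom.toRingHom, ?_, ?_⟩
  · rw [Ne, Polynomial.map_eq_zero_iff]
    · exact hq0
    · exact hb'.1.aevalEquiv.symm.injective
  · rw [Polynomial.eval₂_map]
    rw [Polynomial.aeval_def] at hq
    convert hq using 1
    congr 1
    ext a
    have := congrArg Subtype.val (hb'.1.aevalEquiv.apply_symm_apply a)
    rw [AlgebraicIndependent.aevalEquiv_apply_coe] at this
    exact this

lemma mapDomain_sub {n : ℕ} {q : Fin n → Prop} (b : {i // q i} →₀ ℕ) (j : {i // q i}) :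
    (b - Finsupp.single j 1).mapDomain Subtype.val =
      b.mapDomain Subtype.val - Finsupp.single j.1 1 := by
  ext i
  by_cases h : q i
  · have e1 := Finsupp.mapDomain_apply Subtype.val_injective (b - Finsupp.single j 1) ⟨i, h⟩
    have e2 := Finsupp.mapDomain_apply Subtype.val_injective b ⟨i, h⟩
    simp only at e1 e2
    rw [Finsupp.tsub_apply, e1, e2, Finsupp.tsub_apply]
    congr 1
    rw [Finsupp.single_apply, Finsupp.single_apply]
    simp [Subtype.ext_iff]
  · rw [Finsupp.tsub_apply, Finsupp.mapDomain_notin_range, Finsupp.mapDomain_notin_range]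
    · simp
    · rintro ⟨a, rfl⟩; exact h a.2
    · rintro ⟨a, rfl⟩; exact h a.2

lemma mapDomain_deg {n : ℕ} {q : Fin n → Prop} (b : {i // q i} →₀ ℕ) :
    (b.mapDomain Subtype.val).degree = b.degree := by
  induction b using Finsupp.induction_linear with
  | zero => simp
  | add f g hf hg => rw [Finsupp.mapDomain_add, map_add, map_add, hf, hg]
  | single i m => simp

lemma field2 {k R X : Type u} [Field k] [CommRing R] [Algebra k R] {n : ℕ} (x : Fin n → R)
    (hx : Algebra.adjoin k (Set.range x) = ⊤) (𝔭 : Ideal R) [𝔭.IsPrime] [AddCommGroup X]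
    [Module k X] [Module R X] [IsScalarTower k R X]
    (p : Fin n → Prop) [Algebra (MvPolynomial {i // p i} k) R]
    [IsScalarTower k (MvPolynomial {i // p i} k) R] [Module (MvPolynomial {i // p i} k) X]
    [IsScalarTower (MvPolynomial {i // p i} k) R X]
    (hZ : ∀ i : {i // p i}, algebraMap (MvPolynomial {i // p i} k) R (MvPolynomial.X i) = x i)
    (hZi : Function.Injective (algebraMap (MvPolynomial {i // p i} k) (R ⧸ 𝔭)))
    (hZa : Algebra.IsAlgebraic (MvPolynomial {i // p i} k) (R ⧸ 𝔭))
    (D : (Fin n →₀ ℕ) → X →+ X) (hD0 : ∀ v, D 0 v = v)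
    (hDk : ∀ b (c : k) v, D b (c • v) = c • D b v)
    (hDX : ∀ b i v, D b (x i • v) = x i • D b v +
      if b i = 0 then 0 else D (b - Finsupp.single i 1) v)
    (F : ℕ → Set X) (Fmono : Monotone F) (Fexh : ∀ v, ∃ j, v ∈ F j)
    (FX : ∀ i j v, v ∈ F j → x i • v ∈ F (j + 1))
    (FD : ∀ b j v, v ∈ F j → D b v ∈ F (j + b.degree)) (C : ℕ)
    (hF : ∀ (N j : ℕ) (v : Fin N → X), (∀ i, v i ∈ F j) → LinearIndependent k v →
      N ≤ C * (j + 1) ^ n)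
    (s : ℕ) (u : Fin s → X) (hu : ∀ i, ∀ r ∈ 𝔭, r • u i = 0)
    (hui : ∀ c : Fin s → R, ∑ i, c i • u i = 0 → ∀ i, c i ∈ 𝔭) :
    s ≤ C * (n + 1) ^ n := by
  classical
  have hcard : Fintype.card {i // p i} + Fintype.card {i // ¬ p i} = n := by
    rw [← Fintype.card_sum, Fintype.card_congr (Equiv.sumCompl p), Fintype.card_fin]
  haveI : IsScalarTower k (MvPolynomial {i // p i} k) X := ⟨fun a z v => by
    rw [← algebraMap_smul R (a • z), ← algebraMap_smul R z v]
    have : algebraMap (MvPolynomial {i // p i} k) R (a • z) = a • algebraMap _ R z := by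
      rw [Algebra.algebraMap_eq_smul_one, Algebra.algebraMap_eq_smul_one z, smul_assoc]
    rw [this, smul_assoc]⟩
  haveI : FaithfulSMul (MvPolynomial {i // p i} k) (FractionRing (R ⧸ 𝔭)) := by
    rw [faithfulSMul_iff_algebraMap_injective,
      IsScalarTower.algebraMap_eq _ (R ⧸ 𝔭) (FractionRing (R ⧸ 𝔭))]
    exact (IsFractionRing.injective (R ⧸ 𝔭) (FractionRing (R ⧸ 𝔭))).comp hZi
  haveI : Algebra.FiniteType k R := ⟨⟨(Set.range x).toFinset, by simpa using hx⟩⟩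
  haveI : Algebra.FiniteType k (R ⧸ 𝔭) := Algebra.FiniteType.of_surjective
    (Ideal.Quotient.mkₐ k 𝔭) (Ideal.Quotient.mkₐ_surjective k 𝔭)
  haveI : IsScalarTower k (MvPolynomial {i // p i} k) (R ⧸ 𝔭) := IsScalarTower.of_algebraMap_eq'
    (by rw [IsScalarTower.algebraMap_eq (MvPolynomial {i // p i} k) R (R ⧸ 𝔭), RingHom.comp_assoc,
          ← IsScalarTower.algebraMap_eq k (MvPolynomial {i // p i} k) R]; rfl)
  haveI : Algebra.FiniteType (MvPolynomial {i // p i} k) (R ⧸ 𝔭) :=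
    Algebra.FiniteType.of_restrictScalars_finiteType k _ _
  let g : Fin s → (R ⧸ 𝔭) →ₗ[MvPolynomial {i // p i} k] X := fun i =>
    (Submodule.liftQ 𝔭 (LinearMap.toSpanSingleton R X (u i)) (fun r hr => by
      simpa using hu i r hr)).restrictScalars _
  have hgmk : ∀ i r, g i (Ideal.Quotient.mk 𝔭 r) = r • u i := fun i r => rfl
  have hZlin : ∀ (b : {i // ¬ p i} →₀ ℕ) (z : MvPolynomial {i // p i} k) (v : X),
      D (b.mapDomain Subtype.val) (z • v) = z • D (b.mapDomain Subtype.val) v := by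
    intro b z
    induction z using MvPolynomial.induction_on with
    | C a =>
      intro v
      have : (MvPolynomial.C a : MvPolynomial {i // p i} k) = a • 1 := by
        rw [MvPolynomial.smul_eq_C_mul, mul_one]
      rw [this, smul_assoc, smul_assoc, one_smul, one_smul, hDk]
    | add z w hz hw => intro v; rw [add_smul, map_add, hz, hw, add_smul]
    | mul_X z i hz =>
      intro v
      rw [mul_smul, hz, mul_smul]
      congr 1
      rw [← algebraMap_smul R (MvPolynomial.X i : MvPolynomial {i // p i} k) v, hZ, hDX, if_pos,
        add_zero, ← hZ i, algebraMap_smul]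
      rw [Finsupp.mapDomain_notin_range]
      rintro ⟨a, ha⟩; exact a.2 (ha ▸ i.2)
  have := core (σ := {i // p i}) (τ := {i // ¬ p i}) (R ⧸ 𝔭) (FractionRing (R ⧸ 𝔭)) X
    (fun j => (LinearMap.lsmul R X (x j)).restrictScalars _)
    (fun j => Ideal.Quotient.mk 𝔭 (x j)) s g
    (by
      intro i j c
      obtain ⟨c, rfl⟩ := Ideal.Quotient.mk_surjective c
      rw [← map_mul, hgmk, hgmk, mul_smul]; rfl)
    (by
      intro c hc
      choose c' hc' using fun i => Ideal.Quotient.mk_surjective (c i)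
      funext i
      rw [← hc', Pi.zero_apply, Ideal.Quotient.eq_zero_iff_mem]
      refine hui c' ?_ i
      rw [← hc]
      exact Finset.sum_congr rfl fun i _ => by rw [← hc', hgmk])
    (fun b => { toFun := D (b.mapDomain Subtype.val)
                map_add' := map_add _
                map_smul' := hZlin b })
    (by intro v; simpa using hD0 v)
    (by
      intro b j v
      have h := hDX (b.mapDomain Subtype.val) j v
      rw [Finsupp.mapDomain_apply Subtype.val_injective, ← mapDomain_sub] at h
      exact h)
    F Fmono Fexh
    (by
      intro i j v hv
      rw [← algebraMap_smul R (MvPolynomial.X i : MvPolynomial {i // p i} k) v, hZ]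
      exact FX _ _ _ hv)
    (by
      intro b j v hv
      have := FD (b.mapDomain Subtype.val) j v hv
      rwa [mapDomain_deg] at this) C
    (by rw [hcard]; exact hF)
  rwa [hcard] at this

lemma field_bound {k R X : Type u} [Field k] [CommRing R] [Algebra k R] {n : ℕ} (x : Fin n → R)
    (hx : Algebra.adjoin k (Set.range x) = ⊤) (𝔭 : Ideal R) [𝔭.IsPrime] [AddCommGroup X]
    [Module k X] [Module R X] [IsScalarTower k R X]
    (D : (Fin n →₀ ℕ) → X →+ X) (hD0 : ∀ v, D 0 v = v)
    (hDk : ∀ b (c : k) v, D b (c • v) = c • D b v)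
    (hDX : ∀ b i v, D b (x i • v) = x i • D b v +
      if b i = 0 then 0 else D (b - Finsupp.single i 1) v)
    (F : ℕ → Set X) (Fmono : Monotone F) (Fexh : ∀ v, ∃ j, v ∈ F j)
    (FX : ∀ i j v, v ∈ F j → x i • v ∈ F (j + 1))
    (FD : ∀ b j v, v ∈ F j → D b v ∈ F (j + b.degree)) (C : ℕ)
    (hF : ∀ (N j : ℕ) (v : Fin N → X), (∀ i, v i ∈ F j) → LinearIndependent k v →
      N ≤ C * (j + 1) ^ n)
    (s : ℕ) (u : Fin s → X) (hu : ∀ i, ∀ r ∈ 𝔭, r • u i = 0)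
    (hui : ∀ c : Fin s → R, ∑ i, c i • u i = 0 → ∀ i, c i ∈ 𝔭) :
    s ≤ C * (n + 1) ^ n := by
  have hx' : Algebra.adjoin k (Set.range (fun i => Ideal.Quotient.mk 𝔭 (x i))) = ⊤ := by
    have := congrArg (Subalgebra.map (Ideal.Quotient.mkₐ k 𝔭)) hx
    rw [AlgHom.map_adjoin, ← Set.range_comp, Algebra.map_top,
      (AlgHom.range_eq_top _).2 (Ideal.Quotient.mkₐ_surjective k 𝔭)] at this
    exact this
  obtain ⟨p, hp1, hp2⟩ := field_trans (k := k) (S := R ⧸ 𝔭) _ hx'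
  letI a1 : Algebra (MvPolynomial {i // p i} k) R :=
    (MvPolynomial.aeval (fun i : {i // p i} => x i) : _ →ₐ[k] R).toRingHom.toAlgebra
  haveI : IsScalarTower k (MvPolynomial {i // p i} k) R := IsScalarTower.of_algebraMap_eq'
    (MvPolynomial.aeval (fun i : {i // p i} => x i) : _ →ₐ[k] R).comp_algebraMap.symm
  letI a2 : Module (MvPolynomial {i // p i} k) X := Module.compHom X
    (algebraMap (MvPolynomial {i // p i} k) R)
  haveI : IsScalarTower (MvPolynomial {i // p i} k) R X :=
    ⟨fun a b c => by rw [Algebra.smul_def, mul_smul]; rfl⟩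
  have heq : algebraMap (MvPolynomial {i // p i} k) (R ⧸ 𝔭) =
      (MvPolynomial.aeval (fun i : {i // p i} => Ideal.Quotient.mk 𝔭 (x i)) :
        _ →ₐ[k] (R ⧸ 𝔭)).toRingHom := by
    refine MvPolynomial.ringHom_ext (fun a => ?_) (fun i => ?_)
    · rw [IsScalarTower.algebraMap_apply (MvPolynomial {i // p i} k) R (R ⧸ 𝔭)]
      change algebraMap R (R ⧸ 𝔭) (MvPolynomial.aeval _ (MvPolynomial.C a)) =
        MvPolynomial.aeval _ (MvPolynomial.C a)
      rw [MvPolynomial.aeval_C, MvPolynomial.aeval_C]; rfl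
    · rw [IsScalarTower.algebraMap_apply (MvPolynomial {i // p i} k) R (R ⧸ 𝔭)]
      change algebraMap R (R ⧸ 𝔭) (MvPolynomial.aeval _ (MvPolynomial.X i)) =
        MvPolynomial.aeval _ (MvPolynomial.X i)
      rw [MvPolynomial.aeval_X, MvPolynomial.aeval_X]; rfl
  refine field2 x hx 𝔭 p (fun i => MvPolynomial.aeval_X _ _) ?_ ?_ D hD0 hDk hDX F Fmono Fexh FX
    FD C hF s u hu hui
  · rw [heq]; exact hp1
  · refine ⟨fun a => ?_⟩
    obtain ⟨q, hq0, hq⟩ := hp2 a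
    exact ⟨q, hq0, by rw [Polynomial.aeval_def, heq]; exact hq⟩

end FieldB
end LCB

end

noncomputable section
open CategoryTheory Opposite
namespace LCB

section Red
variable {A : Type u} [CommRing A] {n : ℕ}
variable {X : Type u} [AddCommGroup X] [Module (MvPolynomial (Fin n) A) X]
  {Y : Type u} [AddCommGroup Y] [Module (MvPolynomial (Fin n) A) Y]

lemma small_bound {S : AddSubgroup X} {N0 : ℕ} (h : Small A n S N0) (𝔪 : Ideal A) [𝔪.IsMaximal]
    (N : ℕ) (v : Fin N → X) (hv : ∀ i, v i ∈ S)
    (hk : ∀ i, ∀ a ∈ 𝔪, (MvPolynomial.C a : MvPolynomial (Fin n) A) • v i = 0)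
    (hi : ∀ c : Fin N → A, ∑ i, (MvPolynomial.C (c i) : MvPolynomial (Fin n) A) • v i = 0 →
      ∀ i, c i ∈ 𝔪) : N ≤ N0 := by
  obtain ⟨V, _, _, φ, hφ, hl⟩ := h
  choose y hy using fun i => hφ (v i) (hv i)
  let ψ : (Fin N → A ⧸ 𝔪) →ₗ[A] (V ⧸ LinearMap.ker φ) := ∑ i,
    (Submodule.liftQ 𝔪 (LinearMap.toSpanSingleton A (V ⧸ LinearMap.ker φ)
      ((LinearMap.ker φ).mkQ (y i))) (fun a ha => by
        rw [LinearMap.mem_ker, LinearMap.toSpanSingleton_apply, ← map_smul]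
        rw [Submodule.mkQ_apply, Submodule.Quotient.mk_eq_zero, LinearMap.mem_ker, map_smulₛₗ, hy]
        exact hk i a ha)) ∘ₗ LinearMap.proj i
  have hψ : ∀ c : Fin N → A, ψ (fun i => Ideal.Quotient.mk 𝔪 (c i)) =
      (LinearMap.ker φ).mkQ (∑ i, c i • y i) := by
    intro c
    rw [map_sum]
    simp only [ψ, LinearMap.sum_apply, LinearMap.comp_apply, LinearMap.proj_apply]
    exact Finset.sum_congr rfl fun i _ => rfl
  have hinj : Function.Injective ψ := by
    rw [← LinearMap.ker_eq_bot, LinearMap.ker_eq_bot']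
    intro c hc
    choose c' hc' using fun i => Ideal.Quotient.mk_surjective (c i)
    have : c = fun i => Ideal.Quotient.mk 𝔪 (c' i) := by funext i; exact (hc' i).symm
    rw [this, hψ, Submodule.mkQ_apply, Submodule.Quotient.mk_eq_zero, LinearMap.mem_ker,
      map_sum] at hc
    simp only [map_smulₛₗ, hy] at hc
    funext i
    rw [← hc', Pi.zero_apply, Ideal.Quotient.eq_zero_iff_mem]
    exact hi c' hc i
  have h1 := Module.length_le_of_injective ψ hinj
  have h2 := Module.length_le_of_surjective _ (Submodule.mkQ_surjective (LinearMap.ker φ))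
  haveI : IsSimpleModule A (A ⧸ 𝔪) := isSimpleModule_iff_quot_maximal.2 ⟨𝔪, inferInstance, ⟨.refl _ _⟩⟩
  have h3 : Module.length A (Fin N → A ⧸ 𝔪) = N := by
    rw [Module.length_pi, Module.length_eq_one]
    simp
  rw [h3] at h1
  exact_mod_cast h1.trans (h2.trans hl)

lemma HolF.sub {d : TD A n X} {C F} (h : HolF d C F) {d' : TD A n Y}
    {g : Y →ₗ[MvPolynomial (Fin n) A] X} (hg : Eqv d' d g) (hs : Function.Injective g) :
    HolF d' C (fun j => (F j).comap g.toAddMonoidHom) where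
  mono _ _ hij := AddSubgroup.comap_mono (h.mono hij)
  exh v := h.exh (g v)
  smulC a j v hv := by
    have := h.smulC a j (g v) hv
    rw [← map_smul] at this
    exact this
  smulX a j v hv := by
    have := h.smulX a j (g v) hv
    rw [← map_smul] at this
    exact this
  D_mem b j v hv := by
    have := h.D_mem b j (g v) hv
    rw [← hg] at this
    exact this
  small j := by
    obtain ⟨V, _, _, φ, hφ, hl⟩ := h.small j
    let V' : Submodule A V := (LinearMap.range g).comap φ
    refine ⟨V', inferInstance, inferInstance,
      { toFun := fun x => x.2.choose
        map_add' := fun x y => hs ?_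
        map_smul' := fun a x => hs ?_ }, ?_, ?_⟩
    · rw [map_add, (x + y).2.choose_spec, x.2.choose_spec, y.2.choose_spec]
      exact map_add φ _ _
    · rw [map_smul, (a • x).2.choose_spec, x.2.choose_spec]
      exact map_smulₛₗ φ _ _
    · intro v hv
      obtain ⟨x, hx⟩ := hφ (g v) hv
      refine ⟨⟨x, v, hx.symm⟩, hs ?_⟩
      exact (Exists.choose_spec (p := fun w => g w = φ x) _).trans hx
    · exact (Module.length_le_of_injective V'.subtype V'.injective_subtype).trans hl

lemma prime_bound {d : TD A n X} {C F} (h : HolF d C F) (P : Ideal (MvPolynomial (Fin n) A))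
    [P.IsPrime] (hm : (P.comap (MvPolynomial.C : A →+* MvPolynomial (Fin n) A)).IsMaximal)
    (s : ℕ) (u : Fin s → X)
    (hu : ∀ i, ∀ r ∈ P, r • u i = 0)
    (hui : ∀ c : Fin s → MvPolynomial (Fin n) A, ∑ i, c i • u i = 0 → ∀ i, c i ∈ P) :
    s ≤ C * (n + 1) ^ n := by
  set 𝔪 := P.comap (MvPolynomial.C : A →+* MvPolynomial (Fin n) A) with h𝔪
  let J : Ideal (MvPolynomial (Fin n) A) := 𝔪.map MvPolynomial.C
  have hJ : J ≤ P := Ideal.map_le_iff_le_comap.2 le_rfl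
  letI : Field (A ⧸ 𝔪) := Ideal.Quotient.field 𝔪
  letI : Algebra (A ⧸ 𝔪) (MvPolynomial (Fin n) A ⧸ J) :=
    (Ideal.quotientMap J (MvPolynomial.C : A →+* MvPolynomial (Fin n) A)
      Ideal.le_comap_map).toAlgebra
  have halg : ∀ a : A, algebraMap (A ⧸ 𝔪) (MvPolynomial (Fin n) A ⧸ J) (Ideal.Quotient.mk 𝔪 a) =
      Ideal.Quotient.mk J (MvPolynomial.C a) := fun a => Ideal.quotientMap_mk
  let X' : Submodule (MvPolynomial (Fin n) A) X := Submodule.torsionBySet _ X (J : Set _)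
  have hX' : ∀ v : X, v ∈ X' ↔ ∀ a ∈ 𝔪, (MvPolynomial.C a : MvPolynomial (Fin n) A) • v = 0 := by
    intro v
    constructor
    · intro hv a ha
      exact (Submodule.mem_torsionBySet_iff _ _).1 hv ⟨_, Ideal.mem_map_of_mem _ ha⟩
    · intro hv
      rw [Submodule.mem_torsionBySet_iff]
      rintro ⟨r, hr⟩
      have : J ≤ LinearMap.ker (LinearMap.toSpanSingleton (MvPolynomial (Fin n) A) X v) := by
        refine Ideal.map_le_iff_le_comap.2 fun a ha => ?_
        exact hv a ha
      exact this hr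
  have hst : d.St X' := by
    intro b v hv
    rw [hX'] at hv ⊢
    intro a ha
    rw [← d.D_C, hv a ha, map_zero]
  let d' := d.sub X' hst
  have h' := h.sub (d.sub_eqv X' hst) X'.injective_subtype
  have htor : Module.IsTorsionBySet (MvPolynomial (Fin n) A) X' (J : Set _) :=
    Submodule.torsionBySet_isTorsionBySet _
  letI : Module (MvPolynomial (Fin n) A ⧸ J) X' := htor.module
  have hmk : ∀ (r : MvPolynomial (Fin n) A) (v : X'), Ideal.Quotient.mk J r • v = r • v :=
    fun r v => rfl
  letI : Module (A ⧸ 𝔪) X' := Module.compHom X' (algebraMap (A ⧸ 𝔪) (MvPolynomial (Fin n) A ⧸ J))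
  have hmk2 : ∀ (a : A) (v : X'), Ideal.Quotient.mk 𝔪 a • v =
    (MvPolynomial.C a : MvPolynomial (Fin n) A) • v := fun a v => rfl
  haveI : IsScalarTower (A ⧸ 𝔪) (MvPolynomial (Fin n) A ⧸ J) X' :=
    ⟨fun a b c => by rw [Algebra.smul_def, mul_smul]; rfl⟩
  haveI : (P.map (Ideal.Quotient.mk J)).IsPrime :=
    Ideal.map_isPrime_of_surjective Ideal.Quotient.mk_surjective (by rw [Ideal.mk_ker]; exact hJ)
  have huX : ∀ i, u i ∈ X' := fun i => (hX' _).2 fun a ha => hu i _ ha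
  refine field_bound (k := A ⧸ 𝔪) (R := MvPolynomial (Fin n) A ⧸ J) (X := X')
    (fun i => Ideal.Quotient.mk J (MvPolynomial.X i)) ?_ (P.map (Ideal.Quotient.mk J)) d'.D
    d'.D_zero ?_ ?_ (fun j => ((F j).comap X'.subtype.toAddMonoidHom : Set X')) ?_ h'.exh
    ?_ h'.D_mem C ?_ s (fun i => ⟨u i, huX i⟩) ?_ ?_
  · rw [eq_top_iff]
    rintro r -
    obtain ⟨r, rfl⟩ := Ideal.Quotient.mk_surjective r
    induction r using MvPolynomial.induction_on with
    | C a => rw [← halg]; exact Subalgebra.algebraMap_mem _ _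
    | add p q hp hq => rw [map_add]; exact add_mem hp hq
    | mul_X p i hp => rw [map_mul]; exact mul_mem hp (Algebra.subset_adjoin ⟨i, rfl⟩)
  · intro b c v
    obtain ⟨c, rfl⟩ := Ideal.Quotient.mk_surjective c
    rw [hmk2, hmk2]; exact d'.D_C b c v
  · intro b i v
    rw [hmk, hmk]; exact d'.D_X b i v
  · intro i j hij; exact h'.mono hij
  · intro i j v hv; exact h'.smulX i j v hv
  · intro N j v hv hli
    refine small_bound (h'.small j) 𝔪 N v hv ?_ ?_
    · intro i a ha
      rw [← hmk2, Ideal.Quotient.eq_zero_iff_mem.2 ha, zero_smul]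
    · intro c hc i
      rw [← Ideal.Quotient.eq_zero_iff_mem]
      exact Fintype.linearIndependent_iff.1 hli (fun i => Ideal.Quotient.mk 𝔪 (c i)) hc i
  · intro i r hr
    obtain ⟨r, rfl⟩ := Ideal.Quotient.mk_surjective r
    rw [Ideal.mem_quotient_iff_mem hJ] at hr
    exact Subtype.ext (hu i r hr)
  · intro c hc i
    choose c' hc' using fun i => Ideal.Quotient.mk_surjective (c i)
    rw [← hc', Ideal.mem_quotient_iff_mem hJ]
    refine hui c' ?_ i
    have := congrArg X'.subtype hc
    rw [map_sum, map_zero] at this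
    rw [← this]
    refine Finset.sum_congr rfl fun i _ => ?_
    rw [← hc' i, hmk]; rfl

end Red
end LCB

end

noncomputable section
open CategoryTheory Opposite
namespace LCB

section Soc
variable (L : Type u) [CommRing L] [IsLocalRing L]

abbrev soc (M : Type u) [AddCommGroup M] [Module L M] : Submodule L M :=
  Submodule.torsionBySet L M (IsLocalRing.maximalIdeal L : Set L)

variable {L}
lemma mem_soc {M : Type u} [AddCommGroup M] [Module L M] (x : M) :
    x ∈ soc L M ↔ ∀ a ∈ IsLocalRing.maximalIdeal L, a • x = 0 := by
  rw [Submodule.mem_torsionBySet_iff]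
  exact ⟨fun h a ha => h ⟨a, ha⟩, fun h a => h a a.2⟩

lemma soc_mid [IsNoetherianRing L] {M N Q : Type u} [AddCommGroup M] [Module L M]
    [AddCommGroup N] [Module L N] [AddCommGroup Q] [Module L Q] (f : M →ₗ[L] N) (g : N →ₗ[L] Q)
    (hf : Function.Injective f) (hex : Function.Exact f g)
    (hM : Module.Finite L (soc L M)) (hQ : Module.Finite L (soc L Q)) :
    Module.Finite L (soc L N) := by
  haveI : IsNoetherian L (soc L M) := isNoetherian_of_isNoetherianRing_of_finite _ _
  haveI : IsNoetherian L (soc L Q) := isNoetherian_of_isNoetherianRing_of_finite _ _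
  let f' : soc L M →ₗ[L] soc L N := f.restrict (fun x hx => by
    rw [mem_soc] at *
    intro a ha; rw [← map_smul, hx a ha, map_zero])
  let g' : soc L N →ₗ[L] soc L Q := g.restrict (fun x hx => by
    rw [mem_soc] at *
    intro a ha; rw [← map_smul, hx a ha, map_zero])
  haveI : IsNoetherian L (soc L N) := by
    refine isNoetherian_of_range_eq_ker f' g' ?_
    ext ⟨x, hx⟩
    constructor
    · rintro ⟨y, hy⟩
      rw [← hy, LinearMap.mem_ker]
      exact Subtype.ext (hex.apply_apply_eq_zero _)
    · intro h
      have h' : g x = 0 := congrArg Subtype.val h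
      obtain ⟨y, rfl⟩ := (hex x).1 h'
      refine ⟨⟨y, ?_⟩, rfl⟩
      rw [mem_soc] at *
      intro a ha
      apply hf
      rw [map_smul, hx a ha, map_zero]
  infer_instance

end Soc

section SocLoc
variable {R : Type u} [CommRing R] (P : Ideal R) [P.IsPrime]

abbrev LP : Type u := Localization.AtPrime P
abbrev MP (M : Type u) [AddCommGroup M] [Module R M] : Type u := LocalizedModule P.primeCompl M
variable {M N Q : Type u} [AddCommGroup M] [Module R M] [AddCommGroup N] [Module R N]
   [AddCommGroup Q] [Module R Q]

abbrev mp (f : M →ₗ[R] N) : MP P M →ₗ[LP P] MP P N := LocalizedModule.map P.primeCompl f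
abbrev im (M : Type u) [AddCommGroup M] [Module R M] : M →ₗ[R] MP P M :=
  LocalizedModule.mkLinearMap P.primeCompl M

lemma mp_im (f : M →ₗ[R] N) (x : M) : mp P f (im P M x) = im P N (f x) := by
  simp [LocalizedModule.mkLinearMap_apply]

lemma mp_ses {f : M →ₗ[R] N} {g : N →ₗ[R] Q} (h : SES f g) : SES (mp P f) (mp P g) :=
  ⟨LocalizedModule.map_injective _ _ h.inj, LocalizedModule.map_surjective _ _ h.surj,
    LocalizedModule.map_exact _ _ _ h.ex⟩

def FS (M : Type u) [AddCommGroup M] [Module R M] : Prop := Module.Finite (LP P) (soc (LP P) (MP P M))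

lemma im_surj (x : MP P M) : ∃ t : R, t ∉ P ∧ ∃ u : M, im P M u = t • x := by
  obtain ⟨⟨u, t⟩, h⟩ := IsLocalizedModule.surj P.primeCompl (im P M) x
  exact ⟨t, t.2, u, h.symm⟩

lemma im_zero {x : M} (h : im P M x = 0) : ∃ t : R, t ∉ P ∧ t • x = 0 := by
  obtain ⟨t, ht⟩ := (IsLocalizedModule.eq_zero_iff P.primeCompl (im P M)).1 h
  exact ⟨t, t.2, ht⟩

lemma kill [IsNoetherianRing R] (x : MP P M) (hx : x ∈ soc (LP P) (MP P M)) :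
    ∃ t : R, t ∉ P ∧ ∃ u : M, im P M u = t • x ∧ ∀ p ∈ P, p • u = 0 := by
  classical
  obtain ⟨t, ht, u, hu⟩ := im_surj P x
  obtain ⟨s, hs⟩ := (isNoetherianRing_iff_ideal_fg R).1 inferInstance P
  have h1 : ∀ p ∈ P, ∃ t : R, t ∉ P ∧ t • (p • u) = 0 := by
    intro p hp
    apply im_zero P
    rw [map_smul, hu, smul_comm]
    have : algebraMap R (LP P) p • x = 0 :=
      (mem_soc x).1 hx _ ((IsLocalization.AtPrime.to_map_mem_maximal_iff _ P p).2 hp)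
    rw [algebraMap_smul] at this
    rw [this, smul_zero]
  have hsP : ∀ p ∈ s, p ∈ P := fun p hp => hs ▸ Ideal.subset_span hp
  choose! q hq1 hq2 using h1
  have hr : ∏ p ∈ s, q p ∉ P := fun h => by
    rw [Ideal.IsPrime.prod_mem_iff] at h
    obtain ⟨p, hp, h⟩ := h
    exact hq1 p (hsP p hp) h
  refine ⟨(∏ p ∈ s, q p) * t, fun h => (Ideal.IsPrime.mem_or_mem ‹_› h).elim hr ht,
    (∏ p ∈ s, q p) • u, by rw [map_smul, hu, mul_smul], ?_⟩
  have : P ≤ LinearMap.ker (LinearMap.toSpanSingleton R M ((∏ p ∈ s, q p) • u)) := by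
    rw [← hs, Ideal.span_le]
    intro p hp
    change p • ((∏ p ∈ s, q p) • u) = 0
    rw [smul_comm, ← Finset.mul_prod_erase s q hp, mul_comm, mul_smul, hq2 p (hsP p hp), smul_zero]
  exact fun p hp => this hp

lemma FS_of_bound [IsNoetherianRing R] (B : ℕ)
    (hB : ∀ (s : ℕ) (u : Fin s → M), (∀ i, ∀ r ∈ P, r • u i = 0) →
      (∀ c : Fin s → R, ∑ i, c i • u i = 0 → ∀ i, c i ∈ P) → s ≤ B) : FS P M := by
  classical
  have htor : Module.IsTorsionBySet (LP P) (soc (LP P) (MP P M))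
    (IsLocalRing.maximalIdeal (LP P) : Set (LP P)) := Submodule.torsionBySet_isTorsionBySet _
  letI : Module (LP P ⧸ IsLocalRing.maximalIdeal (LP P)) (soc (LP P) (MP P M)) := htor.module
  haveI : IsScalarTower (LP P) (LP P ⧸ IsLocalRing.maximalIdeal (LP P)) (soc (LP P) (MP P M)) :=
    htor.isScalarTower
  letI : Field (LP P ⧸ IsLocalRing.maximalIdeal (LP P)) := Ideal.Quotient.field _
  have hrank : Module.rank (LP P ⧸ IsLocalRing.maximalIdeal (LP P)) (soc (LP P) (MP P M)) ≤ B := by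
    apply rank_le
    intro s hs
    let e := s.equivFin
    have hs' := hs.comp e.symm e.symm.injective
    choose t ht u hu hu2 using fun i : Fin s.card => kill P _ (e.symm i).1.2
    refine hB s.card u hu2 ?_
    intro c hc i
    have h1 := Fintype.linearIndependent_iff.1 hs'
      (fun i => Ideal.Quotient.mk _ (algebraMap R (LP P) (c i * t i))) (by
        apply Subtype.ext
        rw [AddSubmonoidClass.coe_finset_sum]
        have h2 := congrArg (im P M) hc
        rw [map_sum, map_zero] at h2
        refine Eq.trans ?_ h2
        refine Finset.sum_congr rfl fun i _ => ?_
        rw [map_smul, hu, ← mul_smul]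
        exact algebraMap_smul (LP P) (c i * t i) ((e.symm i).1 : MP P M)) i
    rw [Ideal.Quotient.eq_zero_iff_mem, IsLocalization.AtPrime.to_map_mem_maximal_iff _ P] at h1
    exact (Ideal.IsPrime.mem_or_mem ‹_› h1).resolve_right (ht i)
  haveI : Module.Finite (LP P ⧸ IsLocalRing.maximalIdeal (LP P)) (soc (LP P) (MP P M)) := by
    rw [← Module.rank_lt_aleph0_iff]
    exact hrank.trans_lt (Cardinal.natCast_lt_aleph0)
  exact Module.Finite.trans (LP P ⧸ IsLocalRing.maximalIdeal (LP P)) _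

lemma FS_mid [IsNoetherianRing R] {f : M →ₗ[R] N} {g : N →ₗ[R] Q} (h : SES f g) (h1 : FS P M) (h2 : FS P Q) :
    FS P N :=
  soc_mid (mp P f) (mp P g) (mp_ses P h).inj (mp_ses P h).ex h1 h2

end SocLoc

section SocExt
variable {A : Type u} [CommRing A] [IsNoetherianRing A] {n : ℕ}

/-- Socle finiteness for all subquotients. -/
def TT (P : Ideal (MvPolynomial (Fin n) A)) [P.IsPrime]
    {X : Type u} [AddCommGroup X] [Module (MvPolynomial (Fin n) A) X] (d : TD A n X) : Prop :=
  ∀ (W Y : Type u) [AddCommGroup W] [Module (MvPolynomial (Fin n) A) W] [AddCommGroup Y]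
    [Module (MvPolynomial (Fin n) A) Y] (dW : TD A n W) (dY : TD A n Y)
    (i : W →ₗ[MvPolynomial (Fin n) A] X) (q : W →ₗ[MvPolynomial (Fin n) A] Y)
    (_ : Eqv dW d i) (_ : Eqv dW dY q) (_ : Function.Injective i) (_ : Function.Surjective q),
    FS P Y

lemma eqv_comp {X Y Z : Type u} [AddCommGroup X] [Module (MvPolynomial (Fin n) A) X]
    [AddCommGroup Y] [Module (MvPolynomial (Fin n) A) Y]
    [AddCommGroup Z] [Module (MvPolynomial (Fin n) A) Z] {d : TD A n X} {d' : TD A n Y}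
    {d'' : TD A n Z} {f : X →ₗ[MvPolynomial (Fin n) A] Y} {g : Y →ₗ[MvPolynomial (Fin n) A] Z}
    (hf : Eqv d d' f) (hg : Eqv d' d'' g) : Eqv d d'' (g ∘ₗ f) := fun b v => by
  rw [LinearMap.comp_apply, hf, hg]; rfl

lemma map_st {X Y : Type u} [AddCommGroup X] [Module (MvPolynomial (Fin n) A) X]
    [AddCommGroup Y] [Module (MvPolynomial (Fin n) A) Y] {d : TD A n X} {d' : TD A n Y}
    {f : X →ₗ[MvPolynomial (Fin n) A] Y} (hf : Eqv d d' f) {U} (hU : d.St U) : d'.St (U.map f) := by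
  rintro b _ ⟨v, hv, rfl⟩
  exact ⟨d.D b v, hU b v hv, hf b v⟩

lemma comap_st {X Y : Type u} [AddCommGroup X] [Module (MvPolynomial (Fin n) A) X]
    [AddCommGroup Y] [Module (MvPolynomial (Fin n) A) Y] {d : TD A n X} {d' : TD A n Y}
    {f : X →ₗ[MvPolynomial (Fin n) A] Y} (hf : Eqv d d' f) {U} (hU : d'.St U) :
    d.St (U.comap f) := fun b v hv => by
  rw [Submodule.mem_comap] at *
  rw [hf]; exact hU b _ hv

lemma ExtHol.tt (P : Ideal (MvPolynomial (Fin n) A)) [P.IsPrime]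
    (hm : (P.comap (MvPolynomial.C : A →+* MvPolynomial (Fin n) A)).IsMaximal)
    {X : Type u} [AddCommGroup X] [Module (MvPolynomial (Fin n) A) X] {d : TD A n X}
    (h : ExtHol d) : TT P d := by
  induction h with
  | hol d C F h =>
    intro W Y _ _ _ _ dW dY i q hi hq hii hqs
    exact FS_of_bound P _ (prime_bound ((h.sub hi hii).quot hq hqs) P hm)
  | @mid N X Z _ _ _ _ _ _ dN d dZ f g hf hg hex hN hZ ihN ihZ =>
    intro W Y _ _ _ _ dW dY i q hi hq hii hqs
    let K := LinearMap.ker (g ∘ₗ i)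
    have hK : dW.St K := ker_st (eqv_comp hi hg)
    let U := K.map q
    have hU : dY.St U := map_st hq hK
    have hU1 : FS P U := by
      -- subquotient of N
      let N' := (LinearMap.range i).comap f
      have hN' : dN.St N' := comap_st hf (range_st hi)
      have hc : ∀ x : N', ∃ w : W, i w = f x := fun x => x.2
      choose c hc using hc
      have hcK : ∀ x, c x ∈ K := fun x => by
        rw [LinearMap.mem_ker, LinearMap.comp_apply, hc]
        exact hex.apply_apply_eq_zero _
      let r : N' →ₗ[MvPolynomial (Fin n) A] U :=
        { toFun := fun x => ⟨q (c x), ⟨c x, hcK x, rfl⟩⟩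
          map_add' := fun x y => by
            have : c (x + y) = c x + c y := hii (by
              rw [map_add, hc, hc, hc]; exact map_add f _ _)
            apply Subtype.ext
            simp [this]
          map_smul' := fun a x => by
            have : c (a • x) = a • c x := hii (by
              rw [map_smul, hc, hc]; exact map_smul f _ _)
            apply Subtype.ext
            simp [this] }
      refine ihN N' U (dN.sub N' hN') (dY.sub U hU) N'.subtype r (dN.sub_eqv _ _) ?_
        N'.injective_subtype ?_
      · intro b v
        apply Subtype.ext
        change q (c ((dN.sub N' hN').D b v)) = dY.D b (q (c v))
        rw [← hq]
        congr 1
        apply hii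
        rw [hc, hi, hc]
        exact hf b v
      · rintro ⟨_, w, hw, rfl⟩
        have hw' : g (i w) = 0 := hw
        obtain ⟨x, hx⟩ := (hex _).1 hw'
        refine ⟨⟨x, w, hx.symm⟩, Subtype.ext ?_⟩
        change q (c _) = q w
        congr 1
        apply hii
        exact (hc _).trans hx
    have hU2 : FS P (Y ⧸ U) := by
      refine ihZ (W ⧸ K) (Y ⧸ U) (dW.quot K hK) (dY.quot U hU) (K.liftQ (g ∘ₗ i) le_rfl)
        (K.mapQ U q (Submodule.le_comap_map _ _)) ?_ ?_ ?_ ?_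
      · intro b v
        obtain ⟨v, rfl⟩ := K.mkQ_surjective v
        exact eqv_comp hi hg b v
      · intro b v
        obtain ⟨v, rfl⟩ := K.mkQ_surjective v
        exact congrArg U.mkQ (hq b v)
      · rw [← LinearMap.ker_eq_bot, Submodule.ker_liftQ_eq_bot']
        rfl
      · intro y
        obtain ⟨y, rfl⟩ := U.mkQ_surjective y
        obtain ⟨w, rfl⟩ := hqs y
        exact ⟨K.mkQ w, rfl⟩
    exact FS_mid P (f := U.subtype) (g := U.mkQ)
      ⟨U.injective_subtype, U.mkQ_surjective, LinearMap.exact_subtype_mkQ U⟩ hU1 hU2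

lemma ExtHol.fs (P : Ideal (MvPolynomial (Fin n) A)) [P.IsPrime]
    (hm : (P.comap (MvPolynomial.C : A →+* MvPolynomial (Fin n) A)).IsMaximal)
    {X : Type u} [AddCommGroup X] [Module (MvPolynomial (Fin n) A) X] {d : TD A n X}
    (h : ExtHol d) : FS P X :=
  h.tt P hm X X d d LinearMap.id LinearMap.id (fun _ _ => rfl) (fun _ _ => rfl)
    Function.injective_id Function.surjective_id

end SocExt
end LCB

end

noncomputable section
open CategoryTheory Opposite
namespace LCB

section Melk
variable {L : Type u} [CommRing L]

/-- the auxiliary submodules in Melkersson's criterion -/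
def Vt {M : Type u} [AddCommGroup M] [Module L M] (x : L) (N : Submodule L M) (t : ℕ) :
    Submodule L M := (N ⊓ Submodule.torsionBy L M (x ^ (t+1))).map (x ^ t • LinearMap.id)

variable {M : Type u} [AddCommGroup M] [Module L M]

lemma mem_Vt (x : L) (N : Submodule L M) (t : ℕ) (v : M) :
    v ∈ Vt x N t ↔ ∃ y ∈ N, x ^ (t+1) • y = 0 ∧ x ^ t • y = v := by
  constructor
  · rintro ⟨y, ⟨h1, h2⟩, h3⟩
    exact ⟨y, h1, (Submodule.mem_torsionBy_iff _ _).1 h2, h3⟩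
  · rintro ⟨y, h1, h2, h3⟩
    exact ⟨y, ⟨h1, (Submodule.mem_torsionBy_iff _ _).2 h2⟩, h3⟩

lemma Vt_le (x : L) (N : Submodule L M) (t : ℕ) : Vt x N t ≤ Submodule.torsionBy L M x := by
  intro v hv
  obtain ⟨y, h1, h2, rfl⟩ := (mem_Vt _ _ _ _).1 hv
  rw [Submodule.mem_torsionBy_iff, ← mul_smul, ← pow_succ', h2]

lemma Vt_mono (x : L) {N N' : Submodule L M} (h : N ≤ N') {t t' : ℕ} (ht : t' ≤ t) :
    Vt x N t ≤ Vt x N' t' := by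
  intro v hv
  obtain ⟨y, h1, h2, rfl⟩ := (mem_Vt _ _ _ _).1 hv
  obtain ⟨k, rfl⟩ := Nat.exists_eq_add_of_le ht
  refine (mem_Vt _ _ _ _).2 ⟨x ^ k • y, h (N.smul_mem _ h1), ?_, ?_⟩
  · rw [← mul_smul, ← pow_add, show t' + 1 + k = t' + k + 1 by ring, h2]
  · rw [← mul_smul, ← pow_add]

lemma le_of_Vt (x : L) (htor : ∀ v : M, ∃ k : ℕ, x ^ k • v = 0) {N N' : Submodule L M}
    (h : N ≤ N') (hV : ∀ t, Vt x N' t ≤ Vt x N t) : N' ≤ N := by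
  have key : ∀ k : ℕ, ∀ v ∈ N', x ^ k • v = 0 → v ∈ N := by
    intro k
    induction k with
    | zero =>
      intro v _ hv
      rw [pow_zero, one_smul] at hv
      rw [hv]; exact N.zero_mem
    | succ k ih =>
      intro v hv h0
      obtain ⟨z, hz, _, h2⟩ := (mem_Vt _ _ _ _).1 (hV k ((mem_Vt _ _ _ _).2 ⟨v, hv, h0, rfl⟩))
      have := ih (v - z) (N'.sub_mem hv (h hz)) (by rw [smul_sub, h2, sub_self])
      simpa using N.add_mem this hz
  intro v hv
  obtain ⟨k, hk⟩ := htor v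
  exact key k v hv hk

lemma melk1 (x : L) (htor : ∀ v : M, ∃ k : ℕ, x ^ k • v = 0)
    (hA : IsArtinian L (Submodule.torsionBy L M x)) : IsArtinian L M := by
  rw [← monotone_stabilizes_iff_artinian]
  intro N
  have stab : ∀ f : ℕ → Submodule L M, (∀ a b, a ≤ b → f b ≤ f a) →
      (∀ a, f a ≤ Submodule.torsionBy L M x) → ∃ m, ∀ k, m ≤ k → f m = f k := by
    intro f hf1 hf2
    obtain ⟨m, hm⟩ := IsArtinian.monotone_stabilizes (R := L) (M := Submodule.torsionBy L M x)
      ⟨fun a => OrderDual.toDual ((f a).comap (Submodule.subtype _)),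
        fun a b hab => Submodule.comap_mono (hf1 a b hab)⟩
    refine ⟨m, fun k hk => ?_⟩
    have h1 : (f m).comap (Submodule.torsionBy L M x).subtype =
      (f k).comap (Submodule.torsionBy L M x).subtype := hm k hk
    apply le_antisymm _ (hf1 m k hk)
    intro v hv
    have : (⟨v, hf2 m hv⟩ : Submodule.torsionBy L M x) ∈
      (f m).comap (Submodule.torsionBy L M x).subtype := hv
    rw [h1] at this
    exact this
  let N' : ℕ → Submodule L M := fun a => OrderDual.ofDual (N a)
  have hN : ∀ a b, a ≤ b → N' b ≤ N' a := fun a b hab => N.2 hab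
  obtain ⟨a0, ha0⟩ := stab (fun a => Vt x (N' a) a) (fun a b hab => Vt_mono x (hN a b hab) hab)
    (fun a => Vt_le _ _ _)
  choose m hm using fun t => stab (fun a => Vt x (N' a) t)
    (fun a b hab => Vt_mono x (hN a b hab) le_rfl) (fun a => Vt_le _ _ _)
  let a1 := a0 + ∑ t ∈ Finset.range a0, m t
  refine ⟨a1, fun a ha => ?_⟩
  apply le_antisymm (N.2 ha)
  change N' a1 ≤ N' a
  apply le_of_Vt x htor (hN _ _ ha)
  intro t
  by_cases ht : t < a0
  · have h1 : m t ≤ a1 := (Finset.single_le_sum (f := m) (fun _ _ => Nat.zero_le _)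
      (Finset.mem_range.2 ht)).trans (Nat.le_add_left _ _)
    have h2 := (hm t a1 h1).symm.trans (hm t a (h1.trans ha))
    exact h2.le
  · have h1 : Vt x (N' a1) t ≤ Vt x (N' a0) a0 :=
      Vt_mono x (hN _ _ (Nat.le_add_right _ _)) (not_lt.1 ht)
    refine h1.trans ?_
    have h2 := ha0 (a + t) (by omega)
    exact h2.le.trans (Vt_mono x (hN _ _ (by omega)) (by omega))

lemma melk (s : Finset L) : ∀ (M : Type u) [AddCommGroup M] [Module L M],
    (∀ x ∈ s, ∀ v : M, ∃ k : ℕ, x ^ k • v = 0) →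
    IsArtinian L (Submodule.torsionBySet L M (s : Set L)) → IsArtinian L M := by
  classical
  induction s using Finset.induction_on with
  | empty =>
    intro M _ _ _ h
    refine isArtinian_of_injective (M := M) (P := Submodule.torsionBySet L M ((∅ : Finset L) : Set L))
      (LinearMap.id.codRestrict _ fun v => ?_) fun a b hab => congrArg Subtype.val hab
    rw [Submodule.mem_torsionBySet_iff]
    rintro ⟨a, ha⟩
    simp at ha
  | insert a s ha ih =>
    intro M _ _ htor h
    apply melk1 a (htor a (Finset.mem_insert_self _ _))
    apply ih
    · rintro x hx ⟨v, hv⟩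
      obtain ⟨k, hk⟩ := htor x (Finset.mem_insert_of_mem hx) v
      exact ⟨k, Subtype.ext hk⟩
    · refine isArtinian_of_injective (P := Submodule.torsionBySet L M ((insert a s : Finset L) : Set L))
        (((Submodule.torsionBy L M a).subtype ∘ₗ Submodule.subtype _).codRestrict _ fun v => ?_)
        fun p q hab => Subtype.ext (Subtype.ext (by
          have := congrArg (Submodule.subtype (Submodule.torsionBySet L M ((insert a s : Finset L) : Set L))) hab
          exact this))
      rw [Submodule.mem_torsionBySet_iff]
      rintro ⟨b, hb⟩
      rw [Finset.mem_coe, Finset.mem_insert] at hb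
      rcases hb with rfl | hb
      · exact (Submodule.mem_torsionBy_iff _ _).1 v.1.2
      · have := (Submodule.mem_torsionBySet_iff _ _).1 v.2 ⟨b, hb⟩
        exact congrArg Subtype.val this

lemma ext_artinian [IsNoetherianRing L] (hA : IsArtinian L M) (j : ℕ) :
    ∀ (N : Type u) [AddCommGroup N] [Module L N] [Module.Finite L N], IsArtinian L (E L N M j) := by
  induction j with
  | zero =>
    intro N _ _ _
    obtain ⟨a, f, hf⟩ := Module.Finite.exists_fin' L N
    let e : E L N M 0 ≃ₗ[L] (N →ₗ[L] M) :=
      (Abelian.Ext.linearEquiv₀ (R := L)).trans (ModuleCat.homLinearEquiv (S := L))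
    let φ : E L N M 0 →ₗ[L] (N →ₗ[L] M) := e.toLinearMap
    have hφ : Function.Injective φ := e.injective
    let ψ : (N →ₗ[L] M) →ₗ[L] (Fin a → M) :=
      LinearMap.pi fun i => LinearMap.applyₗ (f (Pi.single i 1))
    have hψ : Function.Injective ψ := by
      intro g h hgh
      have : g ∘ₗ f = h ∘ₗ f := by
        apply (Pi.basisFun L (Fin a)).ext
        intro i
        have := congrFun hgh i
        simpa [ψ] using this
      ext v
      obtain ⟨w, rfl⟩ := hf v
      exact congrArg (fun k => k w) this
    exact isArtinian_of_injective (ψ ∘ₗ φ) (hψ.comp hφ)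
  | succ j ih =>
    intro N _ _ _
    obtain ⟨a, f, hf⟩ := Module.Finite.exists_fin' L N
    let K := LinearMap.ker f
    haveI := ih K
    have h : SES K.subtype f := ⟨K.injective_subtype, hf, LinearMap.exact_subtype_ker_map f⟩
    exact isArtinian_of_surjective _ (dC h M j) (dC_surj h j)

end Melk

section FBL
variable {L : Type u} [CommRing L] [IsLocalRing L]

/-- A module over a field quotient: Artinian implies finite. -/
lemma fin_of_art {V : Type u} [AddCommGroup V] [Module L V]
    (hm : ∀ a ∈ IsLocalRing.maximalIdeal L, ∀ v : V, a • v = 0) (hA : IsArtinian L V) :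
    Module.Finite L V := by
  have htor : Module.IsTorsionBySet L V (IsLocalRing.maximalIdeal L : Set L) :=
    fun v a => hm a a.2 v
  letI : Module (L ⧸ IsLocalRing.maximalIdeal L) V := htor.module
  haveI : IsScalarTower L (L ⧸ IsLocalRing.maximalIdeal L) V := htor.isScalarTower
  letI : Field (L ⧸ IsLocalRing.maximalIdeal L) := Ideal.Quotient.field _
  haveI : IsArtinian (L ⧸ IsLocalRing.maximalIdeal L) V := isArtinian_of_tower L hA
  haveI : Module.Finite (L ⧸ IsLocalRing.maximalIdeal L) V := by
    let b := Module.Basis.ofVectorSpace (L ⧸ IsLocalRing.maximalIdeal L) V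
    haveI : Finite (Module.Basis.ofVectorSpaceIndex (L ⧸ IsLocalRing.maximalIdeal L) V) :=
      IsArtinian.finite_of_linearIndependent (Module.Basis.ofVectorSpaceIndex.linearIndependent
        (L ⧸ IsLocalRing.maximalIdeal L) V)
    exact Module.Finite.of_basis b
  exact Module.Finite.trans (L ⧸ IsLocalRing.maximalIdeal L) _

lemma art_of_fin {V : Type u} [AddCommGroup V] [Module L V]
    (hm : ∀ a ∈ IsLocalRing.maximalIdeal L, ∀ v : V, a • v = 0) (hA : Module.Finite L V) :
    IsArtinian L V := by
  have htor : Module.IsTorsionBySet L V (IsLocalRing.maximalIdeal L : Set L) :=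
    fun v a => hm a a.2 v
  letI : Module (L ⧸ IsLocalRing.maximalIdeal L) V := htor.module
  haveI : IsScalarTower L (L ⧸ IsLocalRing.maximalIdeal L) V := htor.isScalarTower
  letI : Field (L ⧸ IsLocalRing.maximalIdeal L) := Ideal.Quotient.field _
  haveI : Module.Finite (L ⧸ IsLocalRing.maximalIdeal L) V := Module.Finite.of_restrictScalars_finite L _ _
  have : IsArtinian (L ⧸ IsLocalRing.maximalIdeal L) V := inferInstance
  exact isArtinian_of_surjective_algebraMap (S := L) (R := L ⧸ IsLocalRing.maximalIdeal L)
    Ideal.Quotient.mk_surjective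

abbrev KL (L : Type u) [CommRing L] [IsLocalRing L] : Type u := IsLocalRing.ResidueField L

lemma KL_kill (a : L) (ha : a ∈ IsLocalRing.maximalIdeal L) (v : KL L) : a • v = 0 := by
  rw [Algebra.smul_def]
  have : algebraMap L (KL L) a = 0 := (IsLocalRing.residue_eq_zero_iff a).2 ha
  rw [this, zero_mul]

/-- all Bass numbers finite -/
def FBL (M : Type u) [AddCommGroup M] [Module L M] : Prop := ∀ j, Module.Finite L (E L (KL L) M j)

variable [IsNoetherianRing L] {M N Q : Type u} [AddCommGroup M] [Module L M]
    [AddCommGroup N] [Module L N] [AddCommGroup Q] [Module L Q]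

lemma fin_mid {f : M →ₗ[L] N} {g : N →ₗ[L] Q} (hex : Function.Exact f g)
    (h1 : Module.Finite L M) (h2 : Module.Finite L Q) : Module.Finite L N := by
  haveI : IsNoetherian L M := isNoetherian_of_isNoetherianRing_of_finite _ _
  haveI : IsNoetherian L Q := isNoetherian_of_isNoetherianRing_of_finite _ _
  haveI : IsNoetherian L N := isNoetherian_of_range_eq_ker f g hex.linearMap_ker_eq.symm
  infer_instance

lemma FBL_mid {f : M →ₗ[L] N} {g : N →ₗ[L] Q} (h : SES f g) (h1 : FBL (L := L) M)
    (h2 : FBL (L := L) Q) : FBL (L := L) N := fun j => fin_mid (exV2 h j) (h1 j) (h2 j)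

lemma FBL_left {f : M →ₗ[L] N} {g : N →ₗ[L] Q} (h : SES f g) (h1 : FBL (L := L) N)
    (h2 : FBL (L := L) Q) : FBL (L := L) M := by
  intro j
  cases j with
  | zero =>
    haveI := h1 0
    exact Module.Finite.of_injective (post f (KL L) 0) (post_inj0 h)
  | succ j => exact fin_mid (exV1 h j) (h2 j) (h1 (j+1))

lemma FBL_unit (a : L) (ha : a ∈ IsLocalRing.maximalIdeal L) (b : M →ₗ[L] M)
    (hb : ∀ v, a • b v = v) : FBL (L := L) M := by
  intro j
  haveI : Subsingleton (E L (KL L) M j) := subsingleton_of_forall_eq 0 fun x =>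
    ext_zero_of_sum (ι := Unit) (fun _ => a) (fun _ => b) (by ext v; simpa using hb v)
      (fun _ v => KL_kill a ha v) j x
  infer_instance

/-- kernel and cokernel of multiplication by an element of the maximal ideal -/
lemma FBL_mul {W : Type u} [AddCommGroup W] [Module L W]
    {f : M →ₗ[L] N} {g : N →ₗ[L] Q} (h : SES f g) {f' : Q →ₗ[L] N} {g' : N →ₗ[L] W}
    (h' : SES f' g') (a : L) (ha : a ∈ IsLocalRing.maximalIdeal L) (hc : ∀ v, f' (g v) = a • v)
    (h1 : FBL (L := L) M) (h2 : FBL (L := L) W) : FBL (L := L) N := by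
  intro j
  have hz : ∀ x : E L (KL L) N j, post f' (KL L) j (post g (KL L) j x) = 0 := by
    intro x
    rw [post_post]
    have : f' ∘ₗ g = a • LinearMap.id := by ext v; exact hc v
    rw [this, post_smul]
    exact ext_smul_eq_zero _ (KL_kill a ha) _ _
  let K := LinearMap.ker (post (R := L) f' (KL L) j)
  have hK : Module.Finite L K := by
    cases j with
    | zero =>
      haveI : Subsingleton K := subsingleton_of_forall_eq 0 fun x => by
        apply Subtype.ext
        apply post_inj0 (Y := KL L) h'
        rw [x.2]; simp
      infer_instance
    | succ j =>
      haveI := h2 j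
      refine Module.Finite.of_surjective ((dV h' (KL L) j).codRestrict K fun x => ?_) ?_
      · exact (exV1 h' j).apply_apply_eq_zero x
      · rintro ⟨x, hx⟩
        obtain ⟨y, rfl⟩ := (exV1 h' j x).1 hx
        exact ⟨y, rfl⟩
  refine fin_mid (f := post f (KL L) j) (g := (post g (KL L) j).codRestrict K hz) ?_ (h1 j) hK
  intro x
  rw [← exV2 h j x]
  constructor
  · exact fun h => congrArg Subtype.val h
  · exact fun h => Subtype.ext h

lemma FBL_art (s : Finset L) (hs : Ideal.span (s : Set L) = IsLocalRing.maximalIdeal L)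
    (htor : ∀ x ∈ s, ∀ v : M, ∃ k : ℕ, x ^ k • v = 0) (hf : Module.Finite L (soc L M)) :
    FBL (L := L) M := by
  intro j
  have h1 : IsArtinian L (soc L M) := art_of_fin (fun a ha v => Subtype.ext ((mem_soc _).1 v.2 a ha)) hf
  have h2 : IsArtinian L M := melk s M htor (by
    have : Submodule.torsionBySet L M (s : Set L) = soc L M := by
      rw [soc, ← hs]
      exact Submodule.torsionBySet_eq_torsionBySet_span _
    rw [this]; exact h1)
  haveI : Module.Finite L (KL L) := Module.Finite.of_surjective (Algebra.linearMap L (KL L))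
    IsLocalRing.residue_surjective
  exact fin_of_art (fun a ha x => ext_smul_eq_zero _ (KL_kill a ha) _ _) (ext_artinian h2 j (KL L))

end FBL
end LCB

end

noncomputable section
open CategoryTheory Opposite
namespace LCB

section FB
variable {R : Type u} [CommRing R] [IsNoetherianRing R] (P : Ideal R) [P.IsPrime]
variable {M N Q : Type u} [AddCommGroup M] [Module R M] [AddCommGroup N] [Module R N]
   [AddCommGroup Q] [Module R Q]

/-- Finite Bass numbers at P -/
def FB (M : Type u) [AddCommGroup M] [Module R M] : Prop := FBL (L := LP P) (MP P M)

lemma mem_max {p : R} (hp : p ∈ P) : algebraMap R (LP P) p ∈ IsLocalRing.maximalIdeal (LP P) :=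
  (IsLocalization.AtPrime.to_map_mem_maximal_iff _ P p).2 hp

lemma mp_smul_id (p : R) (h : M →ₗ[R] M) (hh : ∀ v, h v = p • v) (v : MP P M) :
    mp P h v = algebraMap R (LP P) p • v := by
  induction v using LocalizedModule.induction_on with
  | _ m s =>
    rw [algebraMap_smul, LocalizedModule.map_mk, hh, LocalizedModule.smul'_mk]

lemma mp_comp (f : M →ₗ[R] N) (g : N →ₗ[R] Q) (v : MP P M) :
    mp P g (mp P f v) = mp P (g ∘ₗ f) v := by
  induction v using LocalizedModule.induction_on with
  | _ m s =>
    rw [LocalizedModule.map_mk, LocalizedModule.map_mk, LocalizedModule.map_mk]; rfl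

lemma FB_mid {f : M →ₗ[R] N} {g : N →ₗ[R] Q} (h : SES f g) (h1 : FB P M) (h2 : FB P Q) : FB P N :=
  FBL_mid (mp_ses P h) h1 h2

lemma FB_left {f : M →ₗ[R] N} {g : N →ₗ[R] Q} (h : SES f g) (h1 : FB P N) (h2 : FB P Q) : FB P M :=
  FBL_left (mp_ses P h) h1 h2

lemma FB_unit (p : R) (hp : p ∈ P) (b : M →ₗ[R] M) (hb : ∀ v, p • b v = v) : FB P M := by
  refine FBL_unit (algebraMap R (LP P) p) (mem_max P hp) (mp P b) fun v => ?_
  rw [← mp_smul_id P p (p • LinearMap.id) (fun _ => rfl), mp_comp]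
  have : (p • LinearMap.id) ∘ₗ b = (1 : R) • (LinearMap.id : M →ₗ[R] M) := by
    ext v; simpa using hb v
  rw [this, mp_smul_id P 1 _ (fun _ => rfl), map_one, one_smul]

lemma FB_loc (p : R) (hp : p ∈ P) : FB P (LocalizedModule (Submonoid.powers p) M) := by
  obtain ⟨w, hw⟩ := IsLocalizedModule.map_units (LocalizedModule.mkLinearMap (Submonoid.powers p) M)
    ⟨p, Submonoid.mem_powers p⟩
  refine FB_unit P p hp (↑w⁻¹ : Module.End R _) fun v => ?_
  have h := congrArg (fun g : Module.End R (LocalizedModule (Submonoid.powers p) M) => g v) w.mul_inv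
  rw [hw] at h
  exact h

lemma FB_mul {W : Type u} [AddCommGroup W] [Module R W]
    {f : M →ₗ[R] N} {g : N →ₗ[R] Q} (h : SES f g) {f' : Q →ₗ[R] N} {g' : N →ₗ[R] W}
    (h' : SES f' g') (p : R) (hp : p ∈ P) (hc : ∀ v, f' (g v) = p • v)
    (h1 : FB P M) (h2 : FB P W) : FB P N :=
  FBL_mul (mp_ses P h) (mp_ses P h') (algebraMap R (LP P) p) (mem_max P hp) (fun v => by
    rw [mp_comp, mp_smul_id P p _ hc]) h1 h2

lemma FB_art (s : Finset R) (hs : Ideal.span (s : Set R) = P)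
    (htor : ∀ x ∈ s, ∀ v : M, ∃ k : ℕ, x ^ k • v = 0) (hf : FS P M) : FB P M := by
  classical
  refine FBL_art (s.image (algebraMap R (LP P))) ?_ ?_ hf
  · rw [Finset.coe_image, ← Ideal.map_span, hs]
    exact Localization.AtPrime.map_eq_maximalIdeal
  · intro x hx v
    obtain ⟨y, hy, rfl⟩ := Finset.mem_image.1 hx
    induction v using LocalizedModule.induction_on with
    | _ m t =>
      obtain ⟨k, hk⟩ := htor y hy m
      refine ⟨k, ?_⟩
      rw [← map_pow, algebraMap_smul, LocalizedModule.smul'_mk, hk, LocalizedModule.zero_mk]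

end FB

section FBE
variable {A : Type u} [CommRing A] [IsNoetherianRing A] {n : ℕ}

lemma ExtHol.fb_aux (P : Ideal (MvPolynomial (Fin n) A)) [P.IsPrime]
    (hm : (P.comap (MvPolynomial.C : A →+* MvPolynomial (Fin n) A)).IsMaximal)
    (t : Finset (MvPolynomial (Fin n) A)) (ht : Ideal.span (t : Set (MvPolynomial (Fin n) A)) = P)
    (s : Finset (MvPolynomial (Fin n) A)) :
    s ⊆ t → ∀ (X : Type u) [AddCommGroup X] [Module (MvPolynomial (Fin n) A) X] (d : TD A n X),
    ExtHol d → (∀ p ∈ t, p ∉ s → ∀ v : X, ∃ k : ℕ, p ^ k • v = 0) → FB P X := by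
  classical
  induction s using Finset.induction_on with
  | empty =>
    intro _ X _ _ d h htor
    exact FB_art P t ht (fun p hp => htor p hp (by simp)) (h.fs P hm)
  | insert f s hf ih =>
    intro hst X _ _ d h htor
    have hs : s ⊆ t := fun x hx => hst (Finset.mem_insert_of_mem hx)
    have hft : f ∈ t := hst (Finset.mem_insert_self _ _)
    have hfP : f ∈ P := ht ▸ Ideal.subset_span hft
    let ι := LocalizedModule.mkLinearMap (Submonoid.powers f) X
    have hι : Eqv d (d.loc (Submonoid.powers f)) ι := TD.loc_eqv _ d
    have h1 : FB P (LinearMap.ker ι) := by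
      refine ih hs _ (d.sub (LinearMap.ker ι) (ker_st hι))
        (h.of_inj (TD.sub_eqv _ _ _) (Submodule.injective_subtype _)) ?_
      rintro p hp hps ⟨v, hv⟩
      by_cases hpf : p = f
      · subst hpf
        obtain ⟨⟨_, k, rfl⟩, hk⟩ := (IsLocalizedModule.eq_zero_iff (Submonoid.powers p) ι).1 hv
        exact ⟨k, Subtype.ext hk⟩
      · obtain ⟨k, hk⟩ := htor p hp (by simp [hpf, hps]) v
        exact ⟨k, Subtype.ext hk⟩
    have h2 : FB P (LocalizedModule (Submonoid.powers f) X ⧸ LinearMap.range ι) := by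
      refine ih hs _ ((d.loc _).quot (LinearMap.range ι) (range_st hι))
        ((h.loc f).of_surj (TD.quot_eqv _ _ _) (Submodule.mkQ_surjective _)) ?_
      intro p hp hps v
      obtain ⟨v, rfl⟩ := Submodule.mkQ_surjective _ v
      obtain ⟨⟨u, ⟨_, m, rfl⟩⟩, hu⟩ := IsLocalizedModule.surj (Submonoid.powers f) ι v
      have hu' : f ^ m • v = ι u := hu
      by_cases hpf : p = f
      · subst hpf
        refine ⟨m, ?_⟩
        rw [← map_smul, hu']
        exact (Submodule.Quotient.mk_eq_zero _).2 ⟨u, rfl⟩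
      · obtain ⟨k, hk⟩ := htor p hp (by simp [hpf, hps]) u
        refine ⟨k, ?_⟩
        rw [← map_smul]
        have : p ^ k • v = 0 := by
          have hinj := (IsLocalizedModule.smul_inj ι (⟨f ^ m, m, rfl⟩ : Submonoid.powers f)
            (p ^ k • v) 0).1
          apply hinj
          change f ^ m • (p ^ k • v) = f ^ m • 0
          rw [smul_comm, hu', ← map_smul, hk, map_zero, smul_zero]
        rw [this, map_zero]
    have h3 : FB P (LinearMap.range ι) := by
      refine FB_left P (f := (LinearMap.range ι).subtype) (g := (LinearMap.range ι).mkQ)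
        ⟨Submodule.injective_subtype _, Submodule.mkQ_surjective _, LinearMap.exact_subtype_mkQ _⟩
        (FB_loc P f hfP) h2
    refine FB_mid P (f := (LinearMap.ker ι).subtype) (g := ι.rangeRestrict)
      ⟨Submodule.injective_subtype _, ι.surjective_rangeRestrict, ?_⟩ h1 h3
    rw [LinearMap.exact_iff, LinearMap.ker_rangeRestrict, Submodule.range_subtype]

lemma ExtHol.fb (P : Ideal (MvPolynomial (Fin n) A)) [P.IsPrime]
    (hm : (P.comap (MvPolynomial.C : A →+* MvPolynomial (Fin n) A)).IsMaximal)
    {X : Type u} [AddCommGroup X] [Module (MvPolynomial (Fin n) A) X] {d : TD A n X}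
    (h : ExtHol d) : FB P X := by
  obtain ⟨t, ht⟩ := (isNoetherianRing_iff_ideal_fg (MvPolynomial (Fin n) A)).1 inferInstance P
  exact ExtHol.fb_aux P hm t ht t le_rfl X d h (fun p hp hp' => absurd hp hp')

lemma Good.fb (P : Ideal (MvPolynomial (Fin n) A)) [P.IsPrime]
    (hm : (P.comap (MvPolynomial.C : A →+* MvPolynomial (Fin n) A)).IsMaximal) (π : A)
    (hπ : (MvPolynomial.C π : MvPolynomial (Fin n) A) ∈ P)
    {X : Type u} [AddCommGroup X] [Module (MvPolynomial (Fin n) A) X] {d : TD A n X}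
    (h : Good π d) : FB P X := by
  refine FB_mul P (f := (LinearMap.ker (mu (n := n) π X)).subtype)
    (g := (mu (n := n) π X).rangeRestrict) ⟨Submodule.injective_subtype _,
      LinearMap.surjective_rangeRestrict _, ?_⟩
    (f' := (LinearMap.range (mu (n := n) π X)).subtype)
    (g' := (LinearMap.range (mu (n := n) π X)).mkQ)
    ⟨Submodule.injective_subtype _, Submodule.mkQ_surjective _, LinearMap.exact_subtype_mkQ _⟩
    (MvPolynomial.C π) hπ (fun v => mu_apply π v) (h.1.fb P hm) (h.2.fb P hm)
  rw [LinearMap.exact_iff, LinearMap.ker_rangeRestrict, Submodule.range_subtype]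

lemma FB.equiv (P : Ideal (MvPolynomial (Fin n) A)) [P.IsPrime] {X Y : Type u} [AddCommGroup X]
    [Module (MvPolynomial (Fin n) A) X] [AddCommGroup Y] [Module (MvPolynomial (Fin n) A) Y]
    (e : X ≃ₗ[MvPolynomial (Fin n) A] Y) (h : FB P Y) : FB P X := by
  refine FB_left P (Q := PUnit) (f := e.toLinearMap) (g := 0)
    ⟨e.injective, fun _ => ⟨0, Subsingleton.elim _ _⟩,
      fun y => ⟨fun _ => ⟨e.symm y, by simp⟩, fun _ => rfl⟩⟩ h ?_
  exact FB_unit P 0 P.zero_mem 0 fun v => Subsingleton.elim _ _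

lemma comap_max (π : A) (hπ : ringKrullDim (A ⧸ Ideal.span {π}) = 0) (p : Ideal A) [hp : p.IsPrime]
    (h : π ∈ p) : p.IsMaximal := by
  have hle : Ideal.span {π} ≤ p := by rwa [Ideal.span_singleton_le_iff_mem]
  haveI : Ring.KrullDimLE 0 (A ⧸ Ideal.span {π}) :=
    (Ring.krullDimLE_iff (n := 0)).2 (by rw [hπ]; rfl)
  haveI h1 : (p.map (Ideal.Quotient.mk (Ideal.span {π}))).IsPrime :=
    Ideal.map_isPrime_of_surjective Ideal.Quotient.mk_surjective (by rwa [Ideal.mk_ker])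
  have h2 : (p.map (Ideal.Quotient.mk (Ideal.span {π}))).IsMaximal :=
    Ideal.isMaximal_of_isPrime _
  have h3 := Ideal.comap_isMaximal_of_surjective (Ideal.Quotient.mk (Ideal.span {π}))
    Ideal.Quotient.mk_surjective (K := p.map (Ideal.Quotient.mk (Ideal.span {π})))
  rw [Ideal.comap_map_of_surjective _ Ideal.Quotient.mk_surjective] at h3
  rw [← RingHom.ker_eq_comap_bot, Ideal.mk_ker, sup_eq_left.2 hle] at h3
  exact h3

lemma final (π : A) (hreg : π ∈ nonZeroDivisors A) (hπ : ringKrullDim (A ⧸ Ideal.span {π}) = 0)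
    (I : Ideal (MvPolynomial (Fin n) A)) (i : ℕ)
    (P : Ideal (MvPolynomial (Fin n) A)) [P.IsPrime]
    (hP : algebraMap A (MvPolynomial (Fin n) A) π ∈ P) : FB P (LCm I i (MvPolynomial (Fin n) A)) := by
  obtain ⟨s, rfl⟩ := (isNoetherianRing_iff_ideal_fg (MvPolynomial (Fin n) A)).1 inferInstance I
  have hm : (P.comap (MvPolynomial.C : A →+* MvPolynomial (Fin n) A)).IsMaximal := 
    comap_max π hπ _ hP
  obtain ⟨Y, _, _, ⟨d, hd⟩, ⟨e⟩⟩ := lc_induct s (MvPolynomial (Fin n) A)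
    (fun M _ _ => ∃ d : TD A n M, Good π d) (fun M _ _ ⟨d, hd⟩ => hd.qm s) ⟨_, good_self π hreg hπ⟩ i
  exact FB.equiv P e ((hd.gm s).fb P hm π hP)

lemma final' (π : A) (hreg : π ∈ nonZeroDivisors A) (hπ : ringKrullDim (A ⧸ Ideal.span {π}) = 0)
    (I : Ideal (MvPolynomial (Fin n) A)) (i : ℕ)
    (P : Ideal (MvPolynomial (Fin n) A)) [P.IsPrime]
    (hP : algebraMap A (MvPolynomial (Fin n) A) π ∈ P) (j : ℕ) :
    Module.Finite (Localization.AtPrime P)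
      (((Ext (Localization.AtPrime P) (ModuleCat.{u} (Localization.AtPrime P)) j).obj
    (Opposite.op (ModuleCat.of _ (IsLocalRing.ResidueField (Localization.AtPrime P))))).obj
    (ModuleCat.of _ (LocalizedModule P.primeCompl ((localCohomology I i).obj (ModuleCat.of _ (MvPolynomial (Fin n) A)))))) := by
  haveI := final π hreg hπ I i P hP j
  exact Module.Finite.equiv (extEquiv _ _ j).symm

end FBE
end LCB

end

theorem bassNumbers_localCohomology_finite_of_CM_dim_one_polynomial
    (A : Type u) [CommRing A] [IsNoetherianRing A] (hCM : IsCohenMacaulayRing A)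
    (hA : ringKrullDim A = 1)
    (π : A) (hreg : π ∈ nonZeroDivisors A) (hπ : ringKrullDim (A ⧸ Ideal.span {π}) = 0)
    (n : ℕ) (I : Ideal (MvPolynomial (Fin n) A)) (i : ℕ)
    (P : Ideal (MvPolynomial (Fin n) A)) [P.IsPrime]
    (hP : algebraMap A (MvPolynomial (Fin n) A) π ∈ P) (j : ℕ) :
    Module.Finite (Localization.AtPrime P)
      (bassExtModule _ P j
        ((localCohomology I i).obj (ModuleCat.of _ (MvPolynomial (Fin n) A)))) := by
  exact LCB.final' π hreg hπ I i P hP j
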